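/- arXiv:1604.06973 — 2 statements merged into one kernel-verified Lean document; each statement's English description precedes it below -/
import Mathlib

section
/- Let X be an infinite set and α an automorphism of Fact(X). If (θ,θ') and (θ,θ'') are 3-atoms of Fact(X) with the same first coordinate, then α(θ,θ') and α(θ,θ'') have the same first coordinate. -/
/-- A factor pair is a pair of equivalence relations with `θ ∩ θ' = Δ` and `θ ∘ θ' = ∇`. -/
def IsFactorPair {X : Type*} (θ θ' : Setoid X) : Prop :=
  (∀ x y : X, θ x y ∧ θ' x y ↔ x = y) ∧
  ∀ x y : X, Relation.Comp (⇑θ) (⇑θ') x y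

/-- `Fact X`, the set of factor pairs of `X`. -/
def FactPair (X : Type*) : Type _ :=
  {p : Setoid X × Setoid X // IsFactorPair p.1 p.2}

/-- The order on `Fact X`: `(θ,θ') ≤ (φ,φ')` iff `φ ⊆ θ`, `θ' ⊆ φ'` and `φ∘θ' = θ'∘φ`. -/
def FactLE {X : Type*} (p q : FactPair X) : Prop :=
  q.1.1 ≤ p.1.1 ∧ p.1.2 ≤ q.1.2 ∧
    Relation.Comp (⇑q.1.1) (⇑p.1.2) = Relation.Comp (⇑p.1.2) (⇑q.1.1)

def FactLT {X : Type*} (p q : FactPair X) : Prop :=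
  FactLE p q ∧ p ≠ q

/-- The orthocomplementation `(θ,θ')^⊥ = (θ',θ)` on `Fact X`. -/
def FactPerp {X : Type*} (p : FactPair X) : FactPair X :=
  ⟨(p.1.2, p.1.1), by
    obtain ⟨h1, h2⟩ := p.2
    refine ⟨fun x y => ⟨fun h => (h1 x y).1 ⟨h.2, h.1⟩, ?_⟩, fun x y => ?_⟩
    · rintro rfl
      exact ⟨p.1.2.refl' x, p.1.1.refl' x⟩
    · obtain ⟨z, hz1, hz2⟩ := h2 y x
      exact ⟨z, p.1.2.symm' hz2, p.1.1.symm' hz1⟩⟩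

/-- `0 = (∇,Δ)` in `Fact X`. -/
def FactZero (X : Type*) : FactPair X :=
  ⟨(⊤, ⊥), by
    refine ⟨fun x y => ⟨fun h => ?_, ?_⟩, fun x y => ⟨y, ?_, ?_⟩⟩
    · simpa [Setoid.bot_def] using h.2
    · rintro rfl
      exact ⟨(⊤ : Setoid X).refl' x, (⊥ : Setoid X).refl' x⟩
    · simp [Setoid.top_def]
    · simp [Setoid.bot_def]⟩

/-- `1 = (Δ,∇)` in `Fact X`. -/
def FactOne (X : Type*) : FactPair X :=
  ⟨(⊥, ⊤), by
    refine ⟨fun x y => ⟨fun h => ?_, ?_⟩, fun x y => ⟨x, ?_, ?_⟩⟩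
    · simpa [Setoid.bot_def] using h.1
    · rintro rfl
      exact ⟨(⊥ : Setoid X).refl' x, (⊤ : Setoid X).refl' x⟩
    · simp [Setoid.bot_def]
    · simp [Setoid.top_def]⟩

/-- An atom of `Fact X`. -/
def IsFactAtom {X : Type*} (a : FactPair X) : Prop :=
  FactLT (FactZero X) a ∧ ∀ x : FactPair X, FactLT (FactZero X) x → ¬ FactLT x a

/-- An `n`-relation: every equivalence class has exactly `n` elements. -/
def IsNRel {X : Type*} (n : ℕ) (θ : Setoid X) : Prop :=
  ∀ x : X, Nat.card {y // θ x y} = n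

/-- A `p`-atom: an atom `(φ,φ')` such that `φ'` is a `p`-relation. -/
def IsPAtom {X : Type*} (p : ℕ) (a : FactPair X) : Prop :=
  IsFactAtom a ∧ IsNRel p a.1.2

/-- The image `σ(θ) = {(σ x, σ y) : (x,y) ∈ θ}` of an equivalence relation under a
permutation. -/
def permSetoid {X : Type*} (σ : Equiv.Perm X) (θ : Setoid X) : Setoid X :=
  ⟨fun a b => θ (σ.symm a) (σ.symm b),
    ⟨fun a => θ.refl' _, fun h => θ.symm' h, fun h1 h2 => θ.trans' h1 h2⟩⟩

/-- The action `Γ(σ)(θ,θ') = (σ(θ),σ(θ'))` of a permutation on factor pairs. -/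
def permFactPair {X : Type*} (σ : Equiv.Perm X) (t : FactPair X) : FactPair X :=
  ⟨(permSetoid σ t.1.1, permSetoid σ t.1.2), by
    obtain ⟨h1, h2⟩ := t.2
    refine ⟨fun x y => ⟨fun h => ?_, ?_⟩, fun x y => ?_⟩
    · exact σ.symm.injective ((h1 (σ.symm x) (σ.symm y)).1 ⟨h.1, h.2⟩)
    · rintro rfl
      exact ⟨t.1.1.refl' _, t.1.2.refl' _⟩
    · obtain ⟨w, hw1, hw2⟩ := h2 (σ.symm x) (σ.symm y)
      refine ⟨σ w, ?_, ?_⟩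
      · show t.1.1 (σ.symm x) (σ.symm (σ w))
        simpa using hw1
      · show t.1.2 (σ.symm (σ w)) (σ.symm y)
        simpa using hw2⟩

/-- An automorphism of `Fact X`: a bijection preserving `≤` in both directions and
commuting with `⊥`. -/
def IsFactAut {X : Type*} (α : FactPair X → FactPair X) : Prop :=
  Function.Bijective α ∧
  (∀ p q : FactPair X, FactLE p q ↔ FactLE (α p) (α q)) ∧
  ∀ p : FactPair X, α (FactPerp p) = FactPerp (α p)

/-- `Eq*(X)`: the equivalence relations on `X` that are `n`-relations for some `n ≥ 1`. -/
def EqStar (X : Type*) : Type _ :=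
  {θ : Setoid X // ∃ n : ℕ, 0 < n ∧ IsNRel n θ}

/-- A regular equivalence relation: any two classes are equinumerous. -/
def IsRegularRel {X : Type*} (θ : Setoid X) : Prop :=
  ∀ x y : X, Nonempty ({z // θ x z} ≃ {z // θ y z})

/-- The action of a permutation on `Eq*(X)`. -/
def permEqStar {X : Type*} (σ : Equiv.Perm X) (θ : EqStar X) : EqStar X :=
  ⟨permSetoid σ θ.1, by
    obtain ⟨n, hn, hrel⟩ := θ.2
    refine ⟨n, hn, fun x => ?_⟩
    have e : {y // (permSetoid σ θ.1) x y} ≃ {y // θ.1 (σ.symm x) y} :=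
      σ.symm.subtypeEquiv fun y => Iff.rfl
    rw [Nat.card_congr e]
    exact hrel (σ.symm x)⟩


namespace FactAux

variable {X : Type*}

lemma fp_eq (p : FactPair X) {x y : X} (h1 : p.1.1 x y) (h2 : p.1.2 x y) : x = y :=
  (p.2.1 x y).1 ⟨h1, h2⟩

lemma fp_ex (p : FactPair X) (x y : X) : ∃ z, p.1.1 x z ∧ p.1.2 z y := p.2.2 x y

lemma fp_ext {p q : FactPair X} (h1 : p.1.1 ≤ q.1.1) (h2 : p.1.2 ≤ q.1.2) : p = q := by
  apply Subtype.ext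
  apply Prod.ext
  · apply le_antisymm h1
    intro x y h
    obtain ⟨z, hz1, hz2⟩ := fp_ex p x y
    have : z = y := fp_eq q (q.1.1.trans' (q.1.1.symm' (h1 hz1)) h) (h2 hz2)
    exact this ▸ hz1
  · apply le_antisymm h2
    intro x y h
    obtain ⟨z, hz1, hz2⟩ := fp_ex p x y
    have : x = z := fp_eq q (h1 hz1) (q.1.2.trans' h (q.1.2.symm' (h2 hz2)))
    exact this ▸ hz2

/-- commutation, form 1 -/
lemma le_comm1 {p q : FactPair X} (h : FactLE p q) {x y z : X} (h1 : q.1.1 x y)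
    (h2 : p.1.2 y z) : ∃ t, p.1.2 x t ∧ q.1.1 t z := by
  have : Relation.Comp (⇑q.1.1) (⇑p.1.2) x z := ⟨y, h1, h2⟩
  rw [h.2.2] at this
  exact this

lemma le_comm2 {p q : FactPair X} (h : FactLE p q) {x y z : X} (h1 : p.1.2 x y)
    (h2 : q.1.1 y z) : ∃ t, q.1.1 x t ∧ p.1.2 t z := by
  have : Relation.Comp (⇑p.1.2) (⇑q.1.1) x z := ⟨y, h1, h2⟩
  rw [← h.2.2] at this
  exact this

/-- Some class of the second coordinate has at least three elements. -/
def Big (a : FactPair X) : Prop :=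
  ∃ p : Fin 3 → X, Function.Injective p ∧ ∀ i, a.1.2 (p 0) (p i)

open Classical in
/-- twisted index map -/
noncomputable def rho (a : FactPair X) (x0 : X) (A : Set X) (π : Equiv.Perm X) (x : X) : X :=
  if x ∈ A then π (Classical.choose (fp_ex a x x0)) else Classical.choose (fp_ex a x x0)

lemma choose_unique (a : FactPair X) (x0 x v : X) (h1 : a.1.1 x v) (h2 : a.1.2 x0 v) :
    Classical.choose (fp_ex a x x0) = v := by
  obtain ⟨h3, h4⟩ := Classical.choose_spec (fp_ex a x x0)
  exact fp_eq a (a.1.1.trans' (a.1.1.symm' h3) h1) (a.1.2.trans' h4 h2)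

lemma choose_congr (a : FactPair X) (x0 x y : X) (h1 : a.1.1 x y) :
    Classical.choose (fp_ex a x x0) = Classical.choose (fp_ex a y x0) := by
  obtain ⟨h3, h4⟩ := Classical.choose_spec (fp_ex a y x0)
  exact choose_unique a x0 x _ (a.1.1.trans' h1 h3) (a.1.2.symm' h4)

open Classical in
lemma twist_factor (a : FactPair X) (x0 : X) (A : Set X)
    (hA : ∀ x y, a.1.2 x y → x ∈ A → y ∈ A) (π : Equiv.Perm X)
    (hπ : ∀ x, a.1.2 x0 x ↔ a.1.2 x0 (π x)) :
    IsFactorPair (Setoid.ker (rho a x0 A π)) a.1.2 := by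
  refine ⟨fun x y => ⟨?_, ?_⟩, fun x y => ?_⟩
  · rintro ⟨h1, h2⟩
    have h1 : rho a x0 A π x = rho a x0 A π y := h1
    have hxy : x ∈ A ↔ y ∈ A := ⟨hA _ _ h2, hA _ _ (a.1.2.symm' h2)⟩
    have h3 : Classical.choose (fp_ex a x x0) = Classical.choose (fp_ex a y x0) := by
      unfold rho at h1
      by_cases hx : x ∈ A
      · have hy := hxy.1 hx
        simpa [hx, hy] using h1
      · have hy : y ∉ A := fun h => hx (hxy.2 h)
        simpa [hx, hy] using h1
    obtain ⟨h4, -⟩ := Classical.choose_spec (fp_ex a x x0)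
    obtain ⟨h5, -⟩ := Classical.choose_spec (fp_ex a y x0)
    rw [← h3] at h5
    exact fp_eq a (a.1.1.trans' h4 (a.1.1.symm' h5)) h2
  · rintro rfl
    exact ⟨rfl, a.1.2.refl' _⟩
  · -- find z with rho z = rho x and θ' z y
    obtain ⟨-, h4⟩ := Classical.choose_spec (fp_ex a x x0)
    have hv : ∃ v, a.1.2 x0 v ∧ rho a x0 A π x = if y ∈ A then π v else v := by
      by_cases hy : y ∈ A
      · refine ⟨π.symm (rho a x0 A π x), ?_, by simp [hy]⟩
        by_cases hx : x ∈ A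
        · simpa [rho, hx] using a.1.2.symm' h4
        · simp only [rho, hx, if_false]
          rw [hπ]; simpa using a.1.2.symm' h4
      · refine ⟨rho a x0 A π x, ?_, by simp [hy]⟩
        by_cases hx : x ∈ A
        · simp only [rho, hx, if_true]
          exact (hπ _).1 (a.1.2.symm' h4)
        · simpa [rho, hx] using a.1.2.symm' h4
    obtain ⟨v, hv1, hv2⟩ := hv
    obtain ⟨z, hz1, hz2⟩ := fp_ex a v y
    refine ⟨z, ?_, hz2⟩
    show rho a x0 A π x = rho a x0 A π z
    have hzA : z ∈ A ↔ y ∈ A := ⟨hA _ _ hz2, hA _ _ (a.1.2.symm' hz2)⟩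
    rw [hv2]
    simp only [rho, choose_unique a x0 z v (a.1.1.symm' hz1) hv1, hzA]

lemma viaEmb_mem (a : FactPair X) (p : Fin 3 ↪ X) (hp : ∀ i, a.1.2 (p 0) (p i))
    (π : Equiv.Perm (Fin 3)) (x : X) :
    a.1.2 (p 0) x ↔ a.1.2 (p 0) (π.viaEmbedding p x) := by
  by_cases hx : x ∈ Set.range p
  · obtain ⟨i, rfl⟩ := hx
    rw [Equiv.Perm.viaEmbedding_apply]
    exact ⟨fun _ => hp _, fun _ => hp _⟩
  · rw [Equiv.Perm.viaEmbedding_apply_of_notMem _ _ _ hx]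

/-- The twist lemma. -/
lemma twist (a : FactPair X) (hbig : Big a) (S : Set (FactPair X)) (hS : ∀ c ∈ S, FactLE a c)
    (A : Set X) (hA : ∀ x y, a.1.2 x y → x ∈ A → y ∈ A)
    (hA2 : ∀ c ∈ S, ∀ x y, c.1.1 x y → x ∈ A → y ∈ A)
    (x1 : X) (hx1 : x1 ∈ A) (x2 : X) (hx2 : x2 ∉ A) :
    6 ≤ {x : FactPair X | (∀ c ∈ S, FactLE x c) ∧ x.1.2 = a.1.2}.encard := by
  classical
  obtain ⟨p0, hinj, hp⟩ := hbig
  let p : Fin 3 ↪ X := ⟨p0, hinj⟩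
  have hp : ∀ i, a.1.2 (p 0) (p i) := hp
  let F : Equiv.Perm (Fin 3) → FactPair X := fun π =>
    ⟨(Setoid.ker (rho a (p 0) A (π.viaEmbedding p)), a.1.2),
      twist_factor a (p 0) A hA _ (viaEmb_mem a p hp π)⟩
  have hF : Function.Injective F := by
    intro π π' h
    ext i : 1
    obtain ⟨x, hxa, hxb⟩ := fp_ex a (p i) x1
    obtain ⟨y, hya, hyb⟩ := fp_ex a (p (π i)) x2
    have hxA : x ∈ A := hA _ _ (a.1.2.symm' hxb) hx1
    have hyA : y ∉ A := fun h => hx2 (hA _ _ hyb h)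
    have e1 := choose_unique a (p 0) x (p i) (a.1.1.symm' hxa) (hp i)
    have e2 := choose_unique a (p 0) y (p (π i)) (a.1.1.symm' hya) (hp _)
    have h1 : (F π).1.1 x y := by
      show rho _ _ _ _ _ = rho _ _ _ _ _
      simp only [rho, hxA, hyA, if_true, if_false, e1, e2, Equiv.Perm.viaEmbedding_apply]
    rw [h] at h1
    have h1 : rho _ _ _ _ _ = rho _ _ _ _ _ := h1
    simp only [rho, hxA, hyA, if_true, if_false, e1, e2, Equiv.Perm.viaEmbedding_apply] at h1
    exact (p.injective h1).symm
  have hsub : Set.range F ⊆ {x : FactPair X | (∀ c ∈ S, FactLE x c) ∧ x.1.2 = a.1.2} := by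
    rintro _ ⟨π, rfl⟩
    refine ⟨fun c hc => ⟨?_, (hS c hc).2.1, (hS c hc).2.2⟩, rfl⟩
    intro x y hxy
    show rho _ _ _ _ _ = rho _ _ _ _ _
    have hiff : x ∈ A ↔ y ∈ A := ⟨hA2 c hc _ _ hxy, hA2 c hc _ _ (c.1.1.symm' hxy)⟩
    have := choose_congr a (p 0) x y ((hS c hc).1 hxy)
    simp only [rho, hiff, this]
  refine le_trans ?_ (Set.encard_le_encard hsub)
  rw [← Set.image_univ, hF.encard_image, Set.encard_univ, ENat.card_eq_coe_fintype_card,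
    Fintype.card_perm]
  simp [Nat.factorial]

/-- common lower bounds of the common upper bounds -/
def TSet (a b : FactPair X) : Set (FactPair X) :=
  {x | ∀ c ∈ {c | FactLE a c ∧ FactLE b c}, FactLE x c}

lemma lam_closed (a : FactPair X) (S : Set (FactPair X)) (hS : ∀ c ∈ S, FactLE a c) (x : X) :
    let A := {z | ∃ v, Relation.EqvGen (fun s t => ∃ c ∈ S, c.1.1 s t) x v ∧ a.1.2 v z}
    (∀ y z, a.1.2 y z → y ∈ A → z ∈ A) ∧ (∀ c ∈ S, ∀ y z, c.1.1 y z → y ∈ A → z ∈ A) := by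
  refine ⟨?_, ?_⟩
  · rintro y z h ⟨v, hv, hy⟩
    exact ⟨v, hv, a.1.2.trans' hy h⟩
  · rintro c hc y z h ⟨v, hv, hy⟩
    obtain ⟨t, ht1, ht2⟩ := le_comm2 (hS c hc) hy h
    exact ⟨t, hv.trans _ _ _ (.rel _ _ ⟨c, hc, ht1⟩), ht2⟩

lemma lam_le (S : Set (FactPair X)) (θ : Setoid X) (hS : ∀ c ∈ S, c.1.1 ≤ θ) {x y : X}
    (h : Relation.EqvGen (fun s t => ∃ c ∈ S, c.1.1 s t) x y) : θ x y := by
  induction h with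
  | rel s t h => obtain ⟨c, hc, h⟩ := h; exact hS c hc h
  | refl s => exact θ.refl' s
  | symm s t _ ih => exact θ.symm' ih
  | trans s t u _ _ ih1 ih2 => exact θ.trans' ih1 ih2

/-- Either the twist applies or the join of first coordinates is the first coordinate. -/
lemma lam_main (a : FactPair X) (hbig : Big a) (S : Set (FactPair X)) (hS : ∀ c ∈ S, FactLE a c)
    (hcard : ¬ 6 ≤ {x : FactPair X | (∀ c ∈ S, FactLE x c) ∧ x.1.2 = a.1.2}.encard)
    (x y : X) (h : a.1.1 x y) :
    Relation.EqvGen (fun s t => ∃ c ∈ S, c.1.1 s t) x y := by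
  obtain ⟨h1, h2⟩ := lam_closed a S hS x
  by_cases hy : y ∈ {z | ∃ v, Relation.EqvGen (fun s t => ∃ c ∈ S, c.1.1 s t) x v ∧ a.1.2 v z}
  · obtain ⟨v, hv, hvy⟩ := hy
    have : a.1.1 x v := lam_le S a.1.1 (fun c hc => (hS c hc).1) hv
    have : v = y := fp_eq a (a.1.1.trans' (a.1.1.symm' this) h) hvy
    exact this ▸ hv
  · exact absurd (twist a hbig S hS _ h1 h2 x ⟨x, .refl x, a.1.2.refl' x⟩ y hy) hcard

lemma first_le (a b : FactPair X) (hbig : Big a) (hT : (TSet a b).encard ≤ 5) :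
    a.1.1 ≤ b.1.1 := by
  intro x y h
  have h2 := lam_main a hbig {c | FactLE a c ∧ FactLE b c} (fun c hc => hc.1) (by
    intro h6
    have : (6 : ℕ∞) ≤ 5 := h6.trans ((Set.encard_le_encard (fun x hx => hx.1)).trans hT)
    exact absurd this (by decide)) x y h
  exact lam_le _ b.1.1 (fun c hc => hc.2.1) h2

lemma TSet_comm (a b : FactPair X) : TSet a b = TSet b a := by
  ext x; simp only [TSet, Set.mem_setOf_eq, and_comm]

lemma first_eq (a b : FactPair X) (ha : Big a) (hb : Big b) (hT : (TSet a b).encard ≤ 5) :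
    a.1.1 = b.1.1 :=
  le_antisymm (first_le a b ha hT) (first_le b a hb (TSet_comm a b ▸ hT))

/-- The property recognizing 2-atoms. -/
def QProp (a : FactPair X) : Prop :=
  ∃ c, FactLE a c ∧ c ≠ a ∧ {x | FactLE x c ∧ x ≠ c ∧ ¬ FactLE x (FactPerp a)}.encard ≤ 5

lemma not_QProp (a : FactPair X) (hbig : Big a) : ¬ QProp a := by
  rintro ⟨c, hac, hne, hcard⟩
  apply hne
  have key : ¬ c.1.2 ≤ a.1.2 → c = a := by
    intro hc2
    have h := lam_main a hbig {c} (by rintro _ rfl; exact hac) (by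
      intro h6
      have hsub : {x : FactPair X | (∀ c' ∈ ({c} : Set (FactPair X)), FactLE x c') ∧
          x.1.2 = a.1.2} ⊆ {x | FactLE x c ∧ x ≠ c ∧ ¬ FactLE x (FactPerp a)} := by
        rintro x ⟨h1, h2⟩
        refine ⟨h1 c rfl, ?_, ?_⟩
        · rintro rfl
          exact hc2 h2.le
        · intro h3
          obtain ⟨p, hinj, hp⟩ := hbig
          have h4 : x.1.1 (p 0) (p 1) := h3.1 (hp 1)
          have h5 : x.1.2 (p 0) (p 1) := by rw [h2]; exact hp 1
          exact absurd (hinj (fp_eq x h4 h5)) (by decide)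
      have : (6 : ℕ∞) ≤ 5 := h6.trans ((Set.encard_le_encard hsub).trans hcard)
      exact absurd this (by decide))
    symm
    apply fp_ext
    · intro x y hxy
      refine lam_le {c} c.1.1 ?_ (h x y hxy)
      rintro _ rfl
      exact le_rfl
    · exact hac.2.1
  by_cases hc2 : c.1.2 ≤ a.1.2
  · exact fp_ext hac.1 hc2
  · exact key hc2

/-- Factor pair given by coordinate functions. -/
def mkF {F E : Type*} (f : X → F) (g : X → E) (h : Function.Bijective fun x => (f x, g x)) :
    FactPair X :=
  ⟨(Setoid.ker f, Setoid.ker g), by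
    refine ⟨fun x y => ⟨fun hh => h.1 (Prod.ext hh.1 hh.2), ?_⟩, fun x y => ?_⟩
    · rintro rfl; exact ⟨rfl, rfl⟩
    · obtain ⟨z, hz⟩ := h.2 (f x, g y)
      have hz := Prod.ext_iff.1 hz
      exact ⟨z, hz.1.symm, hz.2⟩⟩

lemma le_of_triple {F G E : Type*} (f : X → F) (g : X → G) (h : X → E)
    (hs : Function.Surjective fun x => (f x, g x, h x)) (p q : FactPair X)
    (hp1 : ∀ x y, p.1.1 x y ↔ f x = f y) (hp2 : ∀ x y, p.1.2 x y ↔ g x = g y ∧ h x = h y)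
    (hq1 : ∀ x y, q.1.1 x y ↔ f x = f y ∧ g x = g y) (hq2 : ∀ x y, q.1.2 x y ↔ h x = h y) :
    FactLE p q := by
  refine ⟨fun x y hh => ?_, fun x y hh => ?_, ?_⟩
  · exact (hp1 x y).2 ((hq1 x y).1 hh).1
  · exact (hq2 x y).2 ((hp2 x y).1 hh).2
  · ext x y
    constructor
    · rintro ⟨z, h1, h2⟩
      rw [hq1] at h1
      rw [hp2] at h2
      obtain ⟨w, hw⟩ := hs (f y, g x, h x)
      simp only [Prod.mk.injEq] at hw
      refine ⟨w, (hp2 _ _).2 ⟨hw.2.1.symm, hw.2.2.symm⟩, (hq1 _ _).2 ⟨hw.1, ?_⟩⟩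
      rw [hw.2.1, h1.2, h2.1]
    · rintro ⟨z, h1, h2⟩
      rw [hq1] at h2
      rw [hp2] at h1
      obtain ⟨w, hw⟩ := hs (f x, g y, h y)
      simp only [Prod.mk.injEq] at hw
      refine ⟨w, (hq1 _ _).2 ⟨hw.1.symm, ?_⟩, (hp2 _ _).2 ⟨hw.2.1, hw.2.2⟩⟩
      rw [hw.2.1, h1.1, h2.2]


lemma eq_zero_of_bot (a : FactPair X) (h : ∀ x y, a.1.1 x y) : a = FactZero X := by
  symm
  exact fp_ext (fun x y _ => h x y) (fun x y hxy => by
    have : x = y := hxy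
    exact this ▸ a.1.2.refl' x)

/-- classification of factor pairs of a four-element set -/
lemma four_class (R R' : Bool × Bool → Bool × Bool → Prop)
    (r1 : ∀ x, R x x) (s1 : ∀ x y, R x y → R y x) (t1 : ∀ x y z, R x y → R y z → R x z)
    (r2 : ∀ x, R' x x) (s2 : ∀ x y, R' x y → R' y x) (t2 : ∀ x y z, R' x y → R' y z → R' x z)
    (hd : ∀ x y, R x y → R' x y → x = y) (hc : ∀ x y, ∃ z, R x z ∧ R' z y) :
    (∀ x y, R x y) ∨ (∀ x y, R' x y) ∨
    ∃ f g : Bool × Bool → Bool, (f, g) ∈ ([(Prod.fst, Prod.snd), (Prod.snd, Prod.fst),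
      (Prod.fst, fun s => xor s.1 s.2), (Prod.snd, fun s => xor s.1 s.2),
      (fun s => xor s.1 s.2, Prod.fst), (fun s => xor s.1 s.2, Prod.snd)] :
      List ((Bool × Bool → Bool) × (Bool × Bool → Bool))) ∧
      (∀ x y, f x = f y → R x y) ∧ (∀ x y, g x = g y → R' x y) := by
  by_cases h1 : ∀ x, R (false, false) x → x = (false, false)
  · right; left
    have : ∀ y, R' (false, false) y := by
      intro y
      obtain ⟨z, hz1, hz2⟩ := hc (false, false) y
      rw [h1 z hz1] at hz2
      exact hz2
    exact fun x y => t2 _ _ _ (s2 _ _ (this x)) (this y)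
  by_cases h2 : ∀ x, R' x (false, false) → x = (false, false)
  · left
    have : ∀ y, R y (false, false) := by
      intro y
      obtain ⟨z, hz1, hz2⟩ := hc y (false, false)
      rw [h2 z hz2] at hz1
      exact hz1
    exact fun x y => t1 _ _ _ (this x) (s1 _ _ (this y))
  push Not at h1 h2
  obtain ⟨j, hj, hj0⟩ := h1
  obtain ⟨k, hk, hk0⟩ := h2
  have hjk : j ≠ k := by
    rintro rfl
    exact hj0 (hd _ _ hj (s2 _ _ hk)).symm
  obtain ⟨z, hz1, hz2⟩ := hc k j
  have z0 : z ≠ (false, false) := by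
    rintro rfl
    exact hk0 (hd _ _ hz1 hk)
  have zk : z ≠ k := by
    rintro rfl
    exact hj0 (hd _ _ (s1 _ _ hj) (t2 _ _ _ (s2 _ _ hz2) hk))
  have zj : z ≠ j := by
    rintro rfl
    exact hk0 (hd _ _ (t1 _ _ _ hz1 (s1 _ _ hj)) hk)
  right; right
  have hj' := s1 _ _ hj
  have hk' := s2 _ _ hk
  have hz1' := s1 _ _ hz1
  have hz2' := s2 _ _ hz2
  clear hc hd s1 s2 t1 t2
  obtain ⟨j1, j2⟩ := j
  obtain ⟨k1, k2⟩ := k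
  obtain ⟨z1, z2⟩ := z
  cases j1 <;> cases j2 <;> cases k1 <;> cases k2 <;> first | (exfalso; simp_all; done) | skip
  all_goals cases z1 <;> cases z2 <;> first | (exfalso; simp_all; done) | skip
  · refine ⟨Prod.fst, Prod.snd, by simp, ?_, ?_⟩ <;> simp_all
  · refine ⟨Prod.fst, fun s => xor s.1 s.2, by simp, ?_, ?_⟩ <;> simp_all
  · refine ⟨Prod.snd, Prod.fst, by simp, ?_, ?_⟩ <;> simp_all
  · refine ⟨Prod.snd, fun s => xor s.1 s.2, by simp, ?_, ?_⟩ <;> simp_all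
  · refine ⟨fun s => xor s.1 s.2, Prod.fst, by simp, ?_, ?_⟩ <;> simp_all
  · refine ⟨fun s => xor s.1 s.2, Prod.snd, by simp, ?_, ?_⟩ <;> simp_all


lemma two_core {Q : Type*} [Nonempty Q] (i u : X → Bool) (y : X → Q)
    (hbij : Function.Bijective fun x => (i x, u x, y x)) (a : FactPair X)
    (ha1 : ∀ x z, a.1.1 x z ↔ i x = i z) (ha2 : ∀ x z, a.1.2 x z ↔ u x = u z ∧ y x = y z) :
    QProp a := by
  classical
  let e : X ≃ Bool × Bool × Q := Equiv.ofBijective _ hbij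
  let P : Bool × Bool → Q → X := fun s q => e.symm (s.1, s.2, q)
  have eP : ∀ s q, (i (P s q), u (P s q), y (P s q)) = (s.1, s.2, q) :=
    fun s q => e.apply_symm_apply (s.1, s.2, q)
  have iP : ∀ s q, i (P s q) = s.1 := fun s q => congrArg (·.1) (eP s q)
  have uP : ∀ s q, u (P s q) = s.2 := fun s q => congrArg (·.2.1) (eP s q)
  have yP : ∀ s q, y (P s q) = q := fun s q => congrArg (·.2.2) (eP s q)
  let c2 : X → Bool × Bool := fun x => (i x, u x)
  have cP : ∀ s q, c2 (P s q) = s := fun s q => Prod.ext (iP s q) (uP s q)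
  have Peq : ∀ x, P (c2 x) (y x) = x := fun x => e.symm_apply_apply x
  have Pinj : ∀ s s' q, P s q = P s' q → s = s' := by
    intro s s' q h
    rw [← cP s q, h, cP]
  let q0 : Q := Classical.arbitrary Q
  have hcb : Function.Bijective fun x => (c2 x, y x) := by
    constructor
    · intro x z h
      simp only [Prod.mk.injEq] at h
      rw [← Peq x, ← Peq z, h.1, h.2]
    · rintro ⟨s, q⟩
      exact ⟨P s q, by simp [cP, yP]⟩
  let c : FactPair X := mkF c2 y hcb
  have hE : ∀ p : (Bool × Bool → Bool) × (Bool × Bool → Bool),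
      (Function.Bijective fun s => (p.1 s, p.2 s)) →
      Function.Bijective fun x => (p.1 (c2 x), (p.2 (c2 x), y x)) := by
    intro p hp
    constructor
    · intro x z h
      simp only [Prod.mk.injEq] at h
      have : c2 x = c2 z := hp.1 (Prod.ext h.1 h.2.1)
      rw [← Peq x, ← Peq z, this, h.2.2]
    · rintro ⟨s, t, q⟩
      obtain ⟨w, hw⟩ := hp.2 (s, t)
      have hw := Prod.ext_iff.1 hw
      exact ⟨P w q, by simp only [cP, yP, Prod.mk.injEq, and_true]; exact ⟨hw.1, hw.2⟩⟩
  let N : (Bool × Bool → Bool) × (Bool × Bool → Bool) → FactPair X := fun p =>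
    if hp : Function.Bijective fun s => (p.1 s, p.2 s) then
      mkF (fun x => p.1 (c2 x)) (fun x => (p.2 (c2 x), y x)) (hE p hp) else a
  refine ⟨c, ?_, ?_, ?_⟩
  · refine le_of_triple i u y hbij.2 a c ha1 ha2 ?_ ?_
    · intro x z; exact Prod.ext_iff
    · intro x z; exact Iff.rfl
  · intro h
    have h1 : a.1.1 (P (false, false) q0) (P (false, true) q0) := by
      rw [ha1, iP, iP]
    rw [← h] at h1
    have h2 : c2 (P (false, false) q0) = c2 (P (false, true) q0) := h1
    rw [cP, cP] at h2
    simp at h2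
  · let L : Set ((Bool × Bool → Bool) × (Bool × Bool → Bool)) :=
      {(Prod.fst, Prod.snd), 
      (Prod.fst, fun s => xor s.1 s.2), (Prod.snd, fun s => xor s.1 s.2),
      (fun s => xor s.1 s.2, Prod.fst), (fun s => xor s.1 s.2, Prod.snd)}
    have hL : L.encard ≤ 5 := by
      refine (Set.encard_insert_le _ _).trans ?_
      have h4 : (5 : ℕ∞) = 4 + 1 := by norm_num
      have h3 : (4 : ℕ∞) = 3 + 1 := by norm_num
      have h2 : (3 : ℕ∞) = 2 + 1 := by norm_num
      rw [h4]; gcongr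
      refine (Set.encard_insert_le _ _).trans ?_
      rw [h3]; gcongr
      refine (Set.encard_insert_le _ _).trans ?_
      rw [h2]; gcongr
      refine (Set.encard_insert_le _ _).trans ?_
      rw [Set.encard_singleton]; norm_num
    refine le_trans (Set.encard_le_encard (t := N '' L) ?_) ((Set.encard_image_le _ _).trans hL)
    rintro x ⟨hxc, hne, hperp⟩
    have hb1 : ∀ s q q', x.1.1 (P s q) (P s q') := by
      intro s q q'
      apply hxc.1
      change c2 _ = c2 _
      rw [cP, cP]
    have yle : ∀ s t, x.1.2 s t → y s = y t := fun s t h => hxc.2.1 h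
    have tr : ∀ s t q q', x.1.2 (P s q) (P t q) → x.1.2 (P s q') (P t q') := by
      intro s t q q' h
      have h1 : c.1.1 (P s q') (P s q) := by
        change c2 _ = c2 _
        rw [cP, cP]
      obtain ⟨z, hz1, hz2⟩ := le_comm1 hxc h1 h
      have hy := yle _ _ hz1
      have hz2 : c2 z = c2 (P t q) := hz2
      rw [cP] at hz2
      rw [yP] at hy
      rw [← Peq z, hz2, ← hy] at hz1
      exact hz1
    have fin1 : ∀ f : Bool × Bool → Bool, (∀ s t, f s = f t → x.1.1 (P s q0) (P t q0)) →
        ∀ w z, f (c2 w) = f (c2 z) → x.1.1 w z := by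
      intro f hf w z h
      rw [← Peq w, ← Peq z]
      exact x.1.1.trans' (hb1 _ _ q0) (x.1.1.trans' (hf _ _ h) (hb1 _ _ _))
    have fin2 : ∀ f : Bool × Bool → Bool, (∀ s t, f s = f t → x.1.2 (P s q0) (P t q0)) →
        ∀ w z, f (c2 w) = f (c2 z) → y w = y z → x.1.2 w z := by
      intro f hf w z h hy
      rw [← Peq w, ← Peq z, hy]
      exact tr _ _ _ _ (hf _ _ h)
    rcases four_class (fun s t => x.1.1 (P s q0) (P t q0)) (fun s t => x.1.2 (P s q0) (P t q0))
      (fun s => x.1.1.refl' _) (fun s t h => x.1.1.symm' h) (fun s t r h1 h2 => x.1.1.trans' h1 h2)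
      (fun s => x.1.2.refl' _) (fun s t h => x.1.2.symm' h) (fun s t r h1 h2 => x.1.2.trans' h1 h2)
      (fun s t h1 h2 => Pinj _ _ _ (fp_eq x h1 h2))
      (fun s t => by
        obtain ⟨z, hz1, hz2⟩ := fp_ex x (P s q0) (P t q0)
        have hy := yle _ _ hz2
        rw [yP] at hy
        rw [← Peq z, hy] at hz1 hz2
        exact ⟨_, hz1, hz2⟩) with h | h | ⟨f, g, hmem, hf, hg⟩
    · exfalso
      apply hperp
      rw [eq_zero_of_bot x (fun w z => fin1 (fun _ => false) (fun s t _ => h s t) w z rfl)]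
      refine ⟨fun _ _ _ => trivial, ?_, ?_⟩
      · intro w z hwz
        have : w = z := hwz
        exact this ▸ (FactPerp a).1.2.refl' w
      · ext w z
        constructor
        · rintro ⟨t, h1, h2⟩
          have h2 : t = z := h2
          exact ⟨w, rfl, h2 ▸ h1⟩
        · rintro ⟨t, h1, h2⟩
          have h1 : w = t := h1
          exact ⟨z, h1 ▸ h2, rfl⟩
    · exfalso
      apply hne
      symm
      apply fp_ext
      · exact hxc.1
      · intro w z hwz
        exact fin2 (fun _ => false) (fun s t _ => h s t) w z rfl hwz
    · have hx : ∀ hp : Function.Bijective fun s => (f s, g s), N (f, g) = x := by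
        intro hp
        have : N (f, g) = mkF (fun x => f (c2 x)) (fun x => (g (c2 x), y x)) (hE (f, g) hp) :=
          dif_pos hp
        rw [this]
        apply fp_ext
        · intro w z h
          exact fin1 f hf w z h
        · intro w z h
          have h := Prod.ext_iff.1 (show (g (c2 w), y w) = (g (c2 z), y z) from h)
          exact fin2 g hg w z h.1 h.2
      by_cases hsp : (f, g) = (Prod.snd, Prod.fst)
      · exfalso
        apply hperp
        have hp : Function.Bijective fun s => (f s, g s) := by
          simp only [Prod.mk.injEq] at hsp
          rw [hsp.1, hsp.2]
          decide
        have h2 := hx hp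
        have : N (f, g) = mkF (fun x => f (c2 x)) (fun x => (g (c2 x), y x)) (hE (f, g) hp) :=
          dif_pos hp
        rw [← h2, this]
        simp only [Prod.mk.injEq] at hsp
        obtain ⟨rfl, rfl⟩ := hsp
        refine le_of_triple u y i ?_ _ _ ?_ ?_ ?_ ?_
        · rintro ⟨s, q, t⟩
          exact ⟨P (t, s) q, by simp [iP, uP, yP]⟩
        · intro x z; exact Iff.rfl
        · intro w z
          refine Iff.trans (Prod.ext_iff (x := ((i w : Bool), y w)) (y := (i z, y z))) ?_
          exact and_comm
        · exact ha2
        · exact ha1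
      · have hm : (f, g) ∈ L := by
          simp only [List.mem_cons, List.not_mem_nil, or_false] at hmem
          simp only [L, Set.mem_insert_iff, Set.mem_singleton_iff]
          tauto
        refine ⟨(f, g), hm, hx ?_⟩
        simp only [L, Set.mem_insert_iff, Set.mem_singleton_iff, Prod.mk.injEq] at hm
        rcases hm with ⟨rfl, rfl⟩ | ⟨rfl, rfl⟩ | ⟨rfl, rfl⟩ | ⟨rfl, rfl⟩ | ⟨rfl, rfl⟩ <;> decide

lemma exists_bool_prod (Y : Type*) [Infinite Y] : Nonempty (Y ≃ Bool × Y) := by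
  rw [← Cardinal.eq, Cardinal.mk_prod, Cardinal.lift_id', Cardinal.mk_bool, Cardinal.lift_ofNat]
  exact (Cardinal.mul_eq_right (Cardinal.aleph0_le_mk Y)
    ((Cardinal.natCast_lt_aleph0 (n := 2)).le.trans (Cardinal.aleph0_le_mk Y)) two_ne_zero).symm

lemma two_type_QProp [Infinite X] (a : FactPair X) (h0 : a ≠ FactZero X) (hb : ¬ Big a) :
    QProp a := by
  classical
  have hex : ∃ x y, x ≠ y ∧ a.1.2 x y := by
    by_contra hcon
    push Not at hcon
    apply h0
    apply eq_zero_of_bot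
    intro x y
    obtain ⟨z, h1, h2⟩ := fp_ex a x y
    by_cases h : z = y
    · exact h ▸ h1
    · exact absurd h2 (hcon _ _ h)
  obtain ⟨x, y, hxy, hxy2⟩ := hex
  have h3 : ∀ z, a.1.2 x z → z = x ∨ z = y := by
    intro z hz
    by_contra hcon
    push Not at hcon
    apply hb
    refine ⟨![x, y, z], ?_, ?_⟩
    · intro j k hjk
      fin_cases j <;> fin_cases k <;> simp_all
    · intro j
      fin_cases j
      · exact a.1.2.refl' _
      · exact hxy2
      · exact hz
  let i : X → Bool := fun z => decide (a.1.1 x z)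
  have hi1 : ∀ z, ¬ a.1.1 x z → a.1.1 y z := by
    intro z hz
    obtain ⟨t, h1, h2⟩ := fp_ex a z x
    rcases h3 t (a.1.2.symm' h2) with rfl | rfl
    · exact absurd (a.1.1.symm' h1) hz
    · exact a.1.1.symm' h1
  have hnxy : ¬ a.1.1 x y := fun h => hxy (fp_eq a h hxy2)
  have hi : ∀ z w, a.1.1 z w ↔ i z = i w := by
    intro z w
    constructor
    · intro h
      simp only [i, decide_eq_decide]
      exact ⟨fun h1 => a.1.1.trans' h1 h, fun h1 => a.1.1.trans' h1 (a.1.1.symm' h)⟩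
    · intro h
      simp only [i, decide_eq_decide] at h
      by_cases hz : a.1.1 x z
      · exact a.1.1.trans' (a.1.1.symm' hz) (h.1 hz)
      · exact a.1.1.trans' (a.1.1.symm' (hi1 z hz)) (hi1 w (fun h' => hz (h.2 h')))
  let Y := Quotient a.1.2
  let w : X → Y := fun z => Quotient.mk a.1.2 z
  have hw : ∀ z t, a.1.2 z t ↔ w z = w t := fun z t => Quotient.eq.symm
  have hbij : Function.Bijective fun z => (i z, w z) := by
    constructor
    · intro z t h
      simp only [Prod.mk.injEq] at h
      exact fp_eq a ((hi _ _).2 h.1) ((hw _ _).2 h.2)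
    · rintro ⟨b, q⟩
      obtain ⟨t, rfl⟩ := Quotient.exists_rep q
      have hb : ∃ z, i z = b := by
        cases b
        · exact ⟨y, by simpa [i] using hnxy⟩
        · exact ⟨x, by simpa [i] using a.1.1.refl' x⟩
      obtain ⟨z, rfl⟩ := hb
      obtain ⟨s, h1, h2⟩ := fp_ex a z t
      exact ⟨s, Prod.ext ((hi _ _).1 (a.1.1.symm' h1)) ((hw _ _).1 h2)⟩
  have : Infinite Y := by
    by_contra hf
    rw [not_infinite_iff_finite] at hf
    have := Finite.of_injective _ hbij.1
    exact not_finite X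
  obtain ⟨E⟩ := exists_bool_prod Y
  refine two_core i (fun z => (E (w z)).1) (fun z => (E (w z)).2) ?_ a hi ?_
  · exact ((Equiv.refl Bool).prodCongr E).bijective.comp hbij
  · intro z t
    rw [hw, ← Prod.ext_iff, E.injective.eq_iff]

set_option maxHeartbeats 2000000 in
/-- The computation of `TSet` for a simple step. -/
lemma TSet_le {Q : Type*} [Nontrivial Q] (i : X → Fin 3) (u : X → Bool) (y : X → Q)
    (hbij : Function.Bijective fun x => (i x, u x, y x)) (k : Fin 3) (a b : FactPair X)
    (ha1 : ∀ x z, a.1.1 x z ↔ i x = i z) (ha2 : ∀ x z, a.1.2 x z ↔ u x = u z ∧ y x = y z)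
    (hb1 : ∀ x z, b.1.1 x z ↔ i x = i z)
    (hb2 : ∀ x z, b.1.2 x z ↔ xor (u x) (decide (i x = k)) = xor (u z) (decide (i z = k)) ∧
      y x = y z) :
    (TSet a b).encard ≤ 5 := by
  classical
  let e : X ≃ Fin 3 × Bool × Q := Equiv.ofBijective _ hbij
  let P : Fin 3 → Bool → Q → X := fun j s q => e.symm (j, s, q)
  have eP : ∀ j s q, (i (P j s q), u (P j s q), y (P j s q)) = (j, s, q) :=
    fun j s q => e.apply_symm_apply (j, s, q)
  have iP : ∀ j s q, i (P j s q) = j := fun j s q => congrArg (·.1) (eP j s q)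
  have uP : ∀ j s q, u (P j s q) = s := fun j s q => congrArg (·.2.1) (eP j s q)
  have yP : ∀ j s q, y (P j s q) = q := fun j s q => congrArg (·.2.2) (eP j s q)
  have Peq : ∀ x, P (i x) (u x) (y x) = x := fun x => e.symm_apply_apply x
  have Pinj : ∀ j s q j' s' q', P j s q = P j' s' q' → j = j' ∧ s = s' ∧ q = q' := by
    intro j s q j' s' q' h
    have := e.symm.injective h
    simpa using this
  -- the elements c_v
  let c : (Q → Bool) → FactPair X := fun v =>
    mkF (fun x => (i x, xor (u x) (v (y x)))) y (by
      constructor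
      · intro x z h
        simp only [Prod.mk.injEq] at h
        obtain ⟨⟨h1, h2⟩, h3⟩ := h
        rw [h3] at h2
        apply hbij.1
        simp only [Prod.mk.injEq]
        exact ⟨h1, by simpa using h2, h3⟩
      · rintro ⟨⟨j, s⟩, q⟩
        refine ⟨P j (xor s (v q)) q, ?_⟩
        simp [iP, uP, yP])
  have hc : ∀ v, FactLE a (c v) ∧ FactLE b (c v) := by
    intro v
    constructor
    · refine le_of_triple i (fun x => xor (u x) (v (y x))) y ?_ a (c v) ha1 ?_ ?_ ?_
      · rintro ⟨j, s, q⟩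
        refine ⟨P j (xor s (v q)) q, ?_⟩
        simp [iP, uP, yP]
      · intro x z
        rw [ha2]
        constructor
        · rintro ⟨h1, h2⟩; simp [h1, h2]
        · rintro ⟨h1, h2⟩
          rw [h2] at h1
          exact ⟨by simpa using h1, h2⟩
      · intro x z
        exact Prod.ext_iff
      · intro x z; exact Iff.rfl
    · refine le_of_triple i (fun x => xor (xor (u x) (decide (i x = k))) (v (y x))) y ?_ b (c v)
        hb1 ?_ ?_ ?_
      · rintro ⟨j, s, q⟩
        refine ⟨P j (xor (xor s (v q)) (decide (j = k))) q, ?_⟩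
        simp only [iP, uP, yP, Prod.mk.injEq, true_and, and_true]
        cases s <;> cases v q <;> cases decide (j = k) <;> rfl
      · intro x z
        rw [hb2]
        constructor
        · rintro ⟨h1, h2⟩; simp only [h1, h2, and_self]
        · rintro ⟨h1, h2⟩
          rw [h2] at h1
          exact ⟨(Bool.xor_left_inj).1 h1, h2⟩
      · intro x z
        have : (c v).1.1 x z ↔ i x = i z ∧ xor (u x) (v (y x)) = xor (u z) (v (y z)) :=
          Prod.ext_iff
        rw [this]
        constructor
        · rintro ⟨h1, h2⟩
          refine ⟨h1, ?_⟩
          rw [h1]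
          revert h2
          cases u x <;> cases u z <;> cases v (y x) <;> cases v (y z) <;>
            cases decide (i z = k) <;> decide
        · rintro ⟨h1, h2⟩
          refine ⟨h1, ?_⟩
          rw [h1] at h2
          revert h2
          cases u x <;> cases u z <;> cases v (y x) <;> cases v (y z) <;>
            cases decide (i z = k) <;> decide
      · intro x z; exact Iff.rfl
  have ψP : ∀ v j s q j' s' q', (c v).1.1 (P j s q) (P j' s' q') ↔
      j = j' ∧ xor s (v q) = xor s' (v q') := by
    intro v j s q j' s' q'
    have : (c v).1.1 (P j s q) (P j' s' q') ↔ _ := Prod.ext_iff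
    rw [this]
    simp only [iP, uP, yP]
  obtain ⟨q0, q1, hq01⟩ := exists_pair_ne Q
  -- the possible elements
  let S : Bool × Bool → Fin 3 → Bool := fun s => ![false, s.1, s.2]
  let M : Bool × Bool → FactPair X := fun s =>
    mkF i (fun x => (xor (u x) (S s (i x)), y x)) (by
      constructor
      · intro x z h
        simp only [Prod.mk.injEq] at h
        obtain ⟨h1, h2, h3⟩ := h
        rw [h1] at h2
        apply hbij.1
        simp only [Prod.mk.injEq]
        exact ⟨h1, by simpa using h2, h3⟩
      · rintro ⟨j, t, q⟩
        refine ⟨P j (xor t (S s j)) q, ?_⟩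
        simp [iP, uP, yP])
  have hsub : TSet a b ⊆ insert (FactZero X) (Set.range M) := by
    intro x hx
    have hle : ∀ v, FactLE x (c v) := fun v => hx (c v) (hc v)
    -- 1: β contains ker i
    have row1 : ∀ j s q s' q', q ≠ q' → x.1.1 (P j s q) (P j s' q') := by
      intro j s q s' q' hne
      let v : Q → Bool := fun t => if t = q then s else s'
      have h1 : (c v).1.1 (P j s q) (P j s' q') := by
        rw [ψP]; simp [v, hne.symm]
      exact (hle v).1 h1
    have row : ∀ j s q s' q', x.1.1 (P j s q) (P j s' q') := by
      intro j s q s' q'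
      by_cases hne : q = q'
      · subst hne
        obtain ⟨r, hr⟩ := exists_ne q
        exact x.1.1.trans' (row1 j s q s r hr.symm) (row1 j s r s' q hr)
      · exact row1 _ _ _ _ _ hne
    have yle : ∀ s t, x.1.2 s t → y s = y t := fun s t h => (hle (fun _ => false)).2.1 h
    have tr1 : ∀ j s q j' s' d q', q ≠ q' → x.1.2 (P j s q) (P j' s' q) →
        x.1.2 (P j (xor s d) q') (P j' (xor s' d) q') := by
      intro j s q j' s' d q' hne h
      let v : Q → Bool := fun t => if t = q then d else false
      have h1 : (c v).1.1 (P j (xor s d) q') (P j s q) := by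
        rw [ψP]; simp [v, hne.symm]
      obtain ⟨t, ht1, ht2⟩ := le_comm1 (hle v) h1 h
      have hy := yle _ _ ht1
      rw [← Peq t] at ht1 ht2 hy
      rw [yP, yP] at hy
      rw [ψP, ← hy] at ht2
      obtain ⟨h3, h4⟩ := ht2
      simp only [v, hne.symm, if_true, if_false, Bool.xor_false] at h4
      rw [h3, h4, ← hy] at ht1
      exact ht1
    have tr : ∀ j s q j' s' d q', x.1.2 (P j s q) (P j' s' q) →
        x.1.2 (P j (xor s d) q') (P j' (xor s' d) q') := by
      intro j s q j' s' d q' h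
      by_cases hne : q = q'
      · subst hne
        obtain ⟨r, hr⟩ := exists_ne q
        have := tr1 _ _ _ _ _ false q hr (tr1 j s q j' s' d r hr.symm h)
        simpa using this
      · exact tr1 _ _ _ _ _ _ _ hne h
    by_cases hsep : ∀ j j', x.1.1 (P j false q0) (P j' false q0) → j = j'
    · right
      have hex : ∀ j, ∃ s, x.1.2 (P j s q0) (P 0 false q0) := by
        intro j
        obtain ⟨z, hz1, hz2⟩ := fp_ex x (P j false q0) (P 0 false q0)
        have hy := yle _ _ hz2
        rw [← Peq z] at hz1 hz2 hy
        rw [yP, yP] at hy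
        have := hsep j (i z) (x.1.1.trans' hz1 (row _ _ _ _ _))
        rw [← this, hy] at hz2
        exact ⟨_, hz2⟩
      obtain ⟨s1, hs1⟩ := hex 1
      obtain ⟨s2, hs2⟩ := hex 2
      refine ⟨(s1, s2), ?_⟩
      have hall : ∀ j, x.1.2 (P j (S (s1, s2) j) q0) (P 0 false q0) := by
        intro j
        fin_cases j
        · exact x.1.2.refl' _
        · exact hs1
        · exact hs2
      apply fp_ext
      · intro s t hst
        have hst : i s = i t := hst
        rw [← Peq s, ← Peq t, hst]
        exact row _ _ _ _ _
      · intro s t hst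
        have hst : xor (u s) (S (s1, s2) (i s)) = xor (u t) (S (s1, s2) (i t)) ∧ y s = y t :=
          Prod.ext_iff.1 hst
        have key : ∀ z, x.1.2 z (P 0 (xor (u z) (S (s1, s2) (i z))) (y z)) := by
          intro z
          have := tr _ _ _ _ _ (xor (u z) (S (s1, s2) (i z))) (y z) (hall (i z))
          rw [show xor (S (s1, s2) (i z)) (xor (u z) (S (s1, s2) (i z))) = u z by
            cases u z <;> cases S (s1, s2) (i z) <;> rfl, Peq, Bool.false_xor] at this
          exact this
        have h1 := key s
        rw [hst.1, hst.2] at h1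
        exact x.1.2.trans' h1 (x.1.2.symm' (key t))
    · left
      apply eq_zero_of_bot
      push Not at hsep
      obtain ⟨j, j', hjj, hne⟩ := hsep
      have hl : ∀ l, x.1.1 (P j false q0) (P l false q0) := by
        intro l
        by_contra hcon
        -- pigeonhole
        have hz : ∀ w : Bool × Bool, ∃ s, x.1.2 (P l s q0) (P (if w.1 then j else j') w.2 q0) := by
          intro w
          obtain ⟨z, hz1, hz2⟩ := fp_ex x (P l false q0) (P (if w.1 then j else j') w.2 q0)
          have hy := yle _ _ hz2
          rw [← Peq z] at hz1 hz2 hy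
          rw [yP, yP] at hy
          have hz3 : x.1.1 (P l false q0) (P (i z) false q0) := x.1.1.trans' hz1 (row _ _ _ _ _)
          have e1 : i z ≠ j := by
            intro h
            rw [h] at hz3
            exact hcon (x.1.1.symm' hz3)
          have e2 : i z ≠ j' := by
            intro h
            rw [h] at hz3
            exact hcon (x.1.1.trans' hjj (x.1.1.symm' hz3))
          have e3 : l ≠ j := by
            rintro rfl
            exact hcon (x.1.1.refl' _)
          have e4 : l ≠ j' := by
            rintro rfl
            exact hcon hjj
          have e5 : i z = l := by omega
          rw [e5, hy] at hz2
          exact ⟨_, hz2⟩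
        choose g hg using hz
        obtain ⟨w, w', hww, hgw⟩ := Fintype.exists_ne_map_eq_of_card_lt g (by simp)
        have h1 := hg w
        have h2 := hg w'
        rw [hgw] at h1
        have h3 := x.1.2.trans' (x.1.2.symm' h1) h2
        have hj : ∀ w : Bool × Bool, x.1.1 (P j false q0) (P (if w.1 then j else j') w.2 q0) := by
          rintro ⟨w1, w2⟩
          cases w1
          · exact x.1.1.trans' hjj (row _ _ _ _ _)
          · exact row _ _ _ _ _
        have h4 := fp_eq x (x.1.1.trans' (x.1.1.symm' (hj w)) (hj w')) h3
        obtain ⟨h5, h6, -⟩ := Pinj _ _ _ _ _ _ h4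
        apply hww
        obtain ⟨w1, w2⟩ := w
        obtain ⟨w1', w2'⟩ := w'
        simp only at h5 h6
        have h7 : w1 = w1' := by
          cases w1 <;> cases w1' <;>
            first | rfl | exact absurd h5 hne | exact absurd h5 hne.symm
        rw [h6, h7]
      intro s t
      rw [← Peq s, ← Peq t]
      exact x.1.1.trans' (x.1.1.trans' (row _ _ _ _ _) (x.1.1.symm' (hl (i s))))
        (x.1.1.trans' (hl (i t)) (row _ _ _ _ _))
  refine (Set.encard_le_encard hsub).trans ((Set.encard_insert_le _ _).trans ?_)
  have : (Set.range M).encard ≤ 4 := by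
    rw [← Set.image_univ]
    refine (Set.encard_image_le _ _).trans ?_
    rw [Set.encard_univ, ENat.card_eq_coe_fintype_card]
    simp
  calc (Set.range M).encard + 1 ≤ 4 + 1 := by gcongr
    _ = 5 := by norm_num


/-- Orbit setoid of an involution. -/
def orb {Y : Type*} (t : Y → Y) (ht : ∀ y, t (t y) = y) : Setoid Y :=
  ⟨fun x y => y = x ∨ y = t x, by
    refine ⟨fun x => Or.inl rfl, ?_, ?_⟩
    · rintro x y (rfl | rfl)
      · exact Or.inl rfl
      · exact Or.inr (ht x).symm
    · rintro x y z (rfl | rfl) (rfl | rfl)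
      · exact Or.inl rfl
      · exact Or.inr rfl
      · exact Or.inr rfl
      · exact Or.inl (ht x)⟩

lemma orb_out {Y : Type*} (t : Y → Y) (ht : ∀ y, t (t y) = y) (y : Y) :
    y = (Quotient.mk (orb t ht) y).out ∨ y = t (Quotient.mk (orb t ht) y).out :=
  Quotient.mk_out (s := orb t ht) y

lemma orb_infinite {Y : Type*} [Infinite Y] (t : Y → Y) (ht : ∀ y, t (t y) = y) :
    Infinite (Quotient (orb t ht)) := by
  by_contra hf
  rw [not_infinite_iff_finite] at hf
  have : Function.Surjective (fun p : Quotient (orb t ht) × Bool =>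
      if p.2 then p.1.out else t p.1.out) := by
    intro y
    rcases orb_out t ht y with h | h
    · exact ⟨(Quotient.mk _ y, true), h.symm⟩
    · exact ⟨(Quotient.mk _ y, false), h.symm⟩
  have := Finite.of_surjective _ this
  exact not_finite Y

lemma good_inv_fix {Y : Type*} (Good : Equiv.Perm Y → Prop)
    (hf : ∀ τ : Equiv.Perm Y, (∀ y, τ (τ y) = y) → (∀ y, τ y ≠ y) → Good τ)
    (hm : ∀ s t, Good s → Good t → Good (s * t)) (t : Equiv.Perm Y) (ht : ∀ y, t (t y) = y)
    (hinf : Infinite {y // t y = y}) : Good t := by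
  classical
  obtain ⟨E1⟩ := exists_bool_prod {y // t y = y}
  let E : {y // t y = y} ≃ Bool × (Bool × {y // t y = y}) :=
    E1.trans ((Equiv.refl Bool).prodCongr E1)
  let k : Bool × Bool → {y // t y = y} → {y // t y = y} := fun v y =>
    E.symm (xor (E y).1 v.1, (xor (E y).2.1 v.2, (E y).2.2))
  have kk : ∀ v w y, k v (k w y) = k (xor v.1 w.1, xor v.2 w.2) y := by
    intro v w y
    apply E.injective
    simp only [k, Equiv.apply_symm_apply, Prod.mk.injEq, and_true]
    constructor
    · cases (E y).1 <;> cases v.1 <;> cases w.1 <;> rfl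
    · cases (E y).2.1 <;> cases v.2 <;> cases w.2 <;> rfl
  have k0 : ∀ y, k (false, false) y = y := by
    intro y
    simp [k]
  have kne : ∀ v y, v ≠ (false, false) → k v y ≠ y := by
    intro v y hv h
    apply hv
    have h1 := congrArg E h
    simp only [k, Equiv.apply_symm_apply] at h1
    have h2 := congrArg (·.1) h1
    have h3 := congrArg (·.2.1) h1
    simp only at h2 h3
    ext
    · change v.1 = false
      revert h2
      cases (E y).1 <;> cases v.1 <;> decide
    · change v.2 = false
      revert h3
      cases (E y).2.1 <;> cases v.2 <;> decide
  let K : Bool × Bool → Y → Y := fun v y => if h : t y = y then k v ⟨y, h⟩ else t y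
  have K1 : ∀ v (y : {y // t y = y}), K v y = k v y := fun v y => dif_pos y.2
  have K2 : ∀ v y, t y ≠ y → K v y = t y := fun v y h => dif_neg h
  have tt : ∀ y, t y ≠ y → t (t y) ≠ t y := fun y h h' => h (t.injective h')
  have KK : ∀ v y, K v (K v y) = y := by
    intro v y
    by_cases h : t y = y
    · have := K1 v ⟨y, h⟩
      simp only at this
      rw [this, K1, kk]
      simp [k0]
    · rw [K2 v y h, K2 v _ (tt y h), ht]
  have Kne : ∀ v y, v ≠ (false, false) → K v y ≠ y := by
    intro v y hv
    by_cases h : t y = y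
    · have := K1 v ⟨y, h⟩
      simp only at this
      rw [this]
      intro h'
      exact kne v ⟨y, h⟩ hv (Subtype.ext h')
    · rw [K2 v y h]; exact h
  let KP : Bool × Bool → Equiv.Perm Y := fun v => ⟨K v, K v, KK v, KK v⟩
  have hg : ∀ v, v ≠ (false, false) → Good (KP v) := fun v hv => hf _ (KK v) (fun y => Kne v y hv)
  have : t = KP (true, true) * (KP (true, false) * KP (false, true)) := by
    ext y
    change t y = K _ (K _ (K _ y))
    by_cases h : t y = y
    · have := K1 (false, true) ⟨y, h⟩
      simp only at this
      rw [this, K1, K1, kk, kk]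
      simp [k0, h]
    · rw [K2 _ y h, K2 _ _ (tt y h), ht, K2 _ y h]
  rw [this]
  exact hm _ _ (hg _ (by decide)) (hm _ _ (hg _ (by decide)) (hg _ (by decide)))

lemma good_inv {Y : Type*} [Infinite Y] (Good : Equiv.Perm Y → Prop)
    (hf : ∀ τ : Equiv.Perm Y, (∀ y, τ (τ y) = y) → (∀ y, τ y ≠ y) → Good τ)
    (hm : ∀ s t, Good s → Good t → Good (s * t)) (t : Equiv.Perm Y) (ht : ∀ y, t (t y) = y) :
    Good t := by
  classical
  have := orb_infinite t ht
  obtain ⟨E⟩ := exists_bool_prod (Quotient (orb t ht))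
  let S : Y → Bool := fun y => (E (Quotient.mk _ y)).1
  have hS : ∀ y, S (t y) = S y := by
    intro y
    have : Quotient.mk (orb t ht) (t y) = Quotient.mk (orb t ht) y :=
      Quotient.sound (Or.inr (ht y).symm)
    simp only [S, this]
  let T : Bool → Y → Y := fun b y => if S y = b then t y else y
  have TT : ∀ b y, T b (T b y) = y := by
    intro b y
    by_cases h : S y = b
    · simp [T, hS, h, ht]
    · simp [T, h]
  let TP : Bool → Equiv.Perm Y := fun b => ⟨T b, T b, TT b, TT b⟩
  have hg : ∀ b, Good (TP b) := by
    intro b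
    refine good_inv_fix Good hf hm (TP b) (TT b) ?_
    have hout : ∀ o, S (E.symm (!b, o)).out = !b := by
      intro o
      simp [S]
    refine Infinite.of_injective (fun o : Quotient (orb t ht) =>
      (⟨(E.symm (!b, o)).out, ?_⟩ : {y // TP b y = y})) ?_
    · change T b _ = _
      simp [T, hout]
    · intro o o' h
      have h1 : (E.symm (!b, o)).out = (E.symm (!b, o')).out := congrArg Subtype.val h
      have h2 := Quotient.out_injective h1
      have h3 := E.symm.injective h2
      exact congrArg (·.2) h3
  have : t = TP true * TP false := by
    ext y
    change t y = T true (T false y)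
    by_cases h : S y = true
    · simp [T, h]
    · have h : S y = false := by simpa using h
      simp [T, h, hS]
  rw [this]
  exact hm _ _ (hg _) (hg _)

lemma good_all {Y : Type*} [Infinite Y] (Good : Equiv.Perm Y → Prop)
    (hf : ∀ τ : Equiv.Perm Y, (∀ y, τ (τ y) = y) → (∀ y, τ y ≠ y) → Good τ)
    (hm : ∀ s t, Good s → Good t → Good (s * t)) (g : Equiv.Perm Y) : Good g := by
  classical
  let Cy : Setoid Y := Equiv.Perm.SameCycle.setoid g
  let x0 : Y → Y := fun x => (Quotient.mk Cy x).out
  have hx0 : ∀ x, ∃ n : ℤ, (g ^ n) (x0 x) = x := fun x => Quotient.mk_out (s := Cy) x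
  choose n hn using hx0
  have hx0n : ∀ x (m : ℤ), x0 ((g ^ m) (x0 x)) = x0 x := by
    intro x m
    have : Quotient.mk Cy ((g ^ m) (x0 x)) = Quotient.mk Cy x := by
      apply Quotient.sound
      refine ⟨n x - m, ?_⟩
      rw [← Equiv.Perm.mul_apply, ← zpow_add, sub_add_cancel, hn]
    simp only [x0, this]
  let r : Y → Y := fun x => (g ^ (- n x)) (x0 x)
  have hr : ∀ x (m : ℤ), r ((g ^ m) (x0 x)) = (g ^ (-m)) (x0 x) := by
    intro x m
    have h := hn ((g ^ m) (x0 x))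
    simp only [r]
    rw [hx0n] at h ⊢
    have h2 := congrArg (g ^ (- n ((g ^ m) (x0 x)) - m)) h
    rw [← Equiv.Perm.mul_apply, ← Equiv.Perm.mul_apply, ← zpow_add, ← zpow_add] at h2
    ring_nf at h2 ⊢
    exact h2.symm
  have hrr : ∀ x, r (r x) = x := by
    intro x
    have : r x = (g ^ (- n x)) (x0 x) := rfl
    rw [this, hr, neg_neg, hn]
  let R : Equiv.Perm Y := ⟨r, r, hrr, hrr⟩
  have hs : ∀ x, (g * R) ((g * R) x) = x := by
    intro x
    change g (r (g (r x))) = x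
    have : r x = (g ^ (- n x)) (x0 x) := rfl
    rw [this]
    have h1 : g ((g ^ (- n x)) (x0 x)) = (g ^ (1 - n x)) (x0 x) := by
      rw [← Equiv.Perm.mul_apply, ← zpow_one_add]; rfl
    rw [h1, hr, ← Equiv.Perm.mul_apply, ← zpow_one_add]
    have : (1 + -(1 - n x)) = n x := by ring
    rw [this, hn]
  have : g = (g * R) * R := by
    ext x
    change g x = g (r (r x))
    rw [hrr]
  rw [this]
  exact hm _ _ (good_inv Good hf hm _ hs) (good_inv Good hf hm R hrr)

/-! ### Automorphisms -/

lemma zero_le (a : FactPair X) : FactLE (FactZero X) a := by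
  refine ⟨fun _ _ _ => trivial, ?_, ?_⟩
  · intro w z hwz
    have : w = z := hwz
    exact this ▸ a.1.2.refl' w
  · ext w z
    constructor
    · rintro ⟨t, h1, h2⟩
      have h2 : t = z := h2
      exact ⟨w, rfl, h2 ▸ h1⟩
    · rintro ⟨t, h1, h2⟩
      have h1 : w = t := h1
      exact ⟨z, h1 ▸ h2, rfl⟩

lemma eq_zero_of_le_zero (a : FactPair X) (h : FactLE a (FactZero X)) : a = FactZero X :=
  fp_ext (fun _ _ _ => trivial) h.2.1

lemma aut_zero {α : FactPair X → FactPair X} (hα : IsFactAut α) :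
    α (FactZero X) = FactZero X := by
  obtain ⟨z, hz⟩ := hα.1.2 (FactZero X)
  have h := (hα.2.1 _ _).1 (zero_le z)
  rw [hz] at h
  exact eq_zero_of_le_zero _ h

lemma aut_TSet {α : FactPair X → FactPair X} (hα : IsFactAut α) (a b : FactPair X) :
    (TSet (α a) (α b)).encard = (TSet a b).encard := by
  have : TSet (α a) (α b) = α '' TSet a b := by
    ext x
    obtain ⟨x, rfl⟩ := hα.1.2 x
    rw [hα.1.1.mem_set_image]
    constructor
    · rintro h c ⟨h1, h2⟩
      exact (hα.2.1 _ _).2 (h (α c) ⟨(hα.2.1 _ _).1 h1, (hα.2.1 _ _).1 h2⟩)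
    · rintro h c ⟨h1, h2⟩
      obtain ⟨c, rfl⟩ := hα.1.2 c
      exact (hα.2.1 _ _).1 (h c ⟨(hα.2.1 _ _).2 h1, (hα.2.1 _ _).2 h2⟩)
  rw [this, hα.1.1.encard_image]

lemma aut_QProp {α : FactPair X → FactPair X} (hα : IsFactAut α) (a : FactPair X)
    (h : QProp (α a)) : QProp a := by
  obtain ⟨c, h1, h2, h3⟩ := h
  obtain ⟨c, rfl⟩ := hα.1.2 c
  refine ⟨c, (hα.2.1 _ _).2 h1, fun h => h2 (h ▸ rfl), ?_⟩
  rw [← hα.1.1.encard_image]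
  refine (Set.encard_le_encard ?_).trans h3
  rintro _ ⟨x, ⟨g1, g2, g3⟩, rfl⟩
  refine ⟨(hα.2.1 _ _).1 g1, fun h => g2 (hα.1.1 h), fun h => g3 ?_⟩
  rw [← hα.2.2] at h
  exact (hα.2.1 _ _).2 h

lemma aut_Big [Infinite X] {α : FactPair X → FactPair X} (hα : IsFactAut α) (a : FactPair X)
    (h : Big a) : Big (α a) := by
  by_contra hcon
  refine not_QProp a h (aut_QProp hα a (two_type_QProp (α a) ?_ hcon))
  rw [← aut_zero hα]
  intro h0
  have h0 := hα.1.1 h0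
  obtain ⟨p, hp1, hp2⟩ := h
  have h2 := hp2 1
  rw [h0] at h2
  have h2 : p 0 = p 1 := h2
  exact absurd (hp1 h2) (by decide)

lemma aut_first_eq [Infinite X] {α : FactPair X → FactPair X} (hα : IsFactAut α)
    (a b : FactPair X) (ha : Big a) (hb : Big b) (hT : (TSet a b).encard ≤ 5) :
    (α a).1.1 = (α b).1.1 :=
  first_eq _ _ (aut_Big hα a ha) (aut_Big hα b hb) ((aut_TSet hα a b).le.trans hT)

lemma mkF_Big {Y : Type*} [Nonempty Y] (i : X → Fin 3) (w : X → Y)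
    (h : Function.Bijective fun x => (i x, w x)) : Big (mkF i w h) := by
  let q : Y := Classical.arbitrary Y
  have : ∀ j, ∃ x, i x = j ∧ w x = q := by
    intro j
    obtain ⟨x, hx⟩ := h.2 (j, q)
    exact ⟨x, Prod.ext_iff.1 hx⟩
  choose p hp1 hp2 using this
  refine ⟨p, fun j k hjk => by rw [← hp1 j, hjk, hp1], fun j => ?_⟩
  change w _ = w _
  rw [hp2, hp2]

/-- twisting one row -/
def tw {Y : Type*} (i : X → Fin 3) (k : Fin 3) (σ : Equiv.Perm Y) (w : X → Y) : X → Y :=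
  fun x => if i x = k then σ (w x) else w x

lemma tw_bij {Y : Type*} (i : X → Fin 3) (k : Fin 3) (σ : Equiv.Perm Y) (w : X → Y)
    (h : Function.Bijective fun x => (i x, w x)) :
    Function.Bijective fun x => (i x, tw i k σ w x) := by
  constructor
  · intro x z hxz
    simp only [Prod.mk.injEq] at hxz
    obtain ⟨h1, h2⟩ := hxz
    apply h.1
    refine Prod.ext h1 ?_
    simp only [tw, h1] at h2
    split_ifs at h2
    · exact σ.injective h2
    · exact h2
  · rintro ⟨j, q⟩
    obtain ⟨x, hx⟩ := h.2 (j, if j = k then σ.symm q else q)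
    have hx := Prod.ext_iff.1 hx
    simp only at hx
    refine ⟨x, ?_⟩
    simp only [tw, hx.1, hx.2]
    split_ifs <;> simp

lemma step_fpf [Infinite X] {α : FactPair X → FactPair X} (hα : IsFactAut α) {Y : Type*}
    [Infinite Y] (i : X → Fin 3) (k : Fin 3) (τ : Equiv.Perm Y) (hτ : ∀ y, τ (τ y) = y)
    (hne : ∀ y, τ y ≠ y) (w : X → Y) (h : Function.Bijective fun x => (i x, w x)) :
    (α (mkF i w h)).1.1 = (α (mkF i (tw i k τ w) (tw_bij i k τ w h))).1.1 := by
  classical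
  refine aut_first_eq hα _ _ (mkF_Big _ _ _) (mkF_Big _ _ _) ?_
  have := orb_infinite τ hτ
  let q : Y → Quotient (orb τ hτ) := fun y => Quotient.mk _ y
  have hq : ∀ y, q (τ y) = q y := fun y => Quotient.sound (Or.inr (hτ y).symm)
  let u0 : Y → Bool := fun y => decide (y = (q y).out)
  have hu0 : ∀ y, u0 (τ y) = !u0 y := by
    intro y
    simp only [u0, hq]
    rcases orb_out τ hτ y with h | h
    · have h : y = (q y).out := h
      rw [← h]
      simp [hne]
    · have h : y = τ (q y).out := h
      have h2 : τ y = (q y).out := by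
        conv_lhs => rw [h]
        exact hτ _
      rw [← h2]
      simp [(hne y).symm]
  have hin : ∀ y z, u0 y = u0 z ∧ q y = q z ↔ y = z := by
    intro y z
    constructor
    · rintro ⟨h1, h2⟩
      rcases (Quotient.exact h2 : z = y ∨ z = τ y) with h3 | h3
      · exact h3.symm
      · rw [h3, hu0] at h1
        simp at h1
    · rintro rfl; simp
  refine TSet_le i (fun x => u0 (w x)) (fun x => q (w x)) ?_ k _ _ (fun _ _ => Iff.rfl) ?_
    (fun _ _ => Iff.rfl) ?_
  · constructor
    · intro x z hxz
      simp only [Prod.mk.injEq] at hxz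
      exact h.1 (Prod.ext hxz.1 ((hin _ _).1 hxz.2))
    · rintro ⟨j, s, o⟩
      have : ∃ y, u0 y = s ∧ q y = o := by
        obtain ⟨y, rfl⟩ := Quotient.exists_rep o
        by_cases hs : u0 y = s
        · exact ⟨y, hs, rfl⟩
        · refine ⟨τ y, ?_, hq y⟩
          rw [hu0]
          revert hs
          cases u0 y <;> cases s <;> decide
      obtain ⟨y, rfl, rfl⟩ := this
      obtain ⟨x, hx⟩ := h.2 (j, y)
      have hx := Prod.ext_iff.1 hx
      exact ⟨x, by simp only at hx; simp [hx.1, hx.2]⟩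
  · intro x z
    rw [hin]
    exact Iff.rfl
  · intro x z
    have e1 : ∀ x, xor (u0 (w x)) (decide (i x = k)) = u0 (tw i k τ w x) := by
      intro x
      by_cases hx : i x = k <;> simp [tw, hx, hu0]
    have e2 : ∀ x, q (w x) = q (tw i k τ w x) := by
      intro x
      by_cases hx : i x = k <;> simp [tw, hx, hq]
    simp only [e1]
    rw [e2 x, e2 z, hin]
    exact Iff.rfl

lemma step_all [Infinite X] {α : FactPair X → FactPair X} (hα : IsFactAut α) {Y : Type*}
    [Infinite Y] (i : X → Fin 3) (k : Fin 3) (σ : Equiv.Perm Y) : ∀ (w : X → Y)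
    (h : Function.Bijective fun x => (i x, w x)),
    (α (mkF i w h)).1.1 = (α (mkF i (tw i k σ w) (tw_bij i k σ w h))).1.1 := by
  refine good_all (fun σ => ∀ (w : X → Y) (h : Function.Bijective fun x => (i x, w x)),
    (α (mkF i w h)).1.1 = (α (mkF i (tw i k σ w) (tw_bij i k σ w h))).1.1) ?_ ?_ σ
  · intro τ h1 h2 w h
    exact step_fpf hα i k τ h1 h2 w h
  · intro s t hs ht w h
    rw [ht w h, hs _ (tw_bij i k t w h)]
    have : tw i k s (tw i k t w) = tw i k (s * t) w := by
      funext x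
      by_cases hx : i x = k <;> simp [tw, hx]
    simp only [this]

lemma final [Infinite X] {α : FactPair X → FactPair X} (hα : IsFactAut α) (a b : FactPair X)
    (ha : IsNRel 3 a.1.2) (hfst : a.1.1 = b.1.1) : (α a).1.1 = (α b).1.1 := by
  classical
  let x0 : X := Classical.arbitrary X
  have h3 := ha x0
  have hfin : Finite {y // a.1.2 x0 y} := Nat.finite_of_card_ne_zero (by rw [h3]; decide)
  let E : {y // a.1.2 x0 y} ≃ Fin 3 := Finite.equivFinOfCardEq h3
  have hpr : ∀ x, ∃ z : {y // a.1.2 x0 y}, a.1.1 x z := by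
    intro x
    obtain ⟨z, h1, h2⟩ := fp_ex a x x0
    exact ⟨⟨z, a.1.2.symm' h2⟩, h1⟩
  choose pr hpr using hpr
  have hprz : ∀ x (z : {y // a.1.2 x0 y}), a.1.1 x z → pr x = z := by
    intro x z h
    apply Subtype.ext
    exact fp_eq a (a.1.1.trans' (a.1.1.symm' (hpr x)) h)
      (a.1.2.trans' (a.1.2.symm' (pr x).2) z.2)
  let i : X → Fin 3 := fun x => E (pr x)
  have hi : ∀ x z, a.1.1 x z ↔ i x = i z := by
    intro x z
    constructor
    · intro h
      exact congrArg E (hprz x (pr z) (a.1.1.trans' h (hpr z)))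
    · intro h
      have h := E.injective h
      exact a.1.1.trans' (hpr x) (h ▸ a.1.1.symm' (hpr z))
  have hisurj : ∀ j, ∃ x, i x = j := by
    intro j
    refine ⟨E.symm j, ?_⟩
    simp only [i]
    rw [hprz _ (E.symm j) (a.1.1.refl' _)]
    simp
  have bij : ∀ c : FactPair X, a.1.1 = c.1.1 →
      Function.Bijective fun x => (i x, (Quotient.mk c.1.2 x)) := by
    intro c hc
    constructor
    · intro x z h
      simp only [Prod.mk.injEq] at h
      exact fp_eq c (hc ▸ (hi _ _).2 h.1) (Quotient.exact h.2)
    · rintro ⟨j, o⟩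
      obtain ⟨z, rfl⟩ := Quotient.exists_rep o
      obtain ⟨x, rfl⟩ := hisurj j
      obtain ⟨t, h1, h2⟩ := fp_ex c x z
      rw [← hc] at h1
      exact ⟨t, Prod.ext ((hi _ _).1 (a.1.1.symm' h1)) (Quotient.sound h2)⟩
  let w : X → Quotient a.1.2 := fun x => Quotient.mk _ x
  let v : X → Quotient b.1.2 := fun x => Quotient.mk _ x
  have hw : Function.Bijective fun x => (i x, w x) := bij a rfl
  have hv : Function.Bijective fun x => (i x, v x) := bij b hfst
  have hY : Infinite (Quotient a.1.2) := by
    by_contra hf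
    rw [not_infinite_iff_finite] at hf
    have := Finite.of_injective _ hw.1
    exact not_finite X
  let ew := Equiv.ofBijective _ hw
  let ev := Equiv.ofBijective _ hv
  have ew1 : ∀ j y, i (ew.symm (j, y)) = j := fun j y =>
    congrArg (·.1) (ew.apply_symm_apply (j, y))
  have ew2 : ∀ j y, w (ew.symm (j, y)) = y := fun j y =>
    congrArg (·.2) (ew.apply_symm_apply (j, y))
  have ev1 : ∀ j y, i (ev.symm (j, y)) = j := fun j y =>
    congrArg (·.1) (ev.apply_symm_apply (j, y))
  have ev2 : ∀ j y, v (ev.symm (j, y)) = y := fun j y =>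
    congrArg (·.2) (ev.apply_symm_apply (j, y))
  have ew3 : ∀ j x, i x = j → ew.symm (j, w x) = x := by
    rintro _ x rfl; exact ew.symm_apply_apply x
  have ev3 : ∀ j x, i x = j → ev.symm (j, v x) = x := by
    rintro _ x rfl; exact ev.symm_apply_apply x
  let σ : Fin 3 → (Quotient a.1.2 ≃ Quotient b.1.2) := fun j =>
    { toFun := fun y => v (ew.symm (j, y))
      invFun := fun y => w (ev.symm (j, y))
      left_inv := fun y => by
        simp only
        rw [ev3 j _ (ew1 j y), ew2]
      right_inv := fun y => by
        simp only
        rw [ew3 j _ (ev1 j y), ev2] }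
  have hσ : ∀ x, σ (i x) (w x) = v x := by
    intro x
    change v (ew.symm (i x, w x)) = v x
    rw [ew3 _ _ rfl]
  let s : Fin 3 → Equiv.Perm (Quotient a.1.2) := fun j => (σ j).trans (σ 0).symm
  have hA : a = mkF i w hw := by
    apply fp_ext
    · intro x z h; exact (hi _ _).1 h
    · intro x z h; exact Quotient.sound h
  have h2 := tw_bij i 2 (s 2) w hw
  have h1 := tw_bij i 1 (s 1) _ h2
  have hB : b = mkF i (tw i 1 (s 1) (tw i 2 (s 2) w)) h1 := by
    apply fp_ext
    · intro x z h
      rw [← hfst] at h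
      exact (hi _ _).1 h
    · have key : ∀ x, tw i 1 (s 1) (tw i 2 (s 2) w) x = (σ 0).symm (v x) := by
        intro x
        rw [← hσ]
        have : i x = 0 ∨ i x = 1 ∨ i x = 2 := by omega
        rcases this with h | h | h <;> simp [tw, h, s]
      intro x z h
      change tw i 1 (s 1) (tw i 2 (s 2) w) x = tw i 1 (s 1) (tw i 2 (s 2) w) z
      rw [key, key]
      exact congrArg _ (Quotient.sound h)
  rw [hA, hB]
  exact (step_all hα i 2 (s 2) w hw).trans (step_all hα i 1 (s 1) _ h2)

end FactAux

/-- Let `X` be infinite and `α` an automorphism of `Fact X`. If `(θ,θ')` and `(θ,θ'')`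
are `3`-atoms of `Fact X` with the same first coordinate, then `α(θ,θ')` and `α(θ,θ'')`
have the same first coordinate. -/
theorem factAut_same_first_coord_of_three_atoms (X : Type*) [Infinite X]
    (α : FactPair X → FactPair X) (hα : IsFactAut α) (a b : FactPair X)
    (ha : IsPAtom 3 a) (hb : IsPAtom 3 b) (hfst : a.1.1 = b.1.1) :
    (α a).1.1 = (α b).1.1 := by
  exact FactAux.final hα a b ha.2 hfst
end

section
/- Let X be an infinite set and α an automorphism of Fact(X). If (θ,θ') and (θ,θ'') are factor pairs of X with the same first coordinate and X/θ is infinite, then α(θ,θ') and α(θ,θ'') have the same first coordinate. -/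
namespace FA

theorem fp_ext_le {X : Type*} {p q : FactPair X} (h1 : p.1.1 ≤ q.1.1) (h2 : p.1.2 ≤ q.1.2) :
    p = q := by
  have e1 : q.1.1 ≤ p.1.1 := by
    intro x y h
    obtain ⟨z, hz1, hz2⟩ := p.2.2 x y
    have : z = y := (q.2.1 z y).1 ⟨q.1.1.trans' (q.1.1.symm' (h1 hz1)) h, h2 hz2⟩
    exact this ▸ hz1
  have e2 : q.1.2 ≤ p.1.2 := by
    intro x y h
    obtain ⟨z, hz1, hz2⟩ := p.2.2 x y
    have : x = z := (q.2.1 x z).1 ⟨h1 hz1, q.1.2.trans' h (q.1.2.symm' (h2 hz2))⟩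
    exact this ▸ hz2
  exact Subtype.ext (Prod.ext (le_antisymm h1 e1) (le_antisymm h2 e2))

theorem fp_eq_zero {X : Type*} {p : FactPair X} (h : ∀ x y, p.1.1 x y) : p = FactZero X := by
  symm
  apply fp_ext_le
  · intro x y _
    exact h x y
  · intro x y hxy
    have : x = y := hxy
    subst this
    exact p.1.2.refl' _

theorem fp_eq_zero' {X : Type*} {p : FactPair X} (h : ∀ x y, p.1.2 x y → x = y) :
    p = FactZero X := by
  apply fp_eq_zero
  intro x y
  obtain ⟨z, hz1, hz2⟩ := p.2.2 x y
  exact h _ _ hz2 ▸ hz1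

theorem fp_comp' {X : Type*} (p : FactPair X) (x y : X) : ∃ z, p.1.2 x z ∧ p.1.1 z y := by
  obtain ⟨z, hz1, hz2⟩ := p.2.2 y x
  exact ⟨z, p.1.2.symm' hz2, p.1.1.symm' hz1⟩

/-- a two-class element -/
structure TA (X : Type*) where
  f : X → Bool
  s : X → X
  hs : ∀ x, s (s x) = x
  hf : ∀ x, f (s x) = !f x

def TA.fp {X : Type*} (P : TA X) : FactPair X :=
  ⟨(⟨fun x y => P.f x = P.f y, ⟨fun _ => rfl, fun h => h.symm, fun h k => h.trans k⟩⟩,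
    ⟨fun x y => y = x ∨ y = P.s x, ⟨fun _ => Or.inl rfl,
      fun {x y} h => by
        rcases h with h | h
        · exact Or.inl h.symm
        · right; rw [h, P.hs],
      fun {x y z} h k => by
        rcases h with h | h <;> rcases k with k | k <;> subst h <;> subst k <;> simp [P.hs]⟩⟩), by
    constructor
    · intro x y
      constructor
      · rintro ⟨h1, h2⟩
        have h1 : P.f x = P.f y := h1
        rcases h2 with h2 | h2
        · exact h2.symm
        · rw [h2, P.hf] at h1; simp at h1
      · rintro rfl
        exact ⟨rfl, Or.inl rfl⟩
    · intro x y
      by_cases h : P.f x = P.f y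
      · exact ⟨y, h, Or.inl rfl⟩
      · refine ⟨P.s y, ?_, Or.inr (P.hs y).symm⟩
        show P.f x = P.f (P.s y)
        rw [P.hf]
        revert h; cases P.f x <;> cases P.f y <;> simp⟩

theorem TA.fp1 {X : Type*} (P : TA X) (x y : X) : P.fp.1.1 x y ↔ P.f x = P.f y := Iff.rfl
theorem TA.fp2 {X : Type*} (P : TA X) (x y : X) : P.fp.1.2 x y ↔ (y = x ∨ y = P.s x) := Iff.rfl

theorem comm_iff {X : Type*} {θ φ : Setoid X} :
    Relation.Comp (⇑θ) (⇑φ) = Relation.Comp (⇑φ) (⇑θ) ↔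
    ∀ x y z, θ x y → φ y z → ∃ w, φ x w ∧ θ w z := by
  constructor
  · intro h x y z h1 h2
    have : Relation.Comp (⇑θ) (⇑φ) x z := ⟨y, h1, h2⟩
    rw [h] at this
    exact this
  · intro h
    funext x z
    apply propext
    constructor
    · rintro ⟨y, h1, h2⟩
      exact h x y z h1 h2
    · rintro ⟨y, h1, h2⟩
      obtain ⟨w, hw1, hw2⟩ := h z y x (θ.symm' h2) (φ.symm' h1)
      exact ⟨w, θ.symm' hw2, φ.symm' hw1⟩

theorem TA.le_iff {X : Type*} (P : TA X) (c : FactPair X) : FactLE P.fp c ↔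
    (∀ x y, c.1.1 x y → P.f x = P.f y) ∧ (∀ x, c.1.2 x (P.s x)) ∧
    ∀ x y, c.1.1 x y → c.1.1 (P.s x) (P.s y) := by
  unfold FactLE
  rw [comm_iff]
  constructor
  · rintro ⟨h1, h2, h3⟩
    refine ⟨fun x y h => h1 h, fun x => h2 (Or.inr rfl), fun x y h => ?_⟩
    obtain ⟨w, hw1, hw2⟩ := h3 x y (P.s y) h (Or.inr rfl)
    rcases hw1 with rfl | rfl
    · have e1 : P.f w = P.f y := h1 h
      have e2 : P.f w = P.f (P.s y) := h1 hw2
      rw [P.hf] at e2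
      rw [e1] at e2; simp at e2
    · exact hw2
  · rintro ⟨h1, h2, h3⟩
    refine ⟨fun {x y} h => h1 x y h, fun {x y} h => ?_, fun x y z h k => ?_⟩
    · rcases h with rfl | rfl
      · exact c.1.2.refl' _
      · exact h2 x
    · rcases k with rfl | rfl
      · exact ⟨x, Or.inl rfl, h⟩
      · exact ⟨P.s x, Or.inr rfl, h3 _ _ h⟩

def In {X : Type*} (x c : FactPair X) : Prop := x ≠ FactZero X ∧ FactLT x c
def Orth {X : Type*} (x y : FactPair X) : Prop := FactLE x (FactPerp y)

def KK {X : Type*} (c : FactPair X) : Prop :=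
  ∀ x1 x2 x3 x4, In x1 c → In x2 c → In x3 c → In x4 c →
    (x1 = x2 ∨ Orth x1 x2) ∨ (x1 = x3 ∨ Orth x1 x3) ∨ (x1 = x4 ∨ Orth x1 x4) ∨
    (x2 = x3 ∨ Orth x2 x3) ∨ (x2 = x4 ∨ Orth x2 x4) ∨ (x3 = x4 ∨ Orth x3 x4)

def RR {X : Type*} (p q : FactPair X) : Prop :=
  p ≠ q ∧ ∃ c d, c ≠ d ∧ KK c ∧ KK d ∧ In p c ∧ In q c ∧ In p d ∧ In q d

theorem RR.symm {X : Type*} {p q : FactPair X} (h : RR p q) : RR q p := by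
  obtain ⟨h1, c, d, h2, h3, h4, h5, h6, h7, h8⟩ := h
  exact ⟨h1.symm, c, d, h2, h3, h4, h6, h5, h8, h7⟩

theorem TA.ne_zero {X : Type*} [Nonempty X] (P : TA X) : P.fp ≠ FactZero X := by
  intro h
  obtain ⟨x⟩ := ‹Nonempty X›
  have h1 : (FactZero X).1.1 x (P.s x) := trivial
  rw [← h] at h1
  have h1 : P.f x = P.f (P.s x) := h1
  rw [P.hf] at h1; simp at h1

theorem exists_TA {X : Type*} (p : FactPair X) (x y : X) (hxy : ¬ p.1.1 x y)
    (h : ∀ z, p.1.1 z x ∨ p.1.1 z y) : ∃ P : TA X, P.fp = p := by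
  classical
  have key : ∀ z w, (p.1.1 z w ↔ (p.1.1 z x ↔ p.1.1 w x)) := by
    intro z w
    constructor
    · intro k
      exact ⟨fun l => p.1.1.trans' (p.1.1.symm' k) l, fun l => p.1.1.trans' k l⟩
    · intro k
      by_cases hz : p.1.1 z x
      · exact p.1.1.trans' hz (p.1.1.symm' (k.1 hz))
      · have hw : ¬ p.1.1 w x := fun l => hz (k.2 l)
        exact p.1.1.trans' ((h z).resolve_left hz) (p.1.1.symm' ((h w).resolve_left hw))
  have ex : ∀ z, ∃ w, p.1.2 z w ∧ ¬ p.1.1 z w := by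
    intro z
    by_cases hz : p.1.1 z x
    · obtain ⟨w, h1, h2⟩ := fp_comp' p z y
      exact ⟨w, h1, fun l => hxy (p.1.1.trans' (p.1.1.symm' hz) (p.1.1.trans' l h2))⟩
    · obtain ⟨w, h1, h2⟩ := fp_comp' p z x
      exact ⟨w, h1, fun l => hz (p.1.1.trans' l h2)⟩
  choose s hs1 hs2 using ex
  refine ⟨⟨fun z => decide (p.1.1 z x), s, ?_, ?_⟩, ?_⟩
  · intro z
    have a1 := hs2 z
    have a2 := hs2 (s z)
    rw [key] at a1 a2
    apply (p.2.1 _ _).1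
    refine ⟨?_, p.1.2.symm' (p.1.2.trans' (hs1 z) (hs1 (s z)))⟩
    rw [key]; tauto
  · intro z
    have a1 := hs2 z
    rw [key] at a1
    by_cases h1 : p.1.1 z x <;> by_cases h2 : p.1.1 (s z) x <;> simp [h1, h2] at a1 ⊢
  · apply fp_ext_le
    · intro z w k
      have k : decide (p.1.1 z x) = decide (p.1.1 w x) := k
      rw [key]; simpa using k
    · intro z w k
      rcases k with rfl | rfl
      · exact p.1.2.refl' _
      · exact hs1 z

end FA
set_option linter.unusedSimpArgs false
set_option linter.unusedVariables false

namespace FA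

structure Quad (X : Type*) where
  f : X → Bool
  g : X → Bool
  s : X → X
  t : X → X
  hs : ∀ x, s (s x) = x
  ht : ∀ x, t (t x) = x
  st : ∀ x, s (t x) = t (s x)
  fs : ∀ x, f (s x) = !f x
  ft : ∀ x, f (t x) = f x
  gs : ∀ x, g (s x) = g x
  gt : ∀ x, g (t x) = !g x

def Quad.fp {X : Type*} (Q : Quad X) : FactPair X :=
  ⟨(⟨fun x y => Q.f x = Q.f y ∧ Q.g x = Q.g y,
      ⟨fun _ => ⟨rfl, rfl⟩, fun h => ⟨h.1.symm, h.2.symm⟩,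
        fun h k => ⟨h.1.trans k.1, h.2.trans k.2⟩⟩⟩,
    ⟨fun x y => y = x ∨ y = Q.s x ∨ y = Q.t x ∨ y = Q.s (Q.t x), ⟨fun _ => Or.inl rfl,
      fun {x y} h => by
        rcases h with h | h | h | h <;> subst h <;> simp [Q.hs, Q.ht, Q.st],
      fun {x y z} h k => by
        rcases h with h | h | h | h <;> rcases k with k | k | k | k <;> subst h <;> subst k <;>
          simp [Q.hs, Q.ht, Q.st]⟩⟩), by
    constructor
    · intro x y
      constructor
      · rintro ⟨h1, h2⟩
        have h1 : Q.f x = Q.f y ∧ Q.g x = Q.g y := h1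
        obtain ⟨h1, h3⟩ := h1
        rcases h2 with h2 | h2 | h2 | h2 <;> subst h2 <;>
          simp [Q.fs, Q.ft, Q.gt] at h1 h3 ⊢
      · rintro rfl
        exact ⟨⟨rfl, rfl⟩, Or.inl rfl⟩
    · intro x y
      by_cases h : Q.f x = Q.f y <;> by_cases k : Q.g x = Q.g y
      · exact ⟨y, ⟨h, k⟩, Or.inl rfl⟩
      · refine ⟨Q.t y, ⟨?_, ?_⟩, Or.inr (Or.inr (Or.inl (Q.ht y).symm))⟩
        · rw [Q.ft, h]
        · rw [Q.gt]; revert k; cases Q.g x <;> cases Q.g y <;> simp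
      · refine ⟨Q.s y, ⟨?_, ?_⟩, Or.inr (Or.inl (Q.hs y).symm)⟩
        · rw [Q.fs]; revert h; cases Q.f x <;> cases Q.f y <;> simp
        · rw [Q.gs, k]
      · refine ⟨Q.s (Q.t y), ⟨?_, ?_⟩, Or.inr (Or.inr (Or.inr ?_))⟩
        · rw [Q.fs, Q.ft]; revert h; cases Q.f x <;> cases Q.f y <;> simp
        · rw [Q.gs, Q.gt]; revert k; cases Q.g x <;> cases Q.g y <;> simp
        · rw [← Q.st, Q.hs, Q.ht]⟩

theorem Quad.fp1 {X : Type*} (Q : Quad X) (x y : X) :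
    Q.fp.1.1 x y ↔ (Q.f x = Q.f y ∧ Q.g x = Q.g y) := Iff.rfl
theorem Quad.fp2 {X : Type*} (Q : Quad X) (x y : X) :
    Q.fp.1.2 x y ↔ (y = x ∨ y = Q.s x ∨ y = Q.t x ∨ y = Q.s (Q.t x)) := Iff.rfl

def Quad.a1 {X : Type*} (Q : Quad X) : TA X := ⟨Q.f, Q.s, Q.hs, Q.fs⟩
def Quad.b1 {X : Type*} (Q : Quad X) : TA X := ⟨Q.g, Q.t, Q.ht, Q.gt⟩
def Quad.a2 {X : Type*} (Q : Quad X) : TA X :=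
  ⟨Q.f, fun x => Q.s (Q.t x), by simp [Q.st, Q.hs, Q.ht], by simp [Q.fs, Q.ft]⟩
def Quad.b2 {X : Type*} (Q : Quad X) : TA X :=
  ⟨fun x => Bool.xor (Q.f x) (Q.g x), Q.t, Q.ht, by simp [Q.ft, Q.gt]⟩
def Quad.a3 {X : Type*} (Q : Quad X) : TA X :=
  ⟨Q.g, fun x => Q.s (Q.t x), by simp [Q.st, Q.hs, Q.ht], by simp [Q.gs, Q.gt]⟩
def Quad.b3 {X : Type*} (Q : Quad X) : TA X :=
  ⟨fun x => Bool.xor (Q.f x) (Q.g x), Q.s, Q.hs, by simp [Q.fs, Q.gs]⟩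

theorem TA.orth_iff {X : Type*} (P P' : TA X) : Orth P.fp P'.fp ↔
    (∀ x, P.f (P'.s x) = P.f x) ∧ (∀ x, P'.f (P.s x) = P'.f x) ∧
      ∀ x, P.s (P'.s x) = P'.s (P.s x) := by
  unfold Orth
  rw [TA.le_iff]
  constructor
  · rintro ⟨h1, h2, h3⟩
    have k1 : ∀ x, P.f (P'.s x) = P.f x := fun x => (h1 x (P'.s x) (Or.inr rfl)).symm
    refine ⟨k1, fun x => (h2 x).symm, fun x => ?_⟩
    rcases h3 x (P'.s x) (Or.inr rfl) with h | h
    · have a : P'.f x = P'.f (P.s x) := h2 x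
      have b : P'.f (P'.s x) = P'.f (P.s (P'.s x)) := h2 (P'.s x)
      rw [P'.hf, h, ← a] at b
      simp at b
    · exact h
  · rintro ⟨h1, h2, h3⟩
    refine ⟨fun x y h => ?_, fun x => (h2 x).symm, fun x y h => ?_⟩
    · rcases h with rfl | rfl
      · rfl
      · exact (h1 x).symm
    · rcases h with rfl | rfl
      · exact Or.inl rfl
      · exact Or.inr (h3 x)

theorem prop4 (r01 r02 r03 r12 r13 r23 q01 q02 q03 q12 q13 q23 : Prop)
    (n1 : ¬ (r01 ∧ q01)) (n2 : ¬ (r02 ∧ q02)) (n3 : ¬ (r03 ∧ q03))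
    (n4 : ¬ (r12 ∧ q12)) (n5 : ¬ (r13 ∧ q13)) (n6 : ¬ (r23 ∧ q23))
    (r012 : r01 → r02 → r12) (r012' : r01 → r12 → r02) (r012'' : r02 → r12 → r01)
    (r013 : r01 → r03 → r13) (r013' : r01 → r13 → r03) (r013'' : r03 → r13 → r01)
    (r023 : r02 → r03 → r23) (r023' : r02 → r23 → r03) (r023'' : r03 → r23 → r02)
    (r123 : r12 → r13 → r23) (r123' : r12 → r23 → r13) (r123'' : r13 → r23 → r12)
    (q012 : q01 → q02 → q12) (q012' : q01 → q12 → q02) (q012'' : q02 → q12 → q01)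
    (q013 : q01 → q03 → q13) (q013' : q01 → q13 → q03) (q013'' : q03 → q13 → q01)
    (q023 : q02 → q03 → q23) (q023' : q02 → q23 → q03) (q023'' : q03 → q23 → q02)
    (q123 : q12 → q13 → q23) (q123' : q12 → q23 → q13) (q123'' : q13 → q23 → q12)
    (c01 : r01 ∨ q01 ∨ (r02 ∧ q12) ∨ (r03 ∧ q13))
    (c02 : r02 ∨ q02 ∨ (r01 ∧ q12) ∨ (r03 ∧ q23))
    (c03 : r03 ∨ q03 ∨ (r01 ∧ q13) ∨ (r02 ∧ q23))
    (c12 : r12 ∨ q12 ∨ (r01 ∧ q02) ∨ (r13 ∧ q23))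
    (c13 : r13 ∨ q13 ∨ (r01 ∧ q03) ∨ (r12 ∧ q23))
    (c23 : r23 ∨ q23 ∨ (r02 ∧ q03) ∨ (r12 ∧ q13))
    (d01 : r01 ∨ q01 ∨ (q02 ∧ r12) ∨ (q03 ∧ r13))
    (d02 : r02 ∨ q02 ∨ (q01 ∧ r12) ∨ (q03 ∧ r23))
    (d03 : r03 ∨ q03 ∨ (q01 ∧ r13) ∨ (q02 ∧ r23))
    (d12 : r12 ∨ q12 ∨ (q01 ∧ r02) ∨ (q13 ∧ r23))
    (d13 : r13 ∨ q13 ∨ (q01 ∧ r03) ∨ (q12 ∧ r23))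
    (d23 : r23 ∨ q23 ∨ (q02 ∧ r03) ∨ (q12 ∧ r13))
    (z : ¬ (r01 ∧ r02 ∧ r03)) (o : r01 ∨ r02 ∨ r03 ∨ r12 ∨ r13 ∨ r23) :
    (r01 ∧ r23 ∧ q02 ∧ q13) ∨ (r01 ∧ r23 ∧ q03 ∧ q12) ∨ (r02 ∧ r13 ∧ q01 ∧ q23) ∨
    (r02 ∧ r13 ∧ q03 ∧ q12) ∨ (r03 ∧ r12 ∧ q01 ∧ q23) ∨ (r03 ∧ r12 ∧ q02 ∧ q13) := by
  by_cases a1 : r01 <;> by_cases a2 : r02 <;> by_cases a3 : r03 <;> by_cases a4 : r12 <;>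
    by_cases a5 : r13 <;> by_cases a6 : r23 <;> simp_all <;> grind

theorem tr1 {X : Type*} (r : Setoid X) {a b c : X} (h : r a b) (k : r a c) : r b c :=
  r.trans' (r.symm' h) k
theorem tr2 {X : Type*} (r : Setoid X) {a b c : X} (h : r a b) (k : r b c) : r a c :=
  r.trans' h k
theorem tr3 {X : Type*} (r : Setoid X) {a b c : X} (h : r a c) (k : r b c) : r a b :=
  r.trans' h (r.symm' k)

theorem comp4 {X : Type*} (x : FactPair X) (a b u v : X)
    (hz : ∀ z, x.1.2 z b → z = a ∨ z = b ∨ z = u ∨ z = v) :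
    x.1.1 a b ∨ x.1.2 a b ∨ (x.1.1 a u ∧ x.1.2 u b) ∨ (x.1.1 a v ∧ x.1.2 v b) := by
  obtain ⟨z, h1, h2⟩ := x.2.2 a b
  rcases hz z h2 with h | h | h | h <;> subst h
  · exact Or.inr (Or.inl h2)
  · exact Or.inl h1
  · exact Or.inr (Or.inr (Or.inl ⟨h1, h2⟩))
  · exact Or.inr (Or.inr (Or.inr ⟨h1, h2⟩))

theorem comp4' {X : Type*} (x : FactPair X) (a b u v : X)
    (hz : ∀ z, x.1.2 z a → z = a ∨ z = b ∨ z = u ∨ z = v) :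
    x.1.1 a b ∨ x.1.2 a b ∨ (x.1.2 a u ∧ x.1.1 u b) ∨ (x.1.2 a v ∧ x.1.1 v b) := by
  obtain ⟨z, h1, h2⟩ := fp_comp' x a b
  rcases hz z (x.1.2.symm' h1) with h | h | h | h <;> subst h
  · exact Or.inl h2
  · exact Or.inr (Or.inl h1)
  · exact Or.inr (Or.inr (Or.inl ⟨h1, h2⟩))
  · exact Or.inr (Or.inr (Or.inr ⟨h1, h2⟩))

theorem six_res {X : Type*} (Q : Quad X) (x : FactPair X) (hx : In x Q.fp) (o : X) :
    (x.1.1 o (Q.s o) ∧ x.1.1 (Q.t o) (Q.s (Q.t o)) ∧ x.1.2 o (Q.t o) ∧ x.1.2 (Q.s o) (Q.s (Q.t o))) ∨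
    (x.1.1 o (Q.s o) ∧ x.1.1 (Q.t o) (Q.s (Q.t o)) ∧ x.1.2 o (Q.s (Q.t o)) ∧ x.1.2 (Q.s o) (Q.t o)) ∨
    (x.1.1 o (Q.t o) ∧ x.1.1 (Q.s o) (Q.s (Q.t o)) ∧ x.1.2 o (Q.s o) ∧ x.1.2 (Q.t o) (Q.s (Q.t o))) ∨
    (x.1.1 o (Q.t o) ∧ x.1.1 (Q.s o) (Q.s (Q.t o)) ∧ x.1.2 o (Q.s (Q.t o)) ∧ x.1.2 (Q.s o) (Q.t o)) ∨
    (x.1.1 o (Q.s (Q.t o)) ∧ x.1.1 (Q.s o) (Q.t o) ∧ x.1.2 o (Q.s o) ∧ x.1.2 (Q.t o) (Q.s (Q.t o))) ∨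
    (x.1.1 o (Q.s (Q.t o)) ∧ x.1.1 (Q.s o) (Q.t o) ∧ x.1.2 o (Q.t o) ∧ x.1.2 (Q.s o) (Q.s (Q.t o)))
    := by
  obtain ⟨hx0, ⟨hl1, hl2, hl3⟩, hxc⟩ := hx
  have hc : ∀ z, ∃ w, w ∈ ({o, Q.s o, Q.t o, Q.s (Q.t o)} : Set X) ∧ Q.fp.1.1 z w := by
    intro z
    obtain ⟨w, h1, h2⟩ := Q.fp.2.2 z o
    refine ⟨w, ?_, h1⟩
    have h2 := Q.fp.1.2.symm' h2
    exact h2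
  have hz : ∀ z y, Q.fp.1.2 o y → x.1.2 z y → z = o ∨ z = Q.s o ∨ z = Q.t o ∨ z = Q.s (Q.t o) := by
    intro z y h1 h2
    exact tr3 _ h1 (hl2 h2)
  have o0 : Q.fp.1.2 o o := Q.fp.1.2.refl' _
  have o1 : Q.fp.1.2 o (Q.s o) := by simp [Quad.fp2]
  have o2 : Q.fp.1.2 o (Q.t o) := by simp [Quad.fp2]
  have o3 : Q.fp.1.2 o (Q.s (Q.t o)) := by simp [Quad.fp2]
  have nn : ∀ u v : X, Q.f u ≠ Q.f v ∨ Q.g u ≠ Q.g v → ¬ (x.1.1 u v ∧ x.1.2 u v) := by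
    intro u v h k
    have := (x.2.1 u v).1 k
    subst this
    simp at h
  exact prop4 (x.1.1 o (Q.s o)) (x.1.1 o (Q.t o)) (x.1.1 o (Q.s (Q.t o)))
    (x.1.1 (Q.s o) (Q.t o)) (x.1.1 (Q.s o) (Q.s (Q.t o))) (x.1.1 (Q.t o) (Q.s (Q.t o)))
    (x.1.2 o (Q.s o)) (x.1.2 o (Q.t o)) (x.1.2 o (Q.s (Q.t o)))
    (x.1.2 (Q.s o) (Q.t o)) (x.1.2 (Q.s o) (Q.s (Q.t o))) (x.1.2 (Q.t o) (Q.s (Q.t o)))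
    (nn _ _ (by simp [Q.fs])) (nn _ _ (by simp [Q.gt]))
    (nn _ _ (by simp [Q.fs, Q.ft])) (nn _ _ (by simp [Q.fs, Q.ft]))
    (nn _ _ (by simp [Q.gs, Q.gt])) (nn _ _ (by simp [Q.fs]))
    (tr1 _) (tr2 _) (tr3 _) (tr1 _) (tr2 _) (tr3 _) (tr1 _) (tr2 _) (tr3 _)
    (tr1 _) (tr2 _) (tr3 _) (tr1 _) (tr2 _) (tr3 _) (tr1 _) (tr2 _) (tr3 _)
    (tr1 _) (tr2 _) (tr3 _) (tr1 _) (tr2 _) (tr3 _)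
    (by
      have := comp4 x o (Q.s o) (Q.t o) (Q.s (Q.t o)) (fun z h => by have := hz z _ o1 h; tauto)
      have := @Setoid.symm' X x.1.2; tauto)
    (by
      have := comp4 x o (Q.t o) (Q.s o) (Q.s (Q.t o)) (fun z h => by have := hz z _ o2 h; tauto)
      have := @Setoid.symm' X x.1.2; tauto)
    (by
      have := comp4 x o (Q.s (Q.t o)) (Q.s o) (Q.t o) (fun z h => by have := hz z _ o3 h; tauto)
      tauto)
    (by
      have := comp4 x (Q.s o) (Q.t o) o (Q.s (Q.t o)) (fun z h => by have := hz z _ o2 h; tauto)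
      have := @Setoid.symm' X x.1.2; have := @Setoid.symm' X x.1.1; tauto)
    (by
      have := comp4 x (Q.s o) (Q.s (Q.t o)) o (Q.t o) (fun z h => by have := hz z _ o3 h; tauto)
      have := @Setoid.symm' X x.1.2; have := @Setoid.symm' X x.1.1; tauto)
    (by
      have := comp4 x (Q.t o) (Q.s (Q.t o)) o (Q.s o) (fun z h => by have := hz z _ o3 h; tauto)
      have := @Setoid.symm' X x.1.2; have := @Setoid.symm' X x.1.1; tauto)
    (by
      have := comp4' x o (Q.s o) (Q.t o) (Q.s (Q.t o)) (fun z h => by have := hz z _ o0 h; tauto)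
      have := @Setoid.symm' X x.1.1; tauto)
    (by
      have := comp4' x o (Q.t o) (Q.s o) (Q.s (Q.t o)) (fun z h => by have := hz z _ o0 h; tauto)
      have := @Setoid.symm' X x.1.1; tauto)
    (by
      have := comp4' x o (Q.s (Q.t o)) (Q.s o) (Q.t o) (fun z h => by have := hz z _ o0 h; tauto)
      tauto)
    (by
      have := comp4' x (Q.s o) (Q.t o) o (Q.s (Q.t o)) (fun z h => by have := hz z _ o1 h; tauto)
      have := @Setoid.symm' X x.1.2; have := @Setoid.symm' X x.1.1; tauto)
    (by
      have := comp4' x (Q.s o) (Q.s (Q.t o)) o (Q.t o) (fun z h => by have := hz z _ o1 h; tauto)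
      have := @Setoid.symm' X x.1.2; have := @Setoid.symm' X x.1.1; tauto)
    (by
      have := comp4' x (Q.t o) (Q.s (Q.t o)) o (Q.s o) (fun z h => by have := hz z _ o2 h; tauto)
      have := @Setoid.symm' X x.1.2; have := @Setoid.symm' X x.1.1; tauto)
    (by
      rintro ⟨h1, h2, h3⟩
      apply hx0
      have : ∀ z, x.1.1 o z := by
        intro z
        obtain ⟨w, hw, hw2⟩ := hc z
        have hw2 := x.1.1.symm' (hl1 hw2)
        rcases hw with rfl | rfl | rfl | rfl
        · exact hw2
        · exact tr2 _ h1 hw2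
        · exact tr2 _ h2 hw2
        · exact tr2 _ h3 hw2
      exact fp_eq_zero fun u v => tr1 _ (this u) (this v))
    (by
      by_contra hcon
      push Not at hcon
      obtain ⟨h1, h2, h3, h4, h5, h6⟩ := hcon
      apply hxc
      apply fp_ext_le _ hl2
      intro u v huv
      obtain ⟨a, ha, ha2⟩ := hc u
      obtain ⟨b, hb, hb2⟩ := hc v
      have hab : x.1.1 a b := tr1 _ (hl1 ha2) (tr2 _ huv (hl1 hb2))
      have hab' := x.1.1.symm' hab
      have : a = b := by
        rcases ha with rfl | rfl | rfl | rfl <;> rcases hb with rfl | rfl | rfl | rfl <;>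
          first | rfl | contradiction
      subst this
      exact tr3 _ ha2 hb2)

theorem six_aux {X : Type*} [Nonempty X] (Q : Quad X) (x : FactPair X) (hx : In x Q.fp) :
    ∃ P : TA X, (P = Q.a1 ∨ P = Q.b1 ∨ P = Q.a2 ∨ P = Q.b2 ∨ P = Q.a3 ∨ P = Q.b3) ∧
      ∃ o, (∀ u v, u ∈ ({o, Q.s o, Q.t o, Q.s (Q.t o)} : Set X) →
        v ∈ ({o, Q.s o, Q.t o, Q.s (Q.t o)} : Set X) → P.f u = P.f v → x.1.1 u v) ∧
      ∀ u, u ∈ ({o, Q.s o, Q.t o, Q.s (Q.t o)} : Set X) → x.1.2 u (P.s u) := by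
  obtain ⟨o⟩ := ‹Nonempty X›
  have sh2 : ∀ u v, x.1.2 u v → x.1.2 v u := fun u v h => x.1.2.symm' h
  have fin : ∀ P : TA X, (P = Q.a1 ∨ P = Q.b1 ∨ P = Q.a2 ∨ P = Q.b2 ∨ P = Q.a3 ∨ P = Q.b3) →
      (P.f o = P.f (Q.s o) → x.1.1 o (Q.s o)) → (P.f o = P.f (Q.t o) → x.1.1 o (Q.t o)) →
      (P.f o = P.f (Q.s (Q.t o)) → x.1.1 o (Q.s (Q.t o))) →
      (P.f (Q.s o) = P.f (Q.t o) → x.1.1 (Q.s o) (Q.t o)) →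
      (P.f (Q.s o) = P.f (Q.s (Q.t o)) → x.1.1 (Q.s o) (Q.s (Q.t o))) →
      (P.f (Q.t o) = P.f (Q.s (Q.t o)) → x.1.1 (Q.t o) (Q.s (Q.t o))) →
      x.1.2 o (P.s o) → x.1.2 (Q.s o) (P.s (Q.s o)) → x.1.2 (Q.t o) (P.s (Q.t o)) →
      x.1.2 (Q.s (Q.t o)) (P.s (Q.s (Q.t o))) →
      ∃ P : TA X, (P = Q.a1 ∨ P = Q.b1 ∨ P = Q.a2 ∨ P = Q.b2 ∨ P = Q.a3 ∨ P = Q.b3) ∧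
      ∃ o, (∀ u v, u ∈ ({o, Q.s o, Q.t o, Q.s (Q.t o)} : Set X) →
        v ∈ ({o, Q.s o, Q.t o, Q.s (Q.t o)} : Set X) → P.f u = P.f v → x.1.1 u v) ∧
      ∀ u, u ∈ ({o, Q.s o, Q.t o, Q.s (Q.t o)} : Set X) → x.1.2 u (P.s u) := by
    intro P hP e1 e2 e3 e4 e5 e6 f1 f2 f3 f4
    refine ⟨P, hP, o, ?_, ?_⟩
    · intro u v hu hv h
      rcases hu with rfl | rfl | rfl | rfl <;> rcases hv with rfl | rfl | rfl | rfl <;>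
        first
        | exact x.1.1.refl' _
        | exact e1 h
        | exact e2 h
        | exact e3 h
        | exact e4 h
        | exact e5 h
        | exact e6 h
        | exact x.1.1.symm' (e1 h.symm)
        | exact x.1.1.symm' (e2 h.symm)
        | exact x.1.1.symm' (e3 h.symm)
        | exact x.1.1.symm' (e4 h.symm)
        | exact x.1.1.symm' (e5 h.symm)
        | exact x.1.1.symm' (e6 h.symm)
    · intro u hu
      rcases hu with rfl | rfl | rfl | rfl <;> assumption
  rcases six_res Q x hx o with ⟨h1, h2, h3, h4⟩ | ⟨h1, h2, h3, h4⟩ | ⟨h1, h2, h3, h4⟩ | ⟨h1, h2, h3, h4⟩ |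
    ⟨h1, h2, h3, h4⟩ | ⟨h1, h2, h3, h4⟩
  · have h3' := sh2 _ _ h3
    have h4' := sh2 _ _ h4
    clear hx
    apply fin Q.b1 (by simp) <;>
      simp only [Quad.b1, Q.fs, Q.ft, Q.gs, Q.gt, Q.st, Q.hs, Q.ht] at * <;> first | exact fun _ => h1 | exact fun _ => h2 | assumption | simp
  · have h3' := sh2 _ _ h3
    have h4' := sh2 _ _ h4
    clear hx
    apply fin Q.a3 (by simp) <;>
      simp only [Quad.a3, Q.fs, Q.ft, Q.gs, Q.gt, Q.st, Q.hs, Q.ht] at * <;> first | exact fun _ => h1 | exact fun _ => h2 | assumption | simp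
  · have h3' := sh2 _ _ h3
    have h4' := sh2 _ _ h4
    clear hx
    apply fin Q.a1 (by simp) <;>
      simp only [Quad.a1, Q.fs, Q.ft, Q.gs, Q.gt, Q.st, Q.hs, Q.ht] at * <;> first | exact fun _ => h1 | exact fun _ => h2 | assumption | simp
  · have h3' := sh2 _ _ h3
    have h4' := sh2 _ _ h4
    clear hx
    apply fin Q.a2 (by simp) <;>
      simp only [Quad.a2, Q.fs, Q.ft, Q.gs, Q.gt, Q.st, Q.hs, Q.ht] at * <;> first | exact fun _ => h1 | exact fun _ => h2 | assumption | simp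
  · have h3' := sh2 _ _ h3
    have h4' := sh2 _ _ h4
    clear hx
    apply fin Q.b3 (by simp) <;>
      simp only [Quad.b3, Q.fs, Q.ft, Q.gs, Q.gt, Q.st, Q.hs, Q.ht] at * <;> first | exact fun _ => h1 | exact fun _ => h2 | assumption | simp
  · have h3' := sh2 _ _ h3
    have h4' := sh2 _ _ h4
    clear hx
    apply fin Q.b2 (by simp) <;>
      simp only [Quad.b2, Q.fs, Q.ft, Q.gs, Q.gt, Q.st, Q.hs, Q.ht] at * <;> first | exact fun _ => h1 | exact fun _ => h2 | assumption | simp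

end FA

namespace FA

def Quad.six {X : Type*} (Q : Quad X) (P : TA X) : Prop :=
  P = Q.a1 ∨ P = Q.b1 ∨ P = Q.a2 ∨ P = Q.b2 ∨ P = Q.a3 ∨ P = Q.b3

theorem Quad.six_le {X : Type*} (Q : Quad X) (P : TA X) (h : Q.six P) : FactLE P.fp Q.fp := by
  rw [TA.le_iff]
  rcases h with rfl | rfl | rfl | rfl | rfl | rfl
  all_goals
    refine ⟨?_, ?_, ?_⟩
    · rintro x y ⟨h1, h2⟩
      simp [Quad.a1, Quad.a2, Quad.a3, Quad.b1, Quad.b2, Quad.b3, h1, h2]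
    · intro x
      simp [Quad.a1, Quad.a2, Quad.a3, Quad.b1, Quad.b2, Quad.b3, Quad.fp2]
    · rintro x y ⟨h1, h2⟩
      simp [Quad.a1, Quad.a2, Quad.a3, Quad.b1, Quad.b2, Quad.b3, h1, h2, Q.fs, Q.ft, Q.gs, Q.gt,
        Quad.fp1]

theorem Quad.fp_ne {X : Type*} [Nonempty X] (Q : Quad X) (P : TA X) : P.fp ≠ Q.fp := by
  intro h
  obtain ⟨x⟩ := ‹Nonempty X›
  have h1 : Q.fp.1.2 x (Q.s x) := by simp [Quad.fp2]
  have h2 : Q.fp.1.2 x (Q.t x) := by simp [Quad.fp2]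
  rw [← h] at h1 h2
  have a := Q.fs x
  have b := Q.ft x
  have c := Q.gt x
  rcases h1 with h1 | h1
  · rw [h1] at a; simp at a
  rcases h2 with h2 | h2
  · rw [h2] at c; simp at c
  · rw [h1, ← h2, b] at a; simp at a

theorem Quad.six_In {X : Type*} [Nonempty X] (Q : Quad X) (P : TA X) (h : Q.six P) :
    In P.fp Q.fp := ⟨P.ne_zero, Q.six_le P h, Q.fp_ne P⟩

theorem Quad.six_of {X : Type*} [Nonempty X] (Q : Quad X) (x : FactPair X) (hx : In x Q.fp) :
    ∃ P, Q.six P ∧ P.fp = x := by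
  obtain ⟨P, hP, o, h1, h2⟩ := six_aux Q x hx
  refine ⟨P, hP, ?_⟩
  obtain ⟨hx0, ⟨hl1, hl2, hl3⟩, hxc⟩ := hx
  rw [comm_iff] at hl3
  have hPQ := (P.le_iff _).1 (Q.six_le P hP)
  obtain ⟨p1, p2, p3⟩ := hPQ
  have hc : ∀ z, ∃ w, w ∈ ({o, Q.s o, Q.t o, Q.s (Q.t o)} : Set X) ∧ Q.fp.1.1 z w := by
    intro z
    obtain ⟨w, h1, h2⟩ := Q.fp.2.2 z o
    refine ⟨w, ?_, h1⟩
    have h2 := Q.fp.1.2.symm' h2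
    exact h2
  apply fp_ext_le
  · intro u v huv
    obtain ⟨a, ha, ha2⟩ := hc u
    obtain ⟨b, hb, hb2⟩ := hc v
    have huv : P.f u = P.f v := huv
    have := h1 a b ha hb (by rw [← p1 _ _ ha2, ← p1 _ _ hb2, huv])
    exact tr2 _ (hl1 ha2) (tr3 _ this (hl1 hb2))
  · intro u v huv
    rcases huv with rfl | rfl
    · exact x.1.2.refl' _
    · obtain ⟨a, ha, ha2⟩ := hc u
      obtain ⟨w, hw1, hw2⟩ := hl3 _ _ _ ha2 (h2 a ha)
      have : w = P.s u := by
        apply (Q.fp.2.1 _ _).1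
        refine ⟨tr3 _ hw2 (p3 _ _ ha2), ?_⟩
        exact tr1 _ (hl2 hw1) (p2 u)
      exact this ▸ hw1

theorem pigeon {α : Type*} (r : α → α → Prop) (A B C : Set α)
    (hA : ∀ x ∈ A, ∀ y ∈ A, r x y) (hB : ∀ x ∈ B, ∀ y ∈ B, r x y)
    (hC : ∀ x ∈ C, ∀ y ∈ C, r x y) (x1 x2 x3 x4 : α)
    (h1 : x1 ∈ A ∨ x1 ∈ B ∨ x1 ∈ C) (h2 : x2 ∈ A ∨ x2 ∈ B ∨ x2 ∈ C)
    (h3 : x3 ∈ A ∨ x3 ∈ B ∨ x3 ∈ C) (h4 : x4 ∈ A ∨ x4 ∈ B ∨ x4 ∈ C) :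
    r x1 x2 ∨ r x1 x3 ∨ r x1 x4 ∨ r x2 x3 ∨ r x2 x4 ∨ r x3 x4 := by
  rcases h1 with h1 | h1 | h1 <;> rcases h2 with h2 | h2 | h2 <;>
    rcases h3 with h3 | h3 | h3 <;> rcases h4 with h4 | h4 | h4 <;> grind

theorem Quad.orth {X : Type*} (Q : Quad X) :
    (Orth Q.a1.fp Q.b1.fp ∧ Orth Q.b1.fp Q.a1.fp) ∧
    (Orth Q.a2.fp Q.b2.fp ∧ Orth Q.b2.fp Q.a2.fp) ∧
    (Orth Q.a3.fp Q.b3.fp ∧ Orth Q.b3.fp Q.a3.fp) := by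
  simp only [TA.orth_iff]
  simp [Quad.a1, Quad.a2, Quad.a3, Quad.b1, Quad.b2, Quad.b3, Q.fs, Q.ft, Q.gs, Q.gt,
    Q.st, Q.hs, Q.ht]

theorem Quad.kk {X : Type*} [Nonempty X] (Q : Quad X) : KK Q.fp := by
  intro x1 x2 x3 x4 h1 h2 h3 h4
  have o := Q.orth
  have key : ∀ x, In x Q.fp → x ∈ ({Q.a1.fp, Q.b1.fp} : Set (FactPair X)) ∨
      x ∈ ({Q.a2.fp, Q.b2.fp} : Set (FactPair X)) ∨ x ∈ ({Q.a3.fp, Q.b3.fp} : Set (FactPair X)) := by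
    intro x hx
    obtain ⟨P, hP, rfl⟩ := Q.six_of x hx
    rcases hP with rfl | rfl | rfl | rfl | rfl | rfl <;> simp
  refine pigeon (fun x y => x = y ∨ Orth x y) _ _ _ ?_ ?_ ?_ x1 x2 x3 x4 (key _ h1) (key _ h2)
    (key _ h3) (key _ h4)
  all_goals
    intro x hx y hy
    simp only [Set.mem_insert_iff, Set.mem_singleton_iff] at hx hy
    rcases hx with rfl | rfl <;> rcases hy with rfl | rfl <;> tauto

end FA

namespace FA

theorem comp_ne {X : Type*} {p c : FactPair X} (h : In p c) :
    ∃ x0 x1, ¬ ∃ w, c.1.1 x0 w ∧ p.1.2 w x1 := by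
  by_contra hcon
  push Not at hcon
  obtain ⟨h0, ⟨h1, h2, h3⟩, h4⟩ := h
  apply h4
  symm
  apply fp_ext_le h1
  intro a b hab
  obtain ⟨w, hw1, hw2⟩ := hcon a b
  have : a = w := (c.2.1 _ _).1 ⟨hw1, tr3 _ hab (h2 hw2)⟩
  exact this ▸ hw2

theorem two_class {X : Type*} {p c : FactPair X} (hc : KK c) (h : In p c) :
    ∃ P : TA X, P.fp = p := by
  classical
  have ⟨x0, x1, hx⟩ := comp_ne h
  obtain ⟨h0, ⟨h1, h2, h3⟩, h4⟩ := h
  have h3' := comm_iff.1 h3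
  have hp2 : ¬ ∀ x y, p.1.2 x y → x = y := fun k => h0 (fp_eq_zero' k)
  have hp1 : ∃ x y, ¬ p.1.1 x y := by
    by_contra k
    push Not at k
    exact h0 (fp_eq_zero k)
  obtain ⟨x, y, hxy⟩ := hp1
  by_cases hz : ∀ z, p.1.1 z x ∨ p.1.1 z y
  · exact exists_TA p x y hxy hz
  exfalso
  push Not at hz
  obtain ⟨z, hzx, hzy⟩ := hz
  let N := Quotient p.1.1
  let n : X → N := fun x => Quotient.mk p.1.1 x
  have hn : ∀ a b, n a = n b ↔ p.1.1 a b := fun a b => Quotient.eq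
  let S : X → Prop := fun a => ∃ w, c.1.1 x0 w ∧ p.1.2 w a
  have S2 : ∀ a b, p.1.2 a b → S a → S b := by
    rintro a b hab ⟨w, hw1, hw2⟩
    exact ⟨w, hw1, tr2 _ hw2 hab⟩
  have S2' : ∀ a b, p.1.2 a b → (S a ↔ S b) := fun a b hab =>
    ⟨S2 a b hab, S2 b a (p.1.2.symm' hab)⟩
  have S1 : ∀ a b, c.1.1 a b → S a → S b := by
    rintro a b hab ⟨w, hw1, hw2⟩
    obtain ⟨v, hv1, hv2⟩ := h3' b a w (c.1.1.symm' hab) (p.1.2.symm' hw2)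
    exact ⟨v, tr3 _ hw1 hv2, p.1.2.symm' hv1⟩
  have S1' : ∀ a b, c.1.1 a b → (S a ↔ S b) := fun a b hab =>
    ⟨S1 a b hab, S1 b a (c.1.1.symm' hab)⟩
  have rep : ∀ (a : X) (m : N), ∃ b, p.1.2 a b ∧ n b = m := by
    intro a m
    obtain ⟨m', rfl⟩ := Quotient.exists_rep m
    obtain ⟨b, hb1, hb2⟩ := fp_comp' p a m'
    exact ⟨b, hb1, (hn _ _).2 hb2⟩
  let n' : Equiv.Perm N → X → N := fun τ a => if S a then τ (n a) else n a
  have hn'1 : ∀ τ a, S a → n' τ a = τ (n a) := fun τ a h => if_pos h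
  have hn'2 : ∀ τ a, ¬ S a → n' τ a = n a := fun τ a h => if_neg h
  let pt : Equiv.Perm N → FactPair X := fun τ => ⟨(Setoid.ker (n' τ), p.1.2), by
    constructor
    · intro a b
      constructor
      · rintro ⟨k1, k2⟩
        have k1 : n' τ a = n' τ b := k1
        apply (p.2.1 _ _).1
        refine ⟨?_, k2⟩
        by_cases ha : S a
        · have hb := S2 _ _ k2 ha
          rw [hn'1 _ _ ha, hn'1 _ _ hb] at k1
          exact (hn _ _).1 (τ.injective k1)
        · have hb : ¬ S b := fun l => ha (S2 _ _ (p.1.2.symm' k2) l)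
          rw [hn'2 _ _ ha, hn'2 _ _ hb] at k1
          exact (hn _ _).1 k1
      · rintro rfl
        exact ⟨rfl, p.1.2.refl' _⟩
    · intro a b
      by_cases hb : S b
      · obtain ⟨z, hz1, hz2⟩ := rep b (τ.symm (n' τ a))
        refine ⟨z, ?_, p.1.2.symm' hz1⟩
        show n' τ a = n' τ z
        rw [hn'1 τ z (S2 _ _ hz1 hb), hz2]; simp
      · obtain ⟨z, hz1, hz2⟩ := rep b (n' τ a)
        refine ⟨z, ?_, p.1.2.symm' hz1⟩
        show n' τ a = n' τ z
        rw [hn'2 τ z (fun l => hb (S2 _ _ (p.1.2.symm' hz1) l)), hz2]⟩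
  have ptIn : ∀ τ, In (pt τ) c := by
    intro τ
    refine ⟨?_, ⟨?_, h2, h3⟩, ?_⟩
    · intro k
      apply hp2
      intro a b hab
      have : (pt τ).1.2 a b := hab
      rw [k] at this
      exact this
    · intro a b hab
      show n' τ a = n' τ b
      have := (hn a b).2 (h1 hab)
      simp only [n', S1' a b hab, this]
    · intro k
      apply h4
      symm
      apply fp_ext_le h1
      rw [← k]
  have inj : ∀ τ σ, pt τ = pt σ → τ = σ := by
    intro τ σ k
    ext m
    obtain ⟨a, ha1, ha2⟩ := rep x0 m
    obtain ⟨b, hb1, hb2⟩ := rep x1 (τ m)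
    have Sa : S a := S2 _ _ ha1 ⟨x0, c.1.1.refl' _, p.1.2.refl' _⟩
    have Sb : ¬ S b := fun l => hx (S2 _ _ (p.1.2.symm' hb1) l)
    have e : (pt τ).1.1 a b := by
      show n' τ a = n' τ b
      rw [hn'1 _ _ Sa, hn'2 _ _ Sb, hb2, ha2]
    rw [k] at e
    have e : n' σ a = n' σ b := e
    rw [hn'1 _ _ Sa, hn'2 _ _ Sb, hb2, ha2] at e
    exact e.symm
  have northo : ∀ τ σ, ¬ Orth (pt τ) (pt σ) := by
    rintro τ σ ⟨k1, k2, k3⟩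
    apply hp2
    intro a b hab
    exact ((pt τ).2.1 a b).1 ⟨k1 hab, hab⟩
  have no : ∀ τ σ, τ ≠ σ → ¬ (pt τ = pt σ ∨ Orth (pt τ) (pt σ)) := by
    rintro τ σ k (l | l)
    · exact k (inj _ _ l)
    · exact northo _ _ l
  have ij : n x ≠ n y := fun l => hxy ((hn _ _).1 l)
  have ki : n z ≠ n x := fun l => hzx ((hn _ _).1 l)
  have kj : n z ≠ n y := fun l => hzy ((hn _ _).1 l)
  have nsw : ∀ a b : N, a ≠ b → (1 : Equiv.Perm N) ≠ Equiv.swap a b := by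
    intro a b hab k
    have := congrArg (fun e => e a) k
    simp at this
    exact hab this
  have d1 : Equiv.swap (n x) (n y) ≠ Equiv.swap (n x) (n z) := by
    intro k
    have := congrArg (fun e => e (n x)) k
    simp at this
    exact kj this.symm
  have d2 : Equiv.swap (n x) (n y) ≠ Equiv.swap (n y) (n z) := by
    intro k
    have := congrArg (fun e => e (n y)) k
    simp at this
    exact ki this.symm
  have d3 : Equiv.swap (n x) (n z) ≠ Equiv.swap (n y) (n z) := by
    intro k
    have := congrArg (fun e => e (n z)) k
    simp at this
    exact ij this
  rcases hc _ _ _ _ (ptIn 1) (ptIn (Equiv.swap (n x) (n y))) (ptIn (Equiv.swap (n x) (n z)))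
    (ptIn (Equiv.swap (n y) (n z))) with l | l | l | l | l | l
  · exact no _ _ (nsw _ _ ij) l
  · exact no _ _ (nsw _ _ ki.symm) l
  · exact no _ _ (nsw _ _ kj.symm) l
  · exact no _ _ d1 l
  · exact no _ _ d2 l
  · exact no _ _ d3 l

theorem quad_of {X : Type*} {c : FactPair X} (P : TA X) (hc : KK c) (h : In P.fp c) :
    ∃ Q : Quad X, Q.fp = c ∧ Q.a1 = P := by
  obtain ⟨p, hp⟩ : ∃ p, p = P.fp := ⟨_, rfl⟩
  rw [← hp] at h
  have hI := h
  have ⟨x0, x1, hx⟩ := comp_ne h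
  obtain ⟨h0, ⟨h1, h2, h3⟩, h4⟩ := h
  have h3' := comm_iff.1 h3
  have hp2 : ¬ ∀ x y, p.1.2 x y → x = y := fun k => h0 (fp_eq_zero' k)
  have key : ∀ a b, p.1.1 a b → (∃ w, c.1.1 a w ∧ p.1.2 w b) → c.1.1 a b := by
    rintro a b hab ⟨w, hw1, hw2⟩
    have : w = b := (p.2.1 _ _).1 ⟨tr1 _ (h1 hw1) hab, hw2⟩
    exact this ▸ hw1
  let p' : FactPair X := ⟨(⟨fun a b => ∃ w, c.1.1 a w ∧ p.1.2 w b,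
      ⟨fun a => ⟨a, c.1.1.refl' _, p.1.2.refl' _⟩,
        fun {a b} k => by
          obtain ⟨w, hw1, hw2⟩ := k
          obtain ⟨v, hv1, hv2⟩ := h3' _ _ _ hw1 hw2
          exact ⟨v, c.1.1.symm' hv2, p.1.2.symm' hv1⟩,
        fun {a b d} k l => by
          obtain ⟨w, hw1, hw2⟩ := k
          obtain ⟨v, hv1, hv2⟩ := l
          obtain ⟨u, hu1, hu2⟩ := h3' _ _ _ (c.1.1.symm' hv1) (p.1.2.symm' hw2)
          exact ⟨u, tr3 _ hw1 hu2, tr1 _ hu1 hv2⟩⟩⟩, p.1.1 ⊓ c.1.2), by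
    constructor
    · intro a b
      constructor
      · rintro ⟨k1, k2, k3⟩
        exact (c.2.1 _ _).1 ⟨key a b k2 k1, k3⟩
      · rintro rfl
        exact ⟨⟨a, c.1.1.refl' _, p.1.2.refl' _⟩, p.1.1.refl' _, c.1.2.refl' _⟩
    · intro a b
      obtain ⟨w, hw1, hw2⟩ := c.2.2 a b
      obtain ⟨z, hz1, hz2⟩ := fp_comp' p w b
      exact ⟨z, ⟨w, hw1, hz1⟩, hz2, tr1 _ (h2 hz1) hw2⟩⟩
  have hp' : In p' c := by
    refine ⟨?_, ⟨?_, ?_, ?_⟩, ?_⟩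
    · intro k
      have : (FactZero X).1.1 x0 x1 := trivial
      rw [← k] at this
      exact hx this
    · intro a b hab
      exact ⟨b, hab, p.1.2.refl' _⟩
    · intro a b hab
      exact hab.2
    · rw [comm_iff]
      rintro x y z k ⟨l1, l2⟩
      obtain ⟨w, hw1, hw2⟩ := fp_comp' c x z
      exact ⟨w, ⟨tr2 _ (h1 k) (tr3 _ l1 (h1 hw2)), hw1⟩, hw2⟩
    · intro k
      apply hp2
      intro a b hab
      have : c.1.2 a b := h2 hab
      rw [← k] at this
      exact (p.2.1 a b).1 ⟨this.1, hab⟩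
  obtain ⟨P', hP'⟩ := two_class hc hp'
  have ss : ∀ x, p.1.2 x (P.s x) := fun x => hp ▸ Or.inr rfl
  have ft : ∀ x, P.f (P'.s x) = P.f x := by
    intro x
    have : p'.1.2 x (P'.s x) := hP' ▸ Or.inr rfl
    have := this.1
    rw [hp] at this
    exact this.symm
  have gs : ∀ x, P'.f (P.s x) = P'.f x := by
    intro x
    have : p'.1.1 x (P.s x) := ⟨x, c.1.1.refl' _, ss x⟩
    rw [← hP'] at this
    exact this.symm
  have c1 : ∀ a b, P.f a = P.f b → P'.f a = P'.f b → c.1.1 a b := by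
    intro a b k l
    apply key
    · rw [hp]; exact k
    · have : P'.fp.1.1 a b := l
      rw [hP'] at this
      exact this
  have cs : ∀ a, c.1.2 a (P.s a) := fun a => h2 (ss a)
  have ct : ∀ a, c.1.2 a (P'.s a) := by
    intro a
    have : p'.1.2 a (P'.s a) := hP' ▸ Or.inr rfl
    exact this.2
  refine ⟨⟨P.f, P'.f, P.s, P'.s, P.hs, P'.hs, ?_, P.hf, ft, gs, P'.hf⟩, ?_, rfl⟩
  · intro x
    apply (c.2.1 _ _).1
    refine ⟨c1 _ _ ?_ ?_, ?_⟩
    · simp [P.hf, ft]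
    · simp [P'.hf, gs]
    · exact tr1 _ (tr2 _ (ct x) (cs _)) (tr2 _ (cs x) (ct _))
  · apply fp_ext_le
    · rintro a b ⟨k, l⟩
      exact c1 a b k l
    · rintro a b (k | k | k | k)
      · subst k; exact c.1.2.refl' _
      · subst k; exact cs a
      · subst k; exact ct a
      · subst k; exact tr2 _ (ct a) (cs _)

end FA

namespace FA

theorem quad_eq {X : Type*} (Q Q' : Quad X) (h : Q.a1 = Q'.a1) (h1 : Q'.fp.1.1 ≤ Q.fp.1.1)
    (h2 : ∀ x, Q'.fp.1.2 x (Q.t x)) : Q.fp = Q'.fp := by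
  have hs : Q.s = Q'.s := congrArg TA.s h
  symm
  apply fp_ext_le h1
  have ne1 : ∀ x, Q.t x ≠ x := fun x k => by have := Q.gt x; rw [k] at this; simp at this
  have ne2 : ∀ x, Q.t x ≠ Q.s x := fun x k => by
    have := Q.gt x; rw [k, Q.gs] at this; simp at this
  intro x y hxy
  show y = x ∨ y = Q.s x ∨ y = Q.t x ∨ y = Q.s (Q.t x)
  have a := ne1 x
  have b := ne2 x
  rcases h2 x with k | k | k | k
  · exact absurd k a
  · rw [hs] at b; exact absurd k b
  · rw [hs, k]; exact hxy
  · rw [hs, k, Q'.hs]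
    rcases hxy with l | l | l | l <;> simp [l]

theorem RR_cases {X : Type*} [Nonempty X] {p q : FactPair X} (h : RR p q) :
    (∃ Q : Quad X, Q.a1.fp = p ∧ Q.a2.fp = q) ∨ (∃ Q : Quad X, Q.a1.fp = p ∧ Q.b3.fp = q) := by
  obtain ⟨hne, c, d, hcd, hc, hd, hpc, hqc, hpd, hqd⟩ := h
  obtain ⟨P, rfl⟩ := two_class hc hpc
  obtain ⟨Q, rfl, rfl⟩ := quad_of P hc hpc
  obtain ⟨Q', rfl, hQ'⟩ := quad_of _ hd hpd
  obtain ⟨R, hR, rfl⟩ := Q.six_of q hqc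
  have l1 := (TA.le_iff _ _).1 hpd.2.1
  have l2 := (TA.le_iff _ _).1 hqd.2.1
  obtain ⟨k1, k2, k3⟩ := l1
  obtain ⟨m1, m2, m3⟩ := l2
  rcases hR with rfl | rfl | rfl | rfl | rfl | rfl
  · exact absurd rfl hne
  · exfalso; apply hcd
    refine quad_eq _ _ hQ'.symm ?_ m2
    intro a b hab
    exact ⟨k1 a b hab, m1 a b hab⟩
  · left; exact ⟨Q, rfl, rfl⟩
  · exfalso; apply hcd
    refine quad_eq _ _ hQ'.symm ?_ m2
    intro a b hab
    have e1 : Q.f a = Q.f b := k1 a b hab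
    have e2 : (Q.f a ^^ Q.g a) = (Q.f b ^^ Q.g b) := m1 a b hab
    refine ⟨e1, ?_⟩
    rw [e1] at e2
    simpa using e2
  · exfalso; apply hcd
    refine quad_eq _ _ hQ'.symm ?_ ?_
    · intro a b hab
      exact ⟨k1 a b hab, m1 a b hab⟩
    · intro x
      have e1 : Q'.fp.1.2 x (Q.s (Q.t x)) := m2 x
      have e2 : Q'.fp.1.2 (Q.s (Q.t x)) (Q.s (Q.s (Q.t x))) := k2 _
      rw [Q.hs] at e2
      exact tr2 _ e1 e2
  · right; exact ⟨Q, rfl, rfl⟩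

/-- splitting of a fixed point free involution, invariant under commuting maps -/
theorem split_basic {A : Type*} (t : A → A) (ht : ∀ x, t (t x) = x) (hn : ∀ x, t x ≠ x) :
    ∃ g : A → Bool, ∀ x, g (t x) = !g x := by
  classical
  obtain ⟨r, hr⟩ : ∃ r : LinearOrder A, True := ⟨linearOrderOfSTO WellOrderingRel, trivial⟩
  refine ⟨fun x => decide (x < t x), fun x => ?_⟩
  simp only [ht]
  rcases lt_trichotomy x (t x) with h | h | h
  · simp [h, h.le]
  · exact absurd h.symm (hn x)
  · simp [h, h.le]

/-- `E` equivalence relation preserved by `t`, never relating `x` and `t x`. -/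
theorem split_rel {A : Type*} (E : Setoid A) (t : A → A) (ht : ∀ x, t (t x) = x)
    (hE : ∀ x y, E x y → E (t x) (t y)) (hn : ∀ x, ¬ E (t x) x) :
    ∃ g : A → Bool, (∀ x, g (t x) = !g x) ∧ ∀ x y, E x y → g x = g y := by
  obtain ⟨g, hg⟩ := split_basic (A := Quotient E) (Quotient.map t (fun x y h => hE x y h))
    (by
      intro x
      induction x using Quotient.inductionOn with
      | _ x => simp [ht])
    (by
      intro x
      induction x using Quotient.inductionOn with
      | _ x =>
        simp only [Quotient.map_mk]
        intro k
        exact hn x (Quotient.exact k))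
  refine ⟨fun x => g (Quotient.mk E x), fun x => ?_, fun x y h => ?_⟩
  · have := hg (Quotient.mk E x)
    simpa using this
  · exact congrArg g (Quotient.sound h)

/-- orbit relation of an involution -/
def orbS {A : Type*} (s : A → A) (hs : ∀ x, s (s x) = x) : Setoid A :=
  ⟨fun x y => y = x ∨ y = s x, ⟨fun _ => Or.inl rfl,
    fun {x y} h => by
      rcases h with h | h
      · exact Or.inl h.symm
      · right; rw [h, hs],
    fun {x y z} h k => by
      rcases h with h | h <;> rcases k with k | k <;> subst h <;> subst k <;> simp [hs]⟩⟩

theorem L6 {X : Type*} [Infinite X] (P P' : TA X) (hf : P.f = P'.f)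
    (comm : ∀ x, P.s (P'.s x) = P'.s (P.s x)) (ne : ∀ x, P.s x ≠ P'.s x) : RR P.fp P'.fp := by
  classical
  obtain ⟨f, s, hs, fs⟩ := P
  obtain ⟨f', t, ht, ft⟩ := P'
  simp only at hf comm ne
  subst hf
  have nt : ∀ x, t x ≠ x := fun x k => by have := ft x; rw [k] at this; simp at this
  have ns : ∀ x, s x ≠ x := fun x k => by have := fs x; rw [k] at this; simp at this
  obtain ⟨g, g1, g2⟩ := split_rel (orbS s hs) t ht (by
      rintro x y (rfl | rfl)
      · exact Or.inl rfl
      · exact Or.inr (comm x).symm) (by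
      rintro x (h | h)
      · exact nt x h.symm
      · exact ne (t x) (by rw [ht]; exact h.symm))
  have gs : ∀ x, g (s x) = g x := fun x => (g2 _ _ (Or.inr rfl)).symm
  obtain ⟨x0⟩ := (inferInstance : Nonempty X)
  let k : X → Bool := fun x => decide (x = x0 ∨ x = s x0 ∨ x = t x0 ∨ x = s (t x0))
  have ks : ∀ x, k (s x) = k x := by
    intro x
    have e : ∀ y, s x = y ↔ x = s y := fun y => ⟨fun h => by rw [← h, hs], fun h => by rw [h, hs]⟩
    simp only [k, e, hs]
    apply decide_eq_decide.2; tauto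
  have kt : ∀ x, k (t x) = k x := by
    intro x
    have e : ∀ y, t x = y ↔ x = t y := fun y => ⟨fun h => by rw [← h, ht], fun h => by rw [h, ht]⟩
    simp only [k, e, ht, ← comm]
    apply decide_eq_decide.2; tauto
  obtain ⟨y0, hy0⟩ := (Set.toFinite {x0, s x0, t x0, s (t x0)}).infinite_compl.nonempty
  let Q : Quad X := ⟨f, g, s, fun x => s (t x), hs, by simp [comm, hs, ht], by simp [comm, hs], fs,
    by simp [fs, ft], gs, by simp [gs, g1]⟩
  let Q' : Quad X := ⟨f, fun x => g x ^^ k x, s, fun x => s (t x), hs, by simp [comm, hs, ht],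
    by simp [comm, hs], fs, by simp [fs, ft], by simp [gs, ks], by simp [gs, g1, ks, kt]⟩
  have e1 : Q.a1.fp = (⟨f, s, hs, fs⟩ : TA X).fp := rfl
  have e2 : Q'.a1.fp = (⟨f, s, hs, fs⟩ : TA X).fp := rfl
  have e3 : Q.a2.fp = (⟨f, t, ht, ft⟩ : TA X).fp := by
    congr 1; simp [Quad.a2, Q, hs]
  have e4 : Q'.a2.fp = (⟨f, t, ht, ft⟩ : TA X).fp := by
    congr 1; simp [Quad.a2, Q', hs]
  refine ⟨?_, Q.fp, Q'.fp, ?_, Q.kk, Q'.kk, ?_, ?_, ?_, ?_⟩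
  · intro h
    have : (⟨f, t, ht, ft⟩ : TA X).fp.1.2 x0 (t x0) := Or.inr rfl
    rw [← h] at this
    rcases this with h | h
    · exact nt _ h
    · exact ne _ h.symm
  · intro h
    have kx : k x0 = true := by simp [k]
    have ky : k y0 = false := by simpa [k] using hy0
    obtain ⟨z, hz1, hz2⟩ := Q.fp.2.2 y0 x0
    have kz : k z = true := by
      have hz2 := Q.fp.1.2.symm' hz2
      rcases hz2 with h | h | h | h
      · rw [h, kx]
      · rw [h]; show k (s x0) = true; rw [ks, kx]
      · rw [h]; show k (s (t x0)) = true; rw [ks, kt, kx]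
      · rw [h]; show k (s (s (t x0))) = true; rw [ks, ks, kt, kx]
    have l1 := hz1
    rw [h] at hz1
    have m1 : (g y0 ^^ k y0) = (g z ^^ k z) := hz1.2
    have m2 : g y0 = g z := l1.2
    rw [kz, ky, m2] at m1
    simp at m1
  · rw [← e1]; exact Q.six_In _ (Or.inl rfl)
  · rw [← e3]; exact Q.six_In _ (by simp [Quad.six])
  · rw [← e2]; exact Q'.six_In _ (Or.inl rfl)
  · rw [← e4]; exact Q'.six_In _ (by simp [Quad.six])

end FA

namespace FA

theorem L6' {X : Type*} [Infinite X] (Q : Quad X) : RR Q.a1.fp Q.b3.fp := by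
  classical
  obtain ⟨x1, x2, hne, heq⟩ :=
    Finite.exists_ne_map_eq_of_infinite (fun x => (Q.f x, Q.g x))
  have hf : Q.f x1 = Q.f x2 := congrArg Prod.fst heq
  have hg : Q.g x1 = Q.g x2 := congrArg Prod.snd heq
  let π : X → X := fun x => if x = x1 then x2 else if x = x2 then x1 else
    if x = Q.s x1 then Q.s x2 else if x = Q.s x2 then Q.s x1 else x
  have n11 : Q.s x1 ≠ x1 := fun k => by have := Q.fs x1; rw [k] at this; simp at this
  have n22 : Q.s x2 ≠ x2 := fun k => by have := Q.fs x2; rw [k] at this; simp at this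
  have n12 : Q.s x1 ≠ x2 := fun k => by have := Q.fs x1; rw [k, hf] at this; simp at this
  have n21 : Q.s x2 ≠ x1 := fun k => by have := Q.fs x2; rw [k, hf] at this; simp at this
  have nss : Q.s x1 ≠ Q.s x2 := fun k => hne (by rw [← Q.hs x1, k, Q.hs])
  have π1 : π x1 = x2 := by simp [π]
  have π2 : π x2 = x1 := by simp [π, hne.symm]
  have π3 : π (Q.s x1) = Q.s x2 := by simp [π, n11, n12]
  have π4 : π (Q.s x2) = Q.s x1 := by simp [π, n22, n21, nss.symm]
  have π5 : ∀ x, x ≠ x1 → x ≠ x2 → x ≠ Q.s x1 → x ≠ Q.s x2 → π x = x := by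
    intro x h1 h2 h3 h4
    simp [π, h1, h2, h3, h4]
  have cases : ∀ x, x = x1 ∨ x = x2 ∨ x = Q.s x1 ∨ x = Q.s x2 ∨
      (x ≠ x1 ∧ x ≠ x2 ∧ x ≠ Q.s x1 ∧ x ≠ Q.s x2) := by intro x; tauto
  have se : ∀ x y, Q.s x = y ↔ x = Q.s y :=
    fun x y => ⟨fun h => by rw [← h, Q.hs], fun h => by rw [h, Q.hs]⟩
  have ππ : ∀ x, π (π x) = x := by
    intro x
    rcases cases x with rfl | rfl | rfl | rfl | ⟨h1, h2, h3, h4⟩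
    · rw [π1, π2]
    · rw [π2, π1]
    · rw [π3, π4]
    · rw [π4, π3]
    · rw [π5 x h1 h2 h3 h4, π5 x h1 h2 h3 h4]
  have πs : ∀ x, π (Q.s x) = Q.s (π x) := by
    intro x
    rcases cases x with rfl | rfl | rfl | rfl | ⟨h1, h2, h3, h4⟩
    · rw [π3, π1]
    · rw [π4, π2]
    · rw [π3, Q.hs, Q.hs, π1]
    · rw [π4, Q.hs, Q.hs, π2]
    · rw [π5 x h1 h2 h3 h4, π5]
      · rwa [Ne, se]
      · rwa [Ne, se]
      · rwa [Ne, se, Q.hs]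
      · rwa [Ne, se, Q.hs]
  have πf : ∀ x, Q.f (π x) = Q.f x := by
    intro x
    rcases cases x with rfl | rfl | rfl | rfl | ⟨h1, h2, h3, h4⟩
    · rw [π1, hf]
    · rw [π2, hf]
    · rw [π3, Q.fs, Q.fs, hf]
    · rw [π4, Q.fs, Q.fs, hf]
    · rw [π5 x h1 h2 h3 h4]
  have πg : ∀ x, Q.g (π x) = Q.g x := by
    intro x
    rcases cases x with rfl | rfl | rfl | rfl | ⟨h1, h2, h3, h4⟩
    · rw [π1, hg]
    · rw [π2, hg]
    · rw [π3, Q.gs, Q.gs, hg]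
    · rw [π4, Q.gs, Q.gs, hg]
    · rw [π5 x h1 h2 h3 h4]
  let Q' : Quad X := ⟨Q.f, Q.g, Q.s, fun x => π (Q.t (π x)), Q.hs, by simp [ππ, Q.ht],
    by intro x; simp only [πs, ← Q.st], Q.fs, by simp [πf, Q.ft], Q.gs, by simp [πg, Q.gt]⟩
  refine ⟨?_, Q.fp, Q'.fp, ?_, Q.kk, Q'.kk, Q.six_In _ (by simp [Quad.six]),
    Q.six_In _ (by simp [Quad.six]), Q'.six_In Q'.a1 (by simp [Quad.six]),
    Q'.six_In Q'.b3 (by simp [Quad.six])⟩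
  · intro h
    have : Q.a1.fp.1.1 x1 (Q.t x1) := (Q.ft x1).symm
    rw [h] at this
    have : (Q.f x1 ^^ Q.g x1) = (Q.f (Q.t x1) ^^ Q.g (Q.t x1)) := this
    rw [Q.ft, Q.gt] at this
    simp at this
  · intro h
    have h2 : Q'.fp.1.2 x1 (π (Q.t (π x1))) := Or.inr (Or.inr (Or.inl rfl))
    rw [← h, π1, π5] at h2
    · have h3 : Q.fp.1.2 x2 (Q.t x2) := Or.inr (Or.inr (Or.inl rfl))
      exact hne ((Q.fp.2.1 _ _).1 ⟨⟨hf, hg⟩, tr3 _ h2 h3⟩)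
    all_goals
      intro k
      have := Q.gt x2
      simp [k, hg, Q.gs] at this

/-- conditional application -/
def pw {X : Type*} (s : X → X) (a : Bool) (x : X) : X := cond a (s x) x

theorem L7 {X : Type*} [Infinite X] (f : X → Bool) (s t u : X → X)
    (hs : ∀ x, s (s x) = x) (ht : ∀ x, t (t x) = x) (hu : ∀ x, u (u x) = x)
    (fs : ∀ x, f (s x) = !f x) (ft : ∀ x, f (t x) = !f x) (fu : ∀ x, f (u x) = !f x)
    (st : ∀ x, s (t x) = t (s x)) (su : ∀ x, s (u x) = u (s x)) (tu : ∀ x, t (u x) = u (t x))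
    (nst : ∀ x, s x ≠ t x) (nsu : ∀ x, s x ≠ u x) (ntu : ∀ x, t x ≠ u x) :
    ∃ z, z ≠ FactZero X ∧ Orth z (TA.fp ⟨f, s, hs, fs⟩) ∧ Orth z (TA.fp ⟨f, t, ht, ft⟩) ∧
      Orth z (TA.fp ⟨f, u, hu, fu⟩) := by
  have nt : ∀ x, t x ≠ x := fun x k => by have := ft x; rw [k] at this; simp at this
  have gen : ∀ s t u : X → X, (∀ x, s (s x) = x) → (∀ x, t (t x) = x) → (∀ x, u (u x) = x) →
    (∀ x, f (s x) = !f x) → (∀ x, f (t x) = !f x) → (∀ x, f (u x) = !f x) →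
    (∀ x, s (t x) = t (s x)) → (∀ x, s (u x) = u (s x)) → (∀ x, t (u x) = u (t x)) →
    (∀ x, s x ≠ t x) → (∀ x, t x ≠ u x) →
    ∃ g : X → Bool, (∀ x, g (s x) = g x) ∧ (∀ x, g (t x) = !g x) ∧ ∀ x, g (u x) = g x := by
    intro s t u hs ht hu fs ft fu st su tu nst ntu
    let E : Setoid X := ⟨fun x y => y = x ∨ y = s x ∨ y = u x ∨ y = s (u x), ⟨fun _ => Or.inl rfl,
      fun {x y} h => by
        rcases h with h | h | h | h <;> subst h <;> simp [hs, hu, su],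
      fun {x y z} h k => by
        rcases h with h | h | h | h <;> rcases k with k | k | k | k <;> subst h <;> subst k <;>
          simp [hs, hu, su]⟩⟩
    have ff : ∀ x y, f x ≠ f y → x ≠ y := fun x y h k => h (by rw [k])
    obtain ⟨g, g1, g2⟩ := split_rel E t ht (by
      rintro x y (h | h | h | h) <;> subst h
      · exact Or.inl rfl
      · exact Or.inr (Or.inl (st x).symm)
      · exact Or.inr (Or.inr (Or.inl (tu x)))
      · exact Or.inr (Or.inr (Or.inr (by rw [← st, tu])))) (by
      rintro x (h | h | h | h)
      · exact ff x (t x) (by simp [ft]) h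
      · apply nst (t x); rw [ht]; exact h.symm
      · apply ntu (t x); rw [ht]; exact h
      · exact ff x (s (u (t x))) (by simp [fs, ft, fu]) h)
    exact ⟨g, fun x => (g2 _ _ (Or.inr (Or.inl rfl))).symm, g1,
      fun x => (g2 _ _ (Or.inr (Or.inr (Or.inl rfl)))).symm⟩
  obtain ⟨g, gs, gt, gu⟩ := gen s t u hs ht hu fs ft fu st su tu nst ntu
  obtain ⟨h, hhs, hhu, hht⟩ := gen s u t hs hu ht fs fu ft su st (fun x => (tu x).symm) nsu
    (fun x => (ntu x).symm)
  let T : X → X := fun x => s (t x)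
  let U : X → X := fun x => s (u x)
  have hT : ∀ x, T (T x) = x := by simp [T, st, hs, ht]
  have hU : ∀ x, U (U x) = x := by simp [U, su, hs, hu]
  have sT : ∀ x, s (T x) = T (s x) := by simp [T, st]
  have sU : ∀ x, s (U x) = U (s x) := by simp [U, su]
  have TU : ∀ x, T (U x) = U (T x) := by simp [T, U, st, su, tu]
  have fT : ∀ x, f (T x) = f x := by simp [T, fs, ft]
  have fU : ∀ x, f (U x) = f x := by simp [U, fs, fu]
  have gT : ∀ x, g (T x) = !g x := by simp [T, gs, gt]
  have gU : ∀ x, g (U x) = g x := by simp [U, gs, gu]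
  have hhT : ∀ x, h (T x) = h x := by simp [T, hhs, hht]
  have hhU : ∀ x, h (U x) = !h x := by simp [U, hhs, hhu]
  let r : X → X := fun x => pw s (f x) (pw T (g x) (pw U (h x) x))
  have rs : ∀ x, r (s x) = r x := by
    intro x
    simp only [r, fs, gs, hhs]
    cases f x <;> cases g x <;> cases h x <;> simp [pw, hs, ← sT, ← sU]
  have rT : ∀ x, r (T x) = r x := by
    intro x
    simp only [r, fT, gT, hhT]
    cases f x <;> cases g x <;> cases h x <;> simp [pw, hT, ← TU]
  have rU : ∀ x, r (U x) = r x := by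
    intro x
    simp only [r, fU, gU, hhU]
    cases f x <;> cases g x <;> cases h x <;> simp [pw, hU]
  have rt : ∀ x, r (t x) = r x := by
    intro x; have := rT x; rw [← this]; show _ = r (s (t x)); rw [rs]
  have ru : ∀ x, r (u x) = r x := by
    intro x; have := rU x; rw [← this]; show _ = r (s (u x)); rw [rs]
  have pwr : ∀ a b c x, r (pw s a (pw T b (pw U c x))) = r x := by
    intro a b c x
    cases a <;> cases b <;> cases c <;> simp [pw, rs, rT, rU]
  have pwi : ∀ k : X → X, (∀ x, k (k x) = x) → ∀ a x y, pw k a x = pw k a y → x = y := by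
    intro k hk a x y e
    cases a
    · exact e
    · have e : k x = k y := e
      rw [← hk x, e, hk]
  let z : FactPair X := ⟨(Setoid.ker r, Setoid.ker (fun x => (f x, g x, h x))), by
    constructor
    · intro x y
      constructor
      · rintro ⟨k1, k2⟩
        have k1 : r x = r y := k1
        have k2 : (f x, g x, h x) = (f y, g y, h y) := k2
        simp only [Prod.mk.injEq] at k2
        obtain ⟨l1, l2, l3⟩ := k2
        simp only [r, l1, l2, l3] at k1
        exact pwi _ hU _ _ _ (pwi _ hT _ _ _ (pwi _ hs _ _ _ k1))
      · rintro rfl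
        exact ⟨rfl, rfl⟩
    · intro x y
      refine ⟨pw s (f x ^^ f y) (pw T (g x ^^ g y) (pw U (h x ^^ h y) x)), (pwr _ _ _ _).symm, ?_⟩
      have pf : ∀ (F k : X → X → Prop), True := fun _ _ => trivial
      show (_, _, _) = (_, _, _)
      cases hx1 : f x <;> cases hx2 : g x <;> cases hx3 : h x <;> cases hy1 : f y <;>
        cases hy2 : g y <;> cases hy3 : h y <;>
        simp [pw, fs, fT, fU, gs, gT, gU, hhs, hhT, hhU, hx1, hx2, hx3]⟩
  have orth : ∀ (k : X → X) (hk : ∀ x, k (k x) = x) (fk : ∀ x, f (k x) = !f x),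
      (∀ x, r (k x) = r x) → (∀ x y, g x = g y → g (k x) = g (k y)) →
      (∀ x y, h x = h y → h (k x) = h (k y)) → Orth z (TA.fp ⟨f, k, hk, fk⟩) := by
    intro k hk fk rk gk hhk
    refine ⟨?_, ?_, ?_⟩
    · rintro x y (e | e)
      · subst e; exact (Setoid.ker r).refl' _
      · subst e; exact (rk x).symm
    · intro x y e
      have e : (f x, g x, h x) = (f y, g y, h y) := e
      exact congrArg Prod.fst e
    · rw [comm_iff]
      rintro x y w (e | e) e2
      · subst e; exact ⟨w, e2, Or.inl rfl⟩
      · subst e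
        have e2 : (f (k x), g (k x), h (k x)) = (f w, g w, h w) := e2
        simp only [Prod.mk.injEq] at e2
        obtain ⟨l1, l2, l3⟩ := e2
        refine ⟨k w, ?_, Or.inr (hk w).symm⟩
        show (f x, g x, h x) = (f (k w), g (k w), h (k w))
        have m1 := gk _ _ l2
        have m2 := hhk _ _ l3
        rw [hk] at m1 m2
        rw [m1, m2, fk, ← l1, fk]; simp
  refine ⟨z, ?_, orth s hs fs rs (by simp [gs]) (by simp [hhs]), orth t ht ft rt (by simp [gt])
    (by simp [hht]), orth u hu fu ru (by simp [gu]) (by simp [hhu])⟩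
  intro hz
  obtain ⟨x1, x2, hne, heq⟩ :=
    Finite.exists_ne_map_eq_of_infinite (fun x => (f x, g x, h x))
  have : z.1.2 x1 x2 := heq
  rw [hz] at this
  exact hne this

end FA

namespace FA

theorem ext_inv {X : Type*} (f k : X → Bool) (s : X → X) (hs : ∀ x, s (s x) = x)
    (fs : ∀ x, f (s x) = !f x) (ks : ∀ x, k (s x) = k x)
    (a b : X → X) (ha : Function.Injective a) (hb : Function.Injective b)
    (ha1 : ∀ x, f (a x) = false) (ha2 : ∀ x, k (a x) = true)
    (hb1 : ∀ x, f (b x) = false) (hb2 : ∀ x, k (b x) = false) :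
    ∃ t : X → X, (∀ x, t (t x) = x) ∧ (∀ x, s (t x) = t (s x)) ∧ (∀ x, f (t x) = f x) ∧
      ∀ x, k (t x) = !k x := by
  classical
  let A := {x // f x = false ∧ k x = true}
  let B := {x // f x = false ∧ k x = false}
  let aE : X ↪ A := ⟨fun x => ⟨a x, ha1 x, ha2 x⟩, fun x y h => ha (congrArg Subtype.val h)⟩
  let bE : X ↪ B := ⟨fun x => ⟨b x, hb1 x, hb2 x⟩, fun x y h => hb (congrArg Subtype.val h)⟩
  obtain ⟨ε⟩ : Nonempty (A ≃ B) :=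
    Function.Embedding.antisymm ((Function.Embedding.subtype _).trans bE)
      ((Function.Embedding.subtype _).trans aE)
  let t0 : X → X := fun x => if h : f x = false ∧ k x = true then (ε ⟨x, h⟩).1 else
    if h : f x = false ∧ k x = false then (ε.symm ⟨x, h⟩).1 else x
  have t0A : ∀ x (h : f x = false ∧ k x = true), t0 x = (ε ⟨x, h⟩).1 := fun x h => dif_pos h
  have t0B : ∀ x (h : f x = false ∧ k x = false), t0 x = (ε.symm ⟨x, h⟩).1 := by
    intro x h
    simp [t0, h.1, h.2]
  have cs : ∀ x, f x = false → (f x = false ∧ k x = true) ∨ (f x = false ∧ k x = false) := by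
    intro x h; cases k x <;> simp [h]
  have t01 : ∀ x, f x = false → f (t0 x) = false := by
    intro x h
    rcases cs x h with h | h
    · rw [t0A x h]; exact (ε ⟨x, h⟩).2.1
    · rw [t0B x h]; exact (ε.symm ⟨x, h⟩).2.1
  have t02 : ∀ x, f x = false → k (t0 x) = !k x := by
    intro x h
    rcases cs x h with h | h
    · rw [t0A x h, h.2]; exact (ε ⟨x, h⟩).2.2
    · rw [t0B x h, h.2]; exact (ε.symm ⟨x, h⟩).2.2
  have t03 : ∀ x, f x = false → t0 (t0 x) = x := by
    intro x h
    rcases cs x h with h | h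
    · rw [t0A x h, t0B _ (ε ⟨x, h⟩).2]; simp
    · rw [t0B x h, t0A _ (ε.symm ⟨x, h⟩).2]; simp
  let t : X → X := fun x => cond (f x) (s (t0 (s x))) (t0 x)
  have tf : ∀ x, f x = false → t x = t0 x := fun x h => by simp [t, h]
  have tt : ∀ x, f x = true → t x = s (t0 (s x)) := fun x h => by simp [t, h]
  have fsx : ∀ x, f x = true → f (s x) = false := fun x h => by simp [fs, h]
  have ff : ∀ x, f (t x) = f x := by
    intro x
    cases h : f x
    · rw [tf x h, t01 x h]
    · rw [tt x h, fs, t01 _ (fsx x h)]; rfl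
  refine ⟨t, ?_, ?_, ff, ?_⟩
  · intro x
    have h2 := ff x
    cases h : f x <;> rw [h] at h2
    · rw [tf _ h2, tf x h, t03 x h]
    · rw [tt _ h2, tt x h, hs, t03 _ (fsx x h), hs]
  · intro x
    cases h : f x
    · rw [tf x h, tt (s x) (by simp [fs, h]), hs]
    · rw [tt x h, tf (s x) (fsx x h), hs]
  · intro x
    cases h : f x
    · rw [tf x h, t02 x h]
    · rw [tt x h, ks, t02 _ (fsx x h), ks]

theorem L10 {X : Type*} [Infinite X] (Q : Quad X) : ∃ r, RR Q.a1.fp r ∧ RR Q.b3.fp r ∧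
    ∀ z, Orth z Q.a1.fp → Orth z Q.b3.fp → Orth z r → z = FactZero X := by
  classical
  obtain ⟨f, g, s, t, hs, ht, st, fs, ft, gs, gt⟩ := Q
  let N := {x // f x = false ∧ g x = false}
  let eN : X → N × Bool × Bool := fun x => (⟨pw s (f x) (pw t (g x) x), by
    cases h1 : f x <;> cases h2 : g x <;> simp [pw, fs, ft, gs, gt, h1, h2]⟩, f x, g x)
  have eNi : Function.Injective eN := by
    intro x y h
    simp only [eN, Prod.mk.injEq, Subtype.mk.injEq] at h
    obtain ⟨h1, h2, h3⟩ := h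
    have h1 : pw s (f x) (pw t (g x) x) = pw s (f y) (pw t (g y) y) := congrArg Subtype.val h1
    rw [h2, h3] at h1
    have si : ∀ x y, s x = s y → x = y := fun x y h => by rw [← hs x, h, hs]
    have ti : ∀ x y, t x = t y → x = y := fun x y h => by rw [← ht x, h, ht]
    revert h1
    cases f y <;> cases g y <;> simp only [pw, cond_true, cond_false] <;> intro h1
    · exact h1
    · exact ti _ _ h1
    · exact si _ _ h1
    · exact ti _ _ (si _ _ h1)
  have Ninf : Infinite N := by
    by_contra hN
    rw [not_infinite_iff_finite] at hN
    exact (Finite.of_injective eN eNi).not_infinite inferInstance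
  have lift2 : ∀ Y : Type _, Infinite Y → Nonempty (Y × Bool ≃ Y) := by
    intro Y hY
    apply Cardinal.eq.1
    rw [Cardinal.mk_prod]
    simp only [Cardinal.lift_id, Cardinal.lift_uzero]
    exact Cardinal.mul_eq_left (Cardinal.aleph0_le_mk Y)
      (by simpa using (Cardinal.natCast_lt_aleph0 (n := 2)).le.trans (Cardinal.aleph0_le_mk Y))
      (by simp)
  obtain ⟨e1⟩ := lift2 N Ninf
  obtain ⟨e⟩ := lift2 X inferInstance
  have : ∃ j : X → N, Function.Injective j := by
    refine ⟨fun x => e1 (e1 ((eN x).1, (eN x).2.1), (eN x).2.2), ?_⟩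
    intro x y h
    have h := e1.injective h
    simp only [Prod.mk.injEq, EmbeddingLike.apply_eq_iff_eq] at h
    exact eNi (Prod.ext h.1.1 (Prod.ext h.1.2 h.2))
  obtain ⟨j, hj⟩ := this
  let a : X → X := fun x => (j (e (x, true))).1
  let b : X → X := fun x => (j (e (x, false))).1
  have ha : Function.Injective a := by
    intro x y h
    have := e.injective (hj (Subtype.ext h))
    exact congrArg Prod.fst this
  have hb : Function.Injective b := by
    intro x y h
    have := e.injective (hj (Subtype.ext h))
    exact congrArg Prod.fst this
  have hab : ∀ x y, a x ≠ b y := by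
    intro x y h
    have := e.injective (hj (Subtype.ext h))
    simp at this
  have fa : ∀ x, f (a x) = false := fun x => (j (e (x, true))).2.1
  have ga : ∀ x, g (a x) = false := fun x => (j (e (x, true))).2.2
  have fb : ∀ x, f (b x) = false := fun x => (j (e (x, false))).2.1
  have gb : ∀ x, g (b x) = false := fun x => (j (e (x, false))).2.2
  clear_value a b
  clear hj e e1 lift2 Ninf eNi eN
  obtain ⟨x0, fx0, gx0⟩ : ∃ x0, f x0 = false ∧ g x0 = true := by
    obtain ⟨x⟩ := (inferInstance : Nonempty X)
    exact ⟨t (a x), by simp [ft, fa], by simp [gt, ga]⟩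
  let k : X → Bool := fun x => decide ((x = x0 ∨ s x = x0) ∨ ((∃ y, a y = x) ∨ ∃ y, a y = s x))
  have hk : ∀ x, k x = true ↔ ((x = x0 ∨ s x = x0) ∨ ((∃ y, a y = x) ∨ ∃ y, a y = s x)) :=
    fun x => by simp only [k, decide_eq_true_eq]
  have ks : ∀ x, k (s x) = k x := by
    intro x
    simp only [k, hs]
    apply decide_eq_decide.2; tauto
  have ka : ∀ x, k (a x) = true := by
    intro x; rw [hk]; right; left; exact ⟨x, rfl⟩
  have kb : ∀ x, k (b x) = false := by
    intro x
    simp only [k, decide_eq_false_iff_not]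
    rintro ((h | h) | ⟨y, h⟩ | ⟨y, h⟩)
    · have := gb x; rw [h, gx0] at this; simp at this
    · have := gb x; rw [← gs, h, gx0] at this; simp at this
    · exact hab _ _ h
    · have := fa y; rw [h, fs, fb] at this; simp at this
  clear_value k
  obtain ⟨t1, A1, A2, A3, A4⟩ := ext_inv f k s hs fs ks a b ha hb fa ka fb kb
  obtain ⟨t2, B1, B2, B3, B4⟩ := ext_inv (fun x => f x ^^ g x) (fun x => g x ^^ k x) s hs
    (by simp [fs, gs]) (by simp [ks, gs]) a b ha hb (by simp [fa, ga]) (by simp [ka, ga])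
    (by simp [fb, gb]) (by simp [kb, gb])
  let Q1 : Quad X := ⟨f, k, s, t1, hs, A1, A2, fs, A3, ks, A4⟩
  let Q2 : Quad X := ⟨fun x => f x ^^ g x, fun x => g x ^^ k x, s, t2, hs, B1, B2,
    by simp [fs, gs], B3, by simp [ks, gs], B4⟩
  refine ⟨Q1.b3.fp, L6' Q1, ?_, ?_⟩
  · have h1 := L6' Q2
    have e2 : Q2.b3 = Q1.b3 := by
      simp [Quad.b3, Q1, Q2]
    rw [e2] at h1
    exact h1
  · rintro z ⟨-, h1, -⟩ ⟨-, h2, -⟩ ⟨-, h3, -⟩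
    have key : ∀ y, z.1.2 x0 y → x0 = y := by
      intro y hy
      have k1 : f x0 = f y := h1 hy
      have k2 : (f x0 ^^ g x0) = (f y ^^ g y) := h2 hy
      have k3 : (f x0 ^^ k x0) = (f y ^^ k y) := h3 hy
      have kx0 : k x0 = true := by rw [hk]; simp
      rw [← k1] at k2 k3
      simp only [fx0, gx0, kx0, Bool.false_xor] at k2 k3
      have k3 := (hk y).1 k3.symm
      rw [fx0] at k1
      rcases k3 with (h | h) | ⟨w, h⟩ | ⟨w, h⟩
      · exact h.symm
      · have := fs y; rw [h, fx0, ← k1] at this; simp at this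
      · have := ga w; rw [h, ← k2] at this; simp at this
      · have := ga w; rw [h, gs, ← k2] at this; simp at this
    have key2 : ∀ y, z.1.1 x0 y := by
      intro y
      obtain ⟨w, hw1, hw2⟩ := fp_comp' z x0 y
      rw [← key w hw1] at hw2
      exact hw2
    exact fp_eq_zero fun x y => tr1 _ (key2 x) (key2 y)

end FA

namespace FA

theorem RR_cases' {X : Type*} [Nonempty X] {P : TA X} {q : FactPair X} (h : RR P.fp q) :
    (∃ Q : Quad X, Q.a1 = P ∧ Q.a2.fp = q) ∨ (P.fp.1.2 = q.1.2) := by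
  have h' := h
  obtain ⟨hne, c, d, hcd, hc, hd, hpc, hqc, hpd, hqd⟩ := h
  obtain ⟨Q, rfl, rfl⟩ := quad_of P hc hpc
  obtain ⟨R, hR, rfl⟩ := Q.six_of q hqc
  have fl : ∀ x, Q.s x ≠ x := fun x k => by have := Q.fs x; rw [k] at this; simp at this
  rcases RR_cases h' with ⟨Q2, h1, h2⟩ | ⟨Q2, h1, h2⟩
  · -- same first coordinate
    have e : Q.a1.fp.1.1 = R.fp.1.1 := by rw [← h1, ← h2]; rfl
    obtain ⟨x⟩ := ‹Nonempty X›
    rcases hR with rfl | rfl | rfl | rfl | rfl | rfl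
    · exact absurd rfl hne
    · exfalso
      have : Q.b1.fp.1.1 x (Q.s x) := (Q.gs x).symm
      rw [← e] at this
      have : Q.f x = Q.f (Q.s x) := this
      simp [Q.fs] at this
    · left; exact ⟨Q, rfl, rfl⟩
    · exfalso
      have : Q.a1.fp.1.1 x (Q.t x) := (Q.ft x).symm
      rw [e] at this
      have : (Q.f x ^^ Q.g x) = (Q.f (Q.t x) ^^ Q.g (Q.t x)) := this
      simp [Q.ft, Q.gt] at this
    · exfalso
      have : Q.a3.fp.1.1 x (Q.s x) := (Q.gs x).symm
      rw [← e] at this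
      have : Q.f x = Q.f (Q.s x) := this
      simp [Q.fs] at this
    · right; rfl
  · right; rw [← h1, ← h2]; rfl

theorem F_info {X : Type*} [Nonempty X] {P : TA X} {q : FactPair X} (h : RR P.fp q)
    (e : P.fp.1.1 = q.1.1) : ∃ P' : TA X, P'.fp = q ∧ P'.f = P.f ∧
      (∀ x, P.s (P'.s x) = P'.s (P.s x)) ∧ ∀ x, P.s x ≠ P'.s x := by
  rcases RR_cases' h with ⟨Q, rfl, rfl⟩ | h2
  · refine ⟨Q.a2, rfl, rfl, ?_, ?_⟩
    · intro x; simp [Quad.a1, Quad.a2, Q.st]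
    · intro x k
      have k : Q.s x = Q.s (Q.t x) := k
      have := congrArg Q.g k
      simp [Q.gs, Q.gt] at this
  · exact absurd (Subtype.ext (Prod.ext e h2)) h.1

section aut
variable {X : Type*} {α : FactPair X → FactPair X} (hα : IsFactAut α)

theorem zero_le (x : FactPair X) : FactLE (FactZero X) x := by
  refine ⟨fun {a b} _ => trivial, fun {a b} h => ?_, ?_⟩
  · have h : a = b := h
    subst h; exact x.1.2.refl' _
  · rw [comm_iff]
    intro a b c h k
    have k : b = c := k
    subst k
    exact ⟨a, rfl, h⟩

theorem le_zero {x : FactPair X} (h : FactLE x (FactZero X)) : x = FactZero X :=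
  fp_eq_zero fun _ _ => h.1 trivial

theorem aut_zero {X : Type*} {α : FactPair X → FactPair X} (hα : IsFactAut α) :
    α (FactZero X) = FactZero X := by
  obtain ⟨x, hx⟩ := hα.1.2 (FactZero X)
  apply le_zero
  rw [← hx, ← hα.2.1]
  simpa [hx] using zero_le x

theorem aut_In {X : Type*} {α : FactPair X → FactPair X} (hα : IsFactAut α) (p c : FactPair X) :
    In (α p) (α c) ↔ In p c := by
  unfold In FactLT
  rw [← hα.2.1, Ne, Ne, hα.1.1.eq_iff]
  conv_lhs => rw [← aut_zero hα, hα.1.1.eq_iff]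

theorem aut_Orth {X : Type*} {α : FactPair X → FactPair X} (hα : IsFactAut α) (p c : FactPair X) :
    Orth (α p) (α c) ↔ Orth p c := by
  unfold Orth
  rw [← hα.2.2, ← hα.2.1]

theorem aut_KK {X : Type*} {α : FactPair X → FactPair X} (hα : IsFactAut α) (c : FactPair X) :
    KK (α c) ↔ KK c := by
  unfold KK
  constructor
  · intro h x1 x2 x3 x4
    have := h (α x1) (α x2) (α x3) (α x4)
    simpa only [aut_In hα, aut_Orth hα, hα.1.1.eq_iff] using this
  · intro h y1 y2 y3 y4
    obtain ⟨x1, rfl⟩ := hα.1.2 y1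
    obtain ⟨x2, rfl⟩ := hα.1.2 y2
    obtain ⟨x3, rfl⟩ := hα.1.2 y3
    obtain ⟨x4, rfl⟩ := hα.1.2 y4
    simpa only [aut_In hα, aut_Orth hα, hα.1.1.eq_iff] using h x1 x2 x3 x4

theorem aut_RR {X : Type*} {α : FactPair X → FactPair X} (hα : IsFactAut α) (p q : FactPair X) :
    RR (α p) (α q) ↔ RR p q := by
  unfold RR
  constructor
  · rintro ⟨h1, c, d, h2⟩
    obtain ⟨c, rfl⟩ := hα.1.2 c
    obtain ⟨d, rfl⟩ := hα.1.2 d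
    simp only [aut_In hα, aut_KK hα, Ne, hα.1.1.eq_iff] at h1 h2
    exact ⟨h1, c, d, h2⟩
  · rintro ⟨h1, c, d, h2⟩
    refine ⟨?_, α c, α d, ?_⟩
    · simpa only [Ne, hα.1.1.eq_iff] using h1
    · simpa only [aut_In hα, aut_KK hα, Ne, hα.1.1.eq_iff] using h2

end aut

theorem F_step {X : Type*} [Infinite X] {α : FactPair X → FactPair X} (hα : IsFactAut α)
    {p q : FactPair X} (h : RR p q) (e : p.1.1 = q.1.1) : (α p).1.1 = (α q).1.1 := by
  rcases RR_cases ((aut_RR hα p q).2 h) with ⟨Q, h1, h2⟩ | ⟨Q, h1, h2⟩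
  · rw [← h1, ← h2]; rfl
  exfalso
  obtain ⟨r', r1, r2, r3⟩ := L10 Q
  obtain ⟨r, rfl⟩ := hα.1.2 r'
  rw [h1, aut_RR hα] at r1
  rw [h2, aut_RR hα] at r2
  have ext : ∀ a b : FactPair X, a.1.1 = b.1.1 → a.1.2 = b.1.2 → a = b :=
    fun a b h k => Subtype.ext (Prod.ext h k)
  have cs : ∀ a b : FactPair X, RR a b → a.1.1 = b.1.1 ∨ a.1.2 = b.1.2 := by
    intro a b hab
    rcases RR_cases hab with ⟨Q, h1, h2⟩ | ⟨Q, h1, h2⟩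
    · left; rw [← h1, ← h2]; rfl
    · right; rw [← h1, ← h2]; rfl
  have pr : p.1.1 = r.1.1 := by
    rcases cs _ _ r1 with k | k
    · exact k
    · rcases cs _ _ r2 with l | l
      · exact e.trans l
      · exact absurd (ext _ _ e (k.trans l.symm)) h.1
  obtain ⟨P, rfl⟩ : ∃ P : TA X, P.fp = p := by
    obtain ⟨_, c, d, _, hc, _, hp, _⟩ := h
    exact two_class hc hp
  obtain ⟨P1, rfl, f1, c1, n1⟩ := F_info h e
  obtain ⟨P2, rfl, f2, c2, n2⟩ := F_info r1 pr
  obtain ⟨P3, f3, f4, c3, n3⟩ := F_info r2 (e.symm.trans pr)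
  have e3 : ∀ x, P3.s x = P2.s x := by
    intro x
    have : P3.fp.1.2 x (P3.s x) := Or.inr rfl
    rw [f3] at this
    rcases this with k | k
    · have := P3.hf x; rw [k] at this; simp at this
    · exact k
  have e3 : P3.s = P2.s := funext e3
  rw [e3] at c3 n3
  obtain ⟨f, s, hs, fs⟩ := P
  obtain ⟨f1, t, ht, ft⟩ := P1
  obtain ⟨f2, u, hu, fu⟩ := P2
  simp only at *
  subst f1
  subst f2
  obtain ⟨z, z0, z1, z2, z3⟩ := L7 _ s t u hs ht hu fs ft fu c1 c2 c3 n1 n2 n3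
  apply z0
  apply hα.1.1
  rw [aut_zero hα]
  apply r3
  · rw [h1, aut_Orth hα]; exact z1
  · rw [h2, aut_Orth hα]; exact z2
  · rw [aut_Orth hα]; exact z3

end FA

namespace FA

theorem dihedral {X : Type*} (f bb : X → Bool) (lev : X → ℤ) (s t σ : X → X)
    (hs : ∀ x, s (s x) = x) (ht : ∀ x, t (t x) = x) (hσ : ∀ x, σ (σ x) = x)
    (sσ : ∀ x, s (σ x) = σ (s x))
    (fs : ∀ x, f (s x) = !f x) (ft : ∀ x, f (t x) = !f x) (fσ : ∀ x, f (σ x) = !f x)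
    (ls : ∀ x, lev (s x) = -lev x) (lt : ∀ x, lev (t x) = -lev x - 1)
    (lσ : ∀ x, lev (σ x) = -lev x)
    (bs : ∀ x, bb (s x) = bb x) (bt : ∀ x, bb (t x) = bb x) (bσ : ∀ x, bb (σ x) = !bb x) :
    ∃ u : X → X, (∀ x, u (u x) = x) ∧ (∀ x, f (u x) = !f x) ∧ (∀ x, bb (u x) = !bb x) ∧
      (∀ x, s (u x) = u (s x)) ∧ (∀ x, t (u x) = u (t x)) := by
  let S : Equiv.Perm X := ⟨s, s, hs, hs⟩
  let T : Equiv.Perm X := ⟨t, t, ht, ht⟩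
  have SS : S * S = 1 := Equiv.ext hs
  have TT : T * T = 1 := Equiv.ext ht
  let ω : Equiv.Perm X := S * T
  have ωx : ∀ x, ω x = s (t x) := fun x => rfl
  have ωi : ω⁻¹ = T * S := by
    rw [inv_eq_iff_mul_eq_one]
    show S * T * (T * S) = 1
    rw [mul_assoc, ← mul_assoc T T S, TT, one_mul, SS]
  have semi : SemiconjBy S ω ω⁻¹ := by
    rw [ωi]
    show S * (S * T) = T * S * S
    rw [← mul_assoc, SS, mul_assoc, SS, one_mul, mul_one]
  have sz : ∀ (m : ℤ) x, s ((ω ^ m) x) = (ω ^ (-m)) (s x) := by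
    intro m x
    have := (semi.zpow_right m).eq
    have := congrArg (fun e : Equiv.Perm X => e x) this
    rw [inv_zpow, ← zpow_neg] at this
    exact this
  have levω : ∀ (m : ℤ) x, lev ((ω ^ m) x) = lev x + m := by
    have l1 : ∀ x, lev (ω x) = lev x + 1 := fun x => by rw [ωx, ls, lt]; ring
    have l2 : ∀ x, lev (ω⁻¹ x) = lev x - 1 := fun x => by
      have := l1 (ω⁻¹ x); rw [show ω (ω⁻¹ x) = x from Equiv.apply_symm_apply ω x] at this; rw [this]; ring
    intro m
    induction m using Int.induction_on with
    | zero => simp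
    | succ i ih => intro x; rw [zpow_add_one, Equiv.Perm.mul_apply, ih, l1]; ring
    | pred i ih => intro x; rw [zpow_sub_one, Equiv.Perm.mul_apply, ih, l2]; ring
  have invω : ∀ F : X → Bool, (∀ x, F (ω x) = F x) → ∀ (m : ℤ) x, F ((ω ^ m) x) = F x := by
    intro F l1
    have l2 : ∀ x, F (ω⁻¹ x) = F x := fun x => by
      have := l1 (ω⁻¹ x); rw [show ω (ω⁻¹ x) = x from Equiv.apply_symm_apply ω x] at this; rw [this]
    intro m
    induction m using Int.induction_on with
    | zero => simp
    | succ i ih => intro x; rw [zpow_add_one, Equiv.Perm.mul_apply, ih, l1]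
    | pred i ih => intro x; rw [zpow_sub_one, Equiv.Perm.mul_apply, ih, l2]
  have fω := invω f (fun x => by rw [ωx, fs, ft, Bool.not_not])
  have bω := invω bb (fun x => by rw [ωx, bs, bt])
  let u : X → X := fun x => (ω ^ lev x) (σ ((ω ^ (-lev x)) x))
  have ux : ∀ x, u x = (ω ^ lev x) (σ ((ω ^ (-lev x)) x)) := fun x => rfl
  have levu : ∀ x, lev (u x) = lev x := by
    intro x; rw [ux, levω, lσ, levω]; ring
  have us : ∀ x, s (u x) = u (s x) := by
    intro x
    rw [ux, ux, ls, sz, sσ, sz, neg_neg]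
  have uω : ∀ x, ω (u x) = u (ω x) := by
    intro x
    have l1 : lev (ω x) = lev x + 1 := by rw [ωx, ls, lt]; ring
    rw [ux, ux, l1]
    have e1 : (ω ^ (-(lev x + 1))) (ω x) = (ω ^ (-lev x)) x := by
      rw [← Equiv.Perm.mul_apply, ← zpow_add_one]; congr 2; ring
    rw [e1, ← Equiv.Perm.mul_apply, ← zpow_one_add, add_comm]
  refine ⟨u, ?_, ?_, ?_, us, ?_⟩
  · intro x
    rw [ux (u x), levu, ux x]
    have e1 : ∀ y, (ω ^ (-lev x)) ((ω ^ lev x) y) = y := by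
      intro y; rw [← Equiv.Perm.mul_apply, ← zpow_add]; simp
    have e2 : ∀ y, (ω ^ (lev x)) ((ω ^ (-lev x)) y) = y := by
      intro y; rw [← Equiv.Perm.mul_apply, ← zpow_add]; simp
    rw [e1, hσ, e2]
  · intro x; rw [ux, fω, fσ, fω]
  · intro x; rw [ux, bω, bσ, bω]
  · intro x
    have tω : ∀ x, t x = s (ω x) := fun x => by rw [ωx, hs]
    rw [tω, tω, uω, us]

theorem quot_data {A : Type*} [Infinite A] (f : A → Bool) (κ : A → A) (hκ : ∀ x, κ (κ x) = x)
    (fκ : ∀ x, f (κ x) = !f x) : ∃ (κ' β : A → A) (m : A → ℤ) (b : A → Bool),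
      (∀ x, κ' (κ' x) = x) ∧ (∀ x, β (β x) = x) ∧ (∀ x, κ (β x) = β (κ x)) ∧
      (∀ x, f (κ' x) = !f x) ∧ (∀ x, f (β x) = f x) ∧
      (∀ x, m (κ x) = - m x) ∧ (∀ x, m (κ' x) = - m x - 1) ∧ (∀ x, m (β x) = m x) ∧
      (∀ x, b (κ x) = b x) ∧ (∀ x, b (κ' x) = b x) ∧ (∀ x, b (β x) = !b x) := by
  classical
  let A0 := {x // f x = false}
  let r : A → A0 := fun x => ⟨pw κ (f x) x, by cases h : f x <;> simp [pw, fκ, h]⟩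
  have rv : ∀ x, (r x).1 = pw κ (f x) x := fun x => rfl
  have rκ : ∀ x, r (κ x) = r x := by
    intro x; apply Subtype.ext; rw [rv, rv, fκ]
    cases f x <;> simp [pw, hκ]
  have back : ∀ x, pw κ (f x) (r x).1 = x := by
    intro x; rw [rv]; cases f x <;> simp [pw, hκ]
  have fw : ∀ (i : Bool) (y : A0), f (pw κ i y.1) = i := by
    intro i y; cases i <;> simp [pw, fκ, y.2]
  have rw' : ∀ (i : Bool) (y : A0), r (pw κ i y.1) = y := by
    intro i y; apply Subtype.ext; rw [rv, fw]; cases i <;> simp [pw, hκ]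
  have κpw : ∀ i y, κ (pw κ i y) = pw κ (!i) y := by
    intro i y; cases i <;> simp [pw, hκ]
  have A0inf : Infinite A0 := by
    by_contra hN
    rw [not_infinite_iff_finite] at hN
    refine (Finite.of_injective (fun x => (r x, f x)) ?_).not_infinite ‹Infinite A›
    intro x y h
    simp only [Prod.mk.injEq] at h
    rw [← back x, ← back y, h.1, h.2]
  obtain ⟨ν⟩ : Nonempty (A0 ≃ (ℤ × Bool) × A0) := by
    apply Cardinal.eq.1
    rw [Cardinal.mk_prod]
    symm
    simp only [Cardinal.lift_uzero]
    apply Cardinal.mul_eq_right (Cardinal.aleph0_le_mk A0)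
    · simp
    · simp [Cardinal.aleph0_ne_zero]
  have νe : ∀ y : A0, ν.symm (((ν y).1.1, (ν y).1.2), (ν y).2) = y := fun y => by simp
  let sg : Bool → ℤ → ℤ := fun i m => cond i (-m) m
  have sgn : ∀ i m, sg (!i) m = - sg i m := by intro i m; cases i <;> simp [sg]
  have sgsg : ∀ i m, sg i (sg i m) = m := by intro i m; cases i <;> simp [sg]
  -- point with coordinates
  let mkp : Bool → ℤ → Bool → A0 → A := fun i m b e => pw κ i (ν.symm ((sg i m, b), e)).1
  let m : A → ℤ := fun x => sg (f x) (ν (r x)).1.1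
  let b : A → Bool := fun x => (ν (r x)).1.2
  let e : A → A0 := fun x => (ν (r x)).2
  have fmk : ∀ i n c y, f (mkp i n c y) = i := fun i n c y => fw _ _
  have rmk : ∀ i n c y, r (mkp i n c y) = ν.symm ((sg i n, c), y) := fun i n c y => rw' _ _
  have mmk : ∀ i n c y, m (mkp i n c y) = n := by
    intro i n c y; simp only [m, fmk, rmk, Equiv.apply_symm_apply, sgsg]
  have bmk : ∀ i n c y, b (mkp i n c y) = c := by
    intro i n c y; simp only [b, rmk, Equiv.apply_symm_apply]
  have emk : ∀ i n c y, e (mkp i n c y) = y := by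
    intro i n c y; simp only [e, rmk, Equiv.apply_symm_apply]
  have mk_self : ∀ x, mkp (f x) (m x) (b x) (e x) = x := by
    intro x
    simp only [mkp, m, b, e, sgsg]
    rw [νe, back]
  have κmk : ∀ x, κ x = mkp (!f x) (- m x) (b x) (e x) := by
    intro x
    conv_lhs => rw [← mk_self x]
    simp only [mkp, κpw]
    congr 4
    rw [sgn]
    cases f x <;> simp [sg]
  clear_value mkp m b e
  refine ⟨fun x => mkp (!f x) (- m x - 1) (b x) (e x), fun x => mkp (f x) (m x) (!b x) (e x), m, b,
    ?_, ?_, ?_, ?_, ?_, ?_, ?_, ?_, ?_, ?_, ?_⟩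
  · intro x
    simp only [fmk, mmk, bmk, emk, Bool.not_not]
    conv_rhs => rw [← mk_self x]
    congr 1; ring
  · intro x
    simp only [fmk, mmk, bmk, emk, Bool.not_not, mk_self]
  · intro x; simp only [κmk, fmk, mmk, bmk, emk]
  · intro x; simp only [fmk]
  · intro x; simp only [fmk]
  · intro x; simp only [κmk, mmk]
  · intro x; simp only [mmk]
  · intro x; simp only [mmk]
  · intro x; simp only [κmk, bmk]
  · intro x; simp only [bmk]
  · intro x; simp only [bmk]

theorem exists_lift {X : Type*} (a : FactPair X) (κ : Quotient a.1.1 → Quotient a.1.1) :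
    ∃ s : X → X, (∀ x, Quotient.mk a.1.1 (s x) = κ (Quotient.mk a.1.1 x)) ∧
      ∀ x, a.1.2 x (s x) := by
  have : ∀ x, ∃ y, Quotient.mk a.1.1 y = κ (Quotient.mk a.1.1 x) ∧ a.1.2 x y := by
    intro x
    obtain ⟨m, hm⟩ := Quotient.exists_rep (κ (Quotient.mk a.1.1 x))
    obtain ⟨z, hz1, hz2⟩ := fp_comp' a x m
    exact ⟨z, by rw [← hm]; exact Quotient.sound hz2, hz1⟩
  choose s h1 h2 using this
  exact ⟨s, h1, h2⟩

theorem lift_uniq {X : Type*} (a : FactPair X) {x y : X}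
    (h : Quotient.mk a.1.1 x = Quotient.mk a.1.1 y) (k : a.1.2 x y) : x = y :=
  (a.2.1 _ _).1 ⟨Quotient.exact h, k⟩

theorem TA_lift {X : Type*} (a : FactPair X) (f : Quotient a.1.1 → Bool)
    (κ : Quotient a.1.1 → Quotient a.1.1) (hκ : ∀ x, κ (κ x) = x) (fκ : ∀ x, f (κ x) = !f x) :
    ∃ P : TA X, FactLE P.fp a ∧ (∀ x, P.f x = f (Quotient.mk a.1.1 x)) ∧
      (∀ x, Quotient.mk a.1.1 (P.s x) = κ (Quotient.mk a.1.1 x)) := by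
  obtain ⟨s, h1, h2⟩ := exists_lift a κ
  refine ⟨⟨fun x => f (Quotient.mk a.1.1 x), s, ?_, ?_⟩, ?_, fun _ => rfl, h1⟩
  · intro x
    symm
    apply lift_uniq a
    · rw [h1, h1, hκ]
    · exact tr2 _ (h2 x) (h2 _)
  · intro x; simp only [h1, fκ]
  · rw [TA.le_iff]
    refine ⟨?_, h2, ?_⟩
    · intro x y hxy
      exact congrArg f (Quotient.sound hxy)
    · intro x y hxy
      apply Quotient.exact (s := a.1.1)
      show Quotient.mk a.1.1 (s x) = Quotient.mk a.1.1 (s y)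
      rw [h1, h1, Quotient.sound hxy]

theorem L8 {X : Type*} [Infinite X] (P : TA X) (a b : FactPair X) (hab : a.1.1 = b.1.1)
    (hinf : Infinite (Quotient a.1.1)) (hP : FactLE P.fp a) :
    ∃ U T : TA X, RR P.fp U.fp ∧ RR U.fp T.fp ∧ FactLE T.fp b ∧ P.fp.1.1 = U.fp.1.1 ∧
      U.fp.1.1 = T.fp.1.1 := by
  obtain ⟨⟨θ, θ'⟩, ha⟩ := a
  obtain ⟨⟨θ2, θ''⟩, hb⟩ := b
  simp only at hab hinf
  subst hab
  obtain ⟨p1, p2, p3⟩ := (TA.le_iff _ _).1 hP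
  let mk : X → Quotient θ := fun x => Quotient.mk θ x
  let f : Quotient θ → Bool := Quotient.lift P.f (fun x y h => p1 x y h)
  let κ : Quotient θ → Quotient θ := Quotient.map P.s (fun x y h => p3 x y h)
  have fmk : ∀ x, f (mk x) = P.f x := fun x => rfl
  have κmk : ∀ x, κ (mk x) = mk (P.s x) := fun x => rfl
  have hκ : ∀ x, κ (κ x) = x := by
    intro x
    obtain ⟨x, rfl⟩ := Quotient.exists_rep x
    show κ (κ (mk x)) = mk x
    rw [κmk, κmk, P.hs]
  have fκ : ∀ x, f (κ x) = !f x := by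
    intro x
    obtain ⟨x, rfl⟩ := Quotient.exists_rep x
    show f (κ (mk x)) = !f (mk x)
    rw [κmk, fmk, fmk, P.hf]
  obtain ⟨κ', β, m, c, h1, h2, h3, h4, h5, h6, h7, h8, h9, h10, h11⟩ := quot_data f κ hκ fκ
  obtain ⟨T, t1, t2, t3⟩ := TA_lift ⟨(θ, θ''), hb⟩ f κ' h1 h4
  obtain ⟨B, b1, b2⟩ := exists_lift ⟨(θ, θ'), ha⟩ β
  have t2 : ∀ x, T.f x = f (mk x) := t2
  have t3 : ∀ x, mk (T.s x) = κ' (mk x) := t3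
  have b1 : ∀ x, mk (B x) = β (mk x) := b1
  have BB : ∀ x, B (B x) = x := by
    intro x
    symm
    apply lift_uniq ⟨(θ, θ'), ha⟩
    · show mk x = mk (B (B x))
      rw [b1, b1, h2]
    · exact tr2 _ (b2 x) (b2 _)
  have sB : ∀ x, P.s (B x) = B (P.s x) := by
    intro x
    apply lift_uniq ⟨(θ, θ'), ha⟩
    · show mk _ = mk _
      rw [← κmk, b1, b1, ← κmk, h3]
    · exact tr1 _ (tr2 _ (b2 x) (p2 _)) (tr2 _ (p2 x) (b2 _))
  have fB : ∀ x, P.f (B x) = P.f x := by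
    intro x; rw [← fmk, b1, h5, fmk]
  have Tf : T.f = P.f := by
    funext x; rw [t2, fmk]
  obtain ⟨u, u1, u2, u3, u4, u5⟩ := dihedral P.f (fun x => c (mk x)) (fun x => m (mk x)) P.s T.s
    (fun x => P.s (B x)) P.hs T.hs (fun x => by simp only [sB, P.hs, BB]) (fun x => by rw [← sB])
    P.hf (fun x => by rw [← Tf, T.hf]) (fun x => by rw [P.hf, fB])
    (fun x => by rw [← κmk, h6]) (fun x => by rw [t3, h7])
    (fun x => by rw [← κmk, h6, b1, h8])
    (fun x => by rw [← κmk, h9]) (fun x => by rw [t3, h10])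
    (fun x => by rw [← κmk, h9, b1, h11])
  refine ⟨⟨P.f, u, u1, u2⟩, T, ?_, ?_, t1, rfl, ?_⟩
  · refine L6 P ⟨P.f, u, u1, u2⟩ rfl u4 ?_
    intro x k
    have k : P.s x = u x := k
    have := u3 x
    rw [← k, ← κmk, h9] at this
    simp at this
  · refine L6 ⟨P.f, u, u1, u2⟩ T Tf.symm (fun x => (u5 x).symm) ?_
    intro x k
    have k : u x = T.s x := k
    have := u3 x
    rw [k, t3, h10] at this
    simp at this
  · ext x y
    show P.f x = P.f y ↔ T.f x = T.f y
    rw [Tf]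

theorem exists_TA_le {X : Type*} (a : FactPair X) (hinf : Infinite (Quotient a.1.1)) :
    ∃ P : TA X, FactLE P.fp a := by
  obtain ⟨e⟩ : Nonempty (Quotient a.1.1 ≃ Quotient a.1.1 × Bool) := by
    apply Cardinal.eq.1
    rw [Cardinal.mk_prod]
    symm
    simp only [Cardinal.lift_uzero]
    exact Cardinal.mul_eq_left (Cardinal.aleph0_le_mk _)
      (by simpa using (Cardinal.natCast_lt_aleph0 (n := 2)).le.trans (Cardinal.aleph0_le_mk _))
      (by simp)
  obtain ⟨P, h, -⟩ := TA_lift a (fun x => (e x).2) (fun x => e.symm ((e x).1, !(e x).2))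
    (by intro x; simp) (by intro x; simp)
  exact ⟨P, h⟩

theorem TA_two {X : Type*} [Infinite X] (P : TA X) : ∃ c, KK c ∧ In P.fp c := by
  have : Infinite (Quotient (FactOne X).1.1) := by
    apply Infinite.of_injective (fun x : X => Quotient.mk (FactOne X).1.1 x)
    intro x y h
    exact Quotient.exact h
  obtain ⟨U, T, ⟨_, c, d, _, hc, _, h1, _⟩, -⟩ := L8 P (FactOne X) (FactOne X) rfl this (by
    rw [TA.le_iff]
    refine ⟨?_, fun _ => trivial, ?_⟩
    · intro x y h
      have h : x = y := h
      rw [h]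
    · intro x y h
      have h : x = y := h
      rw [h])
  exact ⟨c, hc, h1⟩

theorem L9 {X : Type*} (P : TA X) (a : FactPair X) (hP : FactLE P.fp a) (x y : X)
    (hxy : ¬ a.1.1 x y) : ∃ P' : TA X, FactLE P'.fp a ∧ P'.f x ≠ P'.f y := by
  classical
  by_cases h : P.f x ≠ P.f y
  · exact ⟨P, hP, h⟩
  push Not at h
  obtain ⟨p1, p2, p3⟩ := (TA.le_iff _ _).1 hP
  let k : X → Bool := fun z => decide (a.1.1 z y ∨ a.1.1 (P.s z) y)
  have ks : ∀ z, k (P.s z) = k z := by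
    intro z; simp only [k, P.hs]; apply decide_eq_decide.2; tauto
  have ka : ∀ z w, a.1.1 z w → k z = k w := by
    intro z w hzw
    simp only [k]
    apply decide_eq_decide.2
    have e1 : a.1.1 z y ↔ a.1.1 w y := ⟨fun l => tr1 _ hzw l, fun l => tr2 _ hzw l⟩
    have hs := p3 _ _ hzw
    have e2 : a.1.1 (P.s z) y ↔ a.1.1 (P.s w) y := ⟨fun l => tr1 _ hs l, fun l => tr2 _ hs l⟩
    rw [e1, e2]
  refine ⟨⟨fun z => P.f z ^^ k z, P.s, P.hs, by simp [ks, P.hf]⟩, ?_, ?_⟩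
  · rw [TA.le_iff]
    refine ⟨fun z w hzw => ?_, p2, p3⟩
    simp only [p1 _ _ hzw, ka _ _ hzw]
  · have ky : k y = true := by
      simp only [k, decide_eq_true_eq]; left; exact a.1.1.refl' _
    have kx : k x = false := by
      simp only [k, decide_eq_false_iff_not]
      rintro (l | l)
      · exact hxy l
      · have := p1 _ _ l
        rw [P.hf, h] at this
        simp at this
    simp [h, kx, ky]

theorem main_le {X : Type*} [Infinite X]
    (α : FactPair X → FactPair X) (hα : IsFactAut α) (a b : FactPair X)
    (hfst : a.1.1 = b.1.1) (hinf : Infinite (Quotient a.1.1)) :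
    (α b).1.1 ≤ (α a).1.1 := by
  intro x y hxy
  by_contra hn
  have two : ∀ p : FactPair X, (∃ P : TA X, P.fp = α p) ↔ ∃ P : TA X, P.fp = p := by
    intro p
    constructor
    · rintro ⟨P, hP⟩
      obtain ⟨c, hc, h1⟩ := TA_two P
      obtain ⟨c, rfl⟩ := hα.1.2 c
      rw [hP, aut_In hα] at h1
      rw [aut_KK hα] at hc
      exact two_class hc h1
    · rintro ⟨P, hP⟩
      obtain ⟨c, hc, h1⟩ := TA_two P
      rw [hP, ← aut_In hα] at h1
      rw [← aut_KK hα] at hc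
      exact two_class hc h1
  obtain ⟨P0, h0⟩ := exists_TA_le a hinf
  obtain ⟨P1, h1⟩ := (two P0.fp).2 ⟨P0, rfl⟩
  rw [hα.2.1, ← h1] at h0
  obtain ⟨P2, h2, h3⟩ := L9 P1 (α a) h0 x y hn
  obtain ⟨p, hp⟩ := hα.1.2 P2.fp
  obtain ⟨P, rfl⟩ := (two p).1 ⟨P2, hp.symm⟩
  rw [← hp, ← hα.2.1] at h2
  obtain ⟨U, T, r1, r2, r3, e1, e2⟩ := L8 P a b hfst hinf h2
  have k1 := F_step hα r1 e1
  have k2 := F_step hα r2 e2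
  rw [hα.2.1] at r3
  have := r3.1 hxy
  rw [← k2, ← k1, hp] at this
  exact h3 this

end FA

theorem factAut_same_first_coord (X : Type*) [Infinite X]
    (α : FactPair X → FactPair X) (hα : IsFactAut α) (a b : FactPair X)
    (hfst : a.1.1 = b.1.1) (hinf : Infinite (Quotient a.1.1)) :
    (α a).1.1 = (α b).1.1 := by
  apply le_antisymm
  · exact FA.main_le α hα b a hfst.symm (hfst ▸ hinf)
  · exact FA.main_le α hα a b hfst hinf
end
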